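/- Given s ∈ (0,1), 0 < λ ≤ Λ, and Lipschitz functions f and g_A (A ∈ 𝒜) in B_R ⊂ ℝ^n satisfying the continuity assumption in A, let u ∈ C^∞(ℝ^n) ∩ W^{2,∞}(ℝ^n) be a solution of sup_{A∈𝒜}( 𝓛_A u(x) − g_A(x) ) = f(x) for all x ∈ B_R. Then sup_{B_{R/2}} |∇u| ≤ (C/R)( ‖u‖_{L^∞(ℝ^n)} + R^s G₀^{1/2} ‖u‖_{L^∞(B_R)}^{1/2} + R^{1+2s} G₁ ) for some constant C depending only on n, λ, and Λ. If, in addition, f + g_A is semiconcave in B_R for every A ∈ 𝒜, then for every e ∈ ℝ^n with |e| = 1, sup_{B_{R/2}} ∂²_e u ≤ (C/R²)( ‖u‖_{L^∞(ℝ^n)} + R^s G₀^{1/2} ‖u‖_{L^∞(B_R)}^{1/2} + R^{1+2s} G_{e,1} + R^{2+2s} G_{e,2} ), with C as before. -/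

import Mathlib

open MeasureTheory Filter Metric Set

noncomputable section

/-- Euclidean space `ℝⁿ`. -/
abbrev En (n : ℕ) := EuclideanSpace ℝ (Fin n)

/-- Principal value integral centered at `x`: the limit, as `ε → 0⁺`, of the integrals
over the complement of the `ε`-ball centered at `x`. -/
def pvAt (n : ℕ) (x : En n) (g : En n → ℝ) : ℝ :=
  limUnder (nhdsWithin (0:ℝ) (Set.Ioi 0))
    (fun ε => ∫ y in {y : En n | ε ≤ dist y x}, g y)

/-- Integro-differential operator with kernel `K`:
`𝓛_K u (x) = P.V. ∫ (u x - u y) K (x - y) dy`. -/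
def opK (n : ℕ) (K : En n → ℝ) (u : En n → ℝ) (x : En n) : ℝ :=
  pvAt n x (fun y => (u x - u y) * K (x - y))

/-- The normalizing constant `c_{n,s}` of the fractional Laplacian, for which the
Fourier symbol is `|ξ|^{2s}`. -/
def cns (n : ℕ) (s : ℝ) : ℝ :=
  (4:ℝ) ^ s * s * Real.Gamma ((n:ℝ)/2 + s) / (Real.pi ^ ((n:ℝ)/2) * Real.Gamma (1 - s))

/-- The fractional Laplacian `(-Δ)^s`, for `s ∈ (0,1)`. -/
def fracLap (n : ℕ) (s : ℝ) (u : En n → ℝ) (x : En n) : ℝ :=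
  opK n (fun z => cns n s * ‖z‖ ^ (-((n:ℝ) + 2*s))) u x

/-- Directional derivative `∂_e u`. -/
def dd (n : ℕ) (e : En n) (u : En n → ℝ) (x : En n) : ℝ := fderiv ℝ u x e

/-- Second directional derivative `∂²_e u`. -/
def dd2 (n : ℕ) (e : En n) (u : En n → ℝ) (x : En n) : ℝ := fderiv ℝ (dd n e u) x e

/-- `‖η‖_{C²(ℝⁿ)} ≤ M`. -/
def C2BddBy (n : ℕ) (η : En n → ℝ) (M : ℝ) : Prop :=
  ∀ x : En n, |η x| ≤ M ∧ ‖fderiv ℝ η x‖ ≤ M ∧ ‖fderiv ℝ (fderiv ℝ η) x‖ ≤ M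

/-- The kernel `K` is even and has two-sided power bounds with constants `C₁ ≤ C₂`:
`K(z) = K(-z)` and `C₁ s(1-s)|z|^{-n-2s} ≤ K(z) ≤ C₂ s(1-s)|z|^{-n-2s}` for `z ≠ 0`. -/
def evenPowKernel (n : ℕ) (s C₁ C₂ : ℝ) (K : En n → ℝ) : Prop :=
  (∀ z : En n, z ≠ 0 → K z = K (-z)) ∧
  (∀ z : En n, z ≠ 0 →
    C₁ * (s * (1 - s)) * ‖z‖ ^ (-((n:ℝ) + 2*s)) ≤ K z ∧
    K z ≤ C₂ * (s * (1 - s)) * ‖z‖ ^ (-((n:ℝ) + 2*s)))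

/-- `K ∈ C²(ℝⁿ \ {0})` with `|z||∇K(z)| + |z|²|D²K(z)| ≤ C₃ K(z)` for `z ≠ 0`. -/
def kernelDerivBdd (n : ℕ) (C₃ : ℝ) (K : En n → ℝ) : Prop :=
  ContDiffOn ℝ 2 K {z : En n | z ≠ 0} ∧
  ∀ z : En n, z ≠ 0 →
    ‖z‖ * ‖fderiv ℝ K z‖ + ‖z‖^2 * ‖fderiv ℝ (fderiv ℝ K) z‖ ≤ C₃ * K z

open scoped NNReal

/-- `A` belongs to the class `𝒜_{λ,Λ}`: symmetric with eigenvalues in `[λ,Λ]`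
(equivalently, `λ|v|² ≤ ⟨Av,v⟩ ≤ Λ|v|²` for all `v`). -/
def inEllipticClass (n : ℕ) (lam Lam : ℝ) (A : Matrix (Fin n) (Fin n) ℝ) : Prop :=
  A.IsSymm ∧ ∀ v : Fin n → ℝ,
    lam * (∑ i, v i ^ 2) ≤ ∑ i, A.mulVec v i * v i ∧
    ∑ i, A.mulVec v i * v i ≤ Lam * (∑ i, v i ^ 2)

/-- The Euclidean norm `|Az|`. -/
def anorm (n : ℕ) (A : Matrix (Fin n) (Fin n) ℝ) (z : En n) : ℝ :=
  Real.sqrt (∑ i, (A.mulVec (fun j => z j) i) ^ 2)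

/-- The operator `𝓛_A u(x) = c_{n,s} P.V. ∫ (u(x)−u(y))/|A(x−y)|^{n+2s} dy`. -/
def opA (n : ℕ) (s : ℝ) (A : Matrix (Fin n) (Fin n) ℝ) (u : En n → ℝ) (x : En n) : ℝ :=
  opK n (fun z => cns n s * (anorm n A z) ^ (-((n:ℝ) + 2*s))) u x

/-- The surface-measure constant `n |B₁|` of `ℝⁿ`. -/
def sphereMass (n : ℕ) : ℝ := n * (volume : Measure (En n)).real (ball 0 1)

lemma sphereMass_pos {n : ℕ} (hn : 0 < n) : 0 < sphereMass n := by
  unfold sphereMass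
  have h : 0 < (volume : Measure (En n)).real (ball 0 1) :=
    ENNReal.toReal_pos (measure_ball_pos _ _ one_pos).ne' measure_ball_lt_top.ne
  positivity

lemma nontrivial_En {n : ℕ} (hn : 0 < n) : Nontrivial (En n) := by
  have : Nonempty (Fin n) := ⟨⟨0, hn⟩⟩
  infer_instance

lemma radial_weight {n : ℕ} (hn : 0 < n) {α y : ℝ} (hy : 0 < y) :
    y ^ (n - 1) * y ^ α = y ^ (n - 1 + α) := by
  rw [← Real.rpow_natCast, ← Real.rpow_add hy, Nat.cast_sub hn, Nat.cast_one]

lemma indicator_norm_ball {n : ℕ} (α a : ℝ) (x : En n) :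
    (closedBall (0 : En n) a).indicator (fun z => ‖z‖ ^ α) x
      = (fun r : ℝ => (Iic a).indicator (fun r => r ^ α) r) ‖x‖ := by
  simp [indicator]

lemma radial_ball {n : ℕ} (hn : 0 < n) {α a : ℝ} (hα : 0 < n + α) (ha : 0 < a) :
    IntegrableOn (fun z : En n => ‖z‖ ^ α) (closedBall 0 a) ∧
    ∫ z in closedBall (0 : En n) a, ‖z‖ ^ α = sphereMass n * (a ^ (n + α) / (n + α)) := by
  have := nontrivial_En hn
  have heq : ∀ y ∈ Ioi (0:ℝ), y ^ (Module.finrank ℝ (En n) - 1) •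
      (Iic a).indicator (fun r : ℝ => r ^ α) y
      = (Iic a).indicator (fun r : ℝ => r ^ (n - 1 + α)) y := by
    intro y hy
    rw [finrank_euclideanSpace_fin, smul_eq_mul]
    by_cases h : y ∈ Iic a
    · rw [indicator_of_mem h, indicator_of_mem h, radial_weight hn hy]
    · rw [indicator_of_notMem h, indicator_of_notMem h, mul_zero]
  have hset : Ioi (0:ℝ) ∩ Iic a = Ioc 0 a := rfl
  have hint : IntervalIntegrable (fun r : ℝ => r ^ ((n:ℝ) - 1 + α)) volume 0 a :=
    intervalIntegral.intervalIntegrable_rpow' (by linarith)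
  constructor
  · rw [← integrable_indicator_iff measurableSet_closedBall]
    rw [funext (indicator_norm_ball (n := n) α a)]
    rw [integrable_fun_norm_addHaar volume (f := fun r => (Iic a).indicator (fun r => r ^ α) r)]
    rw [integrableOn_congr_fun heq measurableSet_Ioi]
    rw [integrableOn_indicator_iff measurableSet_Iic, Set.inter_comm, hset]
    exact (intervalIntegrable_iff_integrableOn_Ioc_of_le ha.le).1 hint
  · rw [← integral_indicator measurableSet_closedBall]
    rw [integral_congr_ae (ae_of_all _ (indicator_norm_ball (n := n) α a))]
    rw [integral_fun_norm_addHaar volume (fun r => (Iic a).indicator (fun r => r ^ α) r)]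
    rw [setIntegral_congr_fun measurableSet_Ioi heq, setIntegral_indicator measurableSet_Iic, hset,
      ← intervalIntegral.integral_of_le ha.le, integral_rpow (Or.inl (by linarith))]
    rw [finrank_euclideanSpace_fin, sphereMass, Real.zero_rpow (by linarith)]
    simp only [nsmul_eq_mul, smul_eq_mul, sub_zero]
    rw [show (n:ℝ) - 1 + α + 1 = n + α by ring, mul_assoc]

lemma indicator_norm_compl {n : ℕ} (α a : ℝ) (x : En n) :
    ({z : En n | a ≤ ‖z‖}).indicator (fun z => ‖z‖ ^ α) x
      = (fun r : ℝ => (Ici a).indicator (fun r => r ^ α) r) ‖x‖ := by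
  simp [indicator]

lemma measurableSet_norm_ge {n : ℕ} (a : ℝ) : MeasurableSet {z : En n | a ≤ ‖z‖} :=
  measurableSet_le measurable_const measurable_norm

lemma radial_compl {n : ℕ} (hn : 0 < n) {α a : ℝ} (hα : n + α < 0) (ha : 0 < a) :
    IntegrableOn (fun z : En n => ‖z‖ ^ α) {z | a ≤ ‖z‖} ∧
    ∫ z in {z : En n | a ≤ ‖z‖}, ‖z‖ ^ α = sphereMass n * (a ^ (n + α) / (-(n + α))) := by
  have := nontrivial_En hn
  have heq : ∀ y ∈ Ioi (0:ℝ), y ^ (Module.finrank ℝ (En n) - 1) •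
      (Ici a).indicator (fun r : ℝ => r ^ α) y
      = (Ici a).indicator (fun r : ℝ => r ^ (n - 1 + α)) y := by
    intro y hy
    rw [finrank_euclideanSpace_fin, smul_eq_mul]
    by_cases h : y ∈ Ici a
    · rw [indicator_of_mem h, indicator_of_mem h, radial_weight hn hy]
    · rw [indicator_of_notMem h, indicator_of_notMem h, mul_zero]
  have hset : Ioi (0:ℝ) ∩ Ici a = Ici a :=
    Set.inter_eq_right.2 (fun y hy => lt_of_lt_of_le ha hy)
  constructor
  · rw [← integrable_indicator_iff (measurableSet_norm_ge a)]
    rw [funext (indicator_norm_compl (n := n) α a)]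
    rw [integrable_fun_norm_addHaar volume (f := fun r => (Ici a).indicator (fun r => r ^ α) r)]
    rw [integrableOn_congr_fun heq measurableSet_Ioi]
    rw [integrableOn_indicator_iff measurableSet_Ici, Set.inter_comm, hset,
      integrableOn_Ici_iff_integrableOn_Ioi]
    exact integrableOn_Ioi_rpow_of_lt (by linarith) ha
  · rw [← integral_indicator (measurableSet_norm_ge a)]
    rw [integral_congr_ae (ae_of_all _ (indicator_norm_compl (n := n) α a))]
    rw [integral_fun_norm_addHaar volume (fun r => (Ici a).indicator (fun r => r ^ α) r)]
    rw [setIntegral_congr_fun measurableSet_Ioi heq, setIntegral_indicator measurableSet_Ici, hset,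
      integral_Ici_eq_integral_Ioi, integral_Ioi_rpow_of_lt (by linarith) ha]
    rw [finrank_euclideanSpace_fin, sphereMass]
    simp only [nsmul_eq_mul, smul_eq_mul]
    rw [show (n:ℝ) - 1 + α + 1 = n + α by ring, mul_assoc, div_neg, neg_div]

/-- Bounds on the normalizing constant that are uniform in `s`. -/
lemma cns_bounds {n : ℕ} (hn : 0 < n) : ∃ a b : ℝ, 0 < a ∧ a ≤ b ∧ ∀ s ∈ Ioo (0:ℝ) 1,
    a * (s * (1 - s)) ≤ cns n s ∧ cns n s ≤ b * (s * (1 - s)) := by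
  have hn' : (0:ℝ) < n := by exact_mod_cast hn
  let F : ℝ → ℝ := fun s => (4:ℝ) ^ s * Real.Gamma ((n:ℝ)/2 + s) /
    (Real.pi ^ ((n:ℝ)/2) * Real.Gamma (2 - s))
  have hG : ∀ t : ℝ, 0 < t → ContinuousAt Real.Gamma t := fun t ht =>
    (Real.differentiableAt_Gamma (fun m => by
      have : (0:ℝ) ≤ m := Nat.cast_nonneg m
      linarith)).continuousAt
  have hpos : ∀ s ∈ Icc (0:ℝ) 1, 0 < F s := by
    intro s hs
    have h1 := Real.Gamma_pos_of_pos (s := (n:ℝ)/2 + s) (by linarith [hs.1])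
    have h2 := Real.Gamma_pos_of_pos (s := 2 - s) (by linarith [hs.2])
    have := Real.pi_pos
    simp only [F]; positivity
  have hcont : ContinuousOn F (Icc 0 1) := by
    intro s hs
    apply ContinuousAt.continuousWithinAt
    have h2 := Real.Gamma_pos_of_pos (s := 2 - s) (by linarith [hs.2])
    have hpi : 0 < Real.pi ^ ((n:ℝ)/2) := Real.rpow_pos_of_pos Real.pi_pos _
    apply ContinuousAt.div
    · apply ContinuousAt.mul
      · exact (Real.continuous_const_rpow (by norm_num)).continuousAt
      · exact ContinuousAt.comp (f := fun s => (n:ℝ)/2 + s) (hG _ (by linarith [hs.1])) (by fun_prop)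
    · apply continuousAt_const.mul
      exact ContinuousAt.comp (f := fun s => 2 - s) (hG _ (by linarith [hs.2])) (by fun_prop)
    · positivity
  obtain ⟨x, hx, hxm⟩ := isCompact_Icc.exists_isMinOn (nonempty_Icc.2 zero_le_one) hcont
  obtain ⟨y, hy, hym⟩ := isCompact_Icc.exists_isMaxOn (nonempty_Icc.2 zero_le_one) hcont
  refine ⟨F x, F y, hpos x hx, hym hx, fun s hs => ?_⟩
  have hs' : s ∈ Icc (0:ℝ) 1 := Ioo_subset_Icc_self hs
  have key : cns n s = F s * (s * (1 - s)) := by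
    have h1 : 0 < 1 - s := by linarith [hs.2]
    have h2 : Real.Gamma (2 - s) = (1 - s) * Real.Gamma (1 - s) := by
      rw [← Real.Gamma_add_one h1.ne']; congr 1; ring
    have h3 := Real.Gamma_pos_of_pos h1
    have hpi : 0 < Real.pi ^ ((n:ℝ)/2) := Real.rpow_pos_of_pos Real.pi_pos _
    simp only [F, cns, h2]
    field_simp
  have h0 : 0 ≤ s * (1 - s) := mul_nonneg hs.1.le (by linarith [hs.2])
  rw [key]
  exact ⟨mul_le_mul_of_nonneg_right (hxm hs') h0, mul_le_mul_of_nonneg_right (hym hs') h0⟩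

/-- A smooth cutoff on `ℝ`, equal to `0` on `(-∞,1]` and to `1` on `[2,∞)`. -/
def cut (t : ℝ) : ℝ := Real.smoothTransition (t - 1)

lemma cut_zero {t : ℝ} (h : t ≤ 1) : cut t = 0 :=
  Real.smoothTransition.zero_of_nonpos (by linarith)

lemma cut_one {t : ℝ} (h : 2 ≤ t) : cut t = 1 :=
  Real.smoothTransition.one_of_one_le (by linarith)

lemma cut_nonneg (t : ℝ) : 0 ≤ cut t := Real.smoothTransition.nonneg _

lemma cut_le_one (t : ℝ) : cut t ≤ 1 := Real.smoothTransition.le_one _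

lemma cut_contDiff : ContDiff ℝ (2 : ℕ∞) cut :=
  Real.smoothTransition.contDiff.comp (contDiff_id.sub contDiff_const)

lemma cut_deriv_contDiff : ContDiff ℝ 1 (deriv cut) :=
  ((contDiff_succ_iff_deriv (n := 1)).1 (by exact_mod_cast cut_contDiff)).2.2

lemma cut_hasDerivAt (t : ℝ) : HasDerivAt cut (deriv cut t) t :=
  (cut_contDiff.differentiable (by norm_num) t).hasDerivAt

lemma cut_hasDerivAt₂ (t : ℝ) : HasDerivAt (deriv cut) (deriv (deriv cut) t) t :=
  (cut_deriv_contDiff.differentiable (by norm_num) t).hasDerivAt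

lemma cut_deriv_continuous : Continuous (deriv cut) := cut_deriv_contDiff.continuous

lemma cut_deriv₂_continuous : Continuous (deriv (deriv cut)) :=
  cut_deriv_contDiff.continuous_deriv le_rfl

lemma cut_deriv_left {t : ℝ} (h : t ≤ 1) : deriv cut t = 0 :=
  IsLocalMin.deriv_eq_zero (Eventually.of_forall fun x => by
    rw [cut_zero h]; exact cut_nonneg x)

lemma cut_deriv_right {t : ℝ} (h : 2 ≤ t) : deriv cut t = 0 :=
  IsLocalMax.deriv_eq_zero (Eventually.of_forall fun x => by
    rw [cut_one h]; exact cut_le_one x)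

lemma cut_deriv₂_outside {t : ℝ} (h : t < 1 ∨ 2 < t) : deriv (deriv cut) t = 0 := by
  have : deriv cut =ᶠ[nhds t] fun _ => 0 := by
    rcases h with h | h
    · filter_upwards [Iio_mem_nhds h] with x hx using cut_deriv_left (le_of_lt hx)
    · filter_upwards [Ioi_mem_nhds h] with x hx using cut_deriv_right (le_of_lt hx)
  rw [this.deriv_eq, deriv_const]

lemma cut_deriv_bounds : ∃ C : ℝ, 1 ≤ C ∧ ∀ t, |t * deriv cut t| ≤ C ∧
    |t ^ 2 * deriv (deriv cut) t| ≤ C := by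
  obtain ⟨C₁, h₁⟩ := isCompact_Icc.exists_bound_of_continuousOn (s := Icc (1:ℝ) 2)
    (f := fun t => t * deriv cut t) (continuous_id.mul cut_deriv_continuous).continuousOn
  obtain ⟨C₂, h₂⟩ := isCompact_Icc.exists_bound_of_continuousOn (s := Icc (1:ℝ) 2)
    (f := fun t => t ^ 2 * deriv (deriv cut) t)
    ((continuous_pow 2).mul cut_deriv₂_continuous).continuousOn
  refine ⟨max 1 (max C₁ C₂), le_max_left _ _, fun t => ?_⟩
  by_cases ht : t ∈ Icc (1:ℝ) 2
  · exact ⟨(h₁ t ht).trans ((le_max_left _ _).trans (le_max_right _ _)),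
      (h₂ t ht).trans ((le_max_right _ _).trans (le_max_right _ _))⟩
  · have ht' : t < 1 ∨ 2 < t := by
      by_contra! h
      exact ht ⟨h.1, h.2⟩
    have h0 : deriv cut t = 0 :=
      ht'.elim (fun h => cut_deriv_left h.le) (fun h => cut_deriv_right h.le)
    rw [h0, cut_deriv₂_outside ht']
    simp

/-- A `C¹` increasing profile, comparable to `min t 1` for `t ≥ 0`, and equal to `1` for `t ≥ 1`. -/
def ramp (t : ℝ) : ℝ := 1 - (max (1 - t) 0) ^ 2

lemma ramp_hasDerivAt (t : ℝ) : HasDerivAt ramp (2 * max (1 - t) 0) t := by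
  have hne : ∀ y ≠ (1:ℝ), HasDerivAt ramp (2 * max (1 - y) 0) y := by
    intro y hy
    rcases lt_or_gt_of_ne hy with h | h
    · have h1 : ramp =ᶠ[nhds y] fun t => 1 - (1 - t) ^ 2 := by
        filter_upwards [Iio_mem_nhds h] with x hx
        have hx' : x < 1 := hx
        rw [ramp, max_eq_left (by linarith)]
      rw [max_eq_left (by linarith)]
      refine HasDerivAt.congr_of_eventuallyEq ?_ h1
      have := (((hasDerivAt_id y).const_sub 1).pow 2).const_sub 1
      refine this.congr_deriv ?_
      simp
    · have h1 : ramp =ᶠ[nhds y] fun t => 1 := by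
        filter_upwards [Ioi_mem_nhds h] with x hx
        have hx' : 1 < x := hx
        rw [ramp, max_eq_right (by linarith)]; simp
      rw [max_eq_right (by linarith), mul_zero]
      exact (hasDerivAt_const y (1:ℝ)).congr_of_eventuallyEq h1
  by_cases h : t = 1
  · subst h
    refine hasDerivAt_of_hasDerivAt_of_ne (g := fun y => 2 * max (1 - y) 0) hne ?_ ?_
    · unfold ramp; fun_prop
    · fun_prop
  · exact hne t h

lemma ramp_one {t : ℝ} (h : 1 ≤ t) : ramp t = 1 := by
  rw [ramp, max_eq_right (by linarith)]; simp

lemma ramp_le_one (t : ℝ) : ramp t ≤ 1 := by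
  unfold ramp; nlinarith [sq_nonneg (max (1 - t) 0)]

lemma ramp_nonneg {t : ℝ} (h : 0 ≤ t) : 0 ≤ ramp t := by
  have h1 : 0 ≤ max (1 - t) 0 := le_max_right _ _
  have h2 : max (1 - t) 0 ≤ 1 := max_le (by linarith) zero_le_one
  unfold ramp; nlinarith

lemma ramp_le {t : ℝ} : ramp t ≤ 2 * t := by
  have h1 : 1 - t ≤ max (1 - t) 0 := le_max_left _ _
  unfold ramp; nlinarith [sq_nonneg (max (1 - t) 0 - 1)]

lemma ramp_ge {t : ℝ} (h : 0 ≤ t) (h1 : t ≤ 1) : t ≤ ramp t := by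
  rw [ramp, max_eq_left (by linarith)]; nlinarith

lemma ramp_le_half {t : ℝ} (h : t ≤ 1 / 2) : ramp t ≤ 3 / 4 := by
  rw [ramp, max_eq_left (by linarith)]; nlinarith

lemma ramp_deriv_bound {t : ℝ} (h : 0 ≤ t) :
    0 ≤ t * (2 * max (1 - t) 0) ∧ t * (2 * max (1 - t) 0) ≤ min 1 (2 * t) := by
  have h1 : 0 ≤ max (1 - t) 0 := le_max_right _ _
  have h2 : max (1 - t) 0 ≤ 1 := max_le (by linarith) zero_le_one
  refine ⟨by positivity, le_min ?_ (by nlinarith)⟩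
  rcases le_total t 1 with h3 | h3
  · rw [max_eq_left (by linarith)]; nlinarith [sq_nonneg (2 * t - 1)]
  · rw [max_eq_right (by linarith)]; norm_num

lemma hasDerivAt_rpow_mul {a δ : ℝ} {g g' : ℝ → ℝ} (hδ : 0 < δ) (h0 : ∀ q ≤ δ, g q = 0)
    (hg : ∀ q, HasDerivAt g (g' q) q) (q : ℝ) :
    HasDerivAt (fun q => q ^ (-a) * g q) (q ^ (-a) * (g' q - a * g q / q)) q := by
  by_cases hq : 0 < q
  · have h1 := (Real.hasDerivAt_rpow_const (x := q) (p := -a) (Or.inl hq.ne')).mul (hg q)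
    refine h1.congr_deriv ?_
    rw [Real.rpow_sub_one hq.ne']
    field_simp
    ring
  · have hq' : q < δ := by linarith
    have e1 : g =ᶠ[nhds q] fun _ => 0 := by
      filter_upwards [Iio_mem_nhds hq'] with x hx using h0 x (le_of_lt hx)
    have h2 : g' q = 0 :=
      (hg q).unique ((hasDerivAt_const q (0:ℝ)).congr_of_eventuallyEq e1)
    rw [h2, h0 q hq'.le]
    have e2 : (fun q => q ^ (-a) * g q) =ᶠ[nhds q] fun _ => 0 := by
      filter_upwards [e1] with x hx
      simp [hx]
    simpa using (hasDerivAt_const q (0:ℝ)).congr_of_eventuallyEq e2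

/-- The homogeneous kernel `c |Bz|^{-p}`. -/
def hker {n : ℕ} (c p : ℝ) (B : En n →L[ℝ] En n) (z : En n) : ℝ := c * ‖B z‖ ^ (-p)

lemma hker_nonneg {n : ℕ} {c p : ℝ} (hc : 0 ≤ c) (B : En n →L[ℝ] En n) (z : En n) :
    0 ≤ hker c p B z := mul_nonneg hc (Real.rpow_nonneg (norm_nonneg _) _)

lemma hker_neg {n : ℕ} {c p : ℝ} (B : En n →L[ℝ] En n) (z : En n) :
    hker c p B (-z) = hker c p B z := by simp [hker]

lemma hker_measurable {n : ℕ} {c p : ℝ} (B : En n →L[ℝ] En n) : Measurable (hker c p B) := by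
  have h : Measurable fun z : En n => ‖B z‖ := B.continuous.norm.measurable
  exact (h.pow_const _).const_mul _

lemma hker_eq {n : ℕ} {c p : ℝ} (B : En n →L[ℝ] En n) (z : En n) :
    hker c p B z = c * (‖B z‖ ^ 2) ^ (-(p / 2)) := by
  rw [hker, ← Real.rpow_natCast, ← Real.rpow_mul (norm_nonneg _)]
  congr 2; push_cast; ring

lemma hasDerivAt_normSq_line {n : ℕ} (B : En n →L[ℝ] En n) (z e : En n) (t : ℝ) :
    HasDerivAt (fun t : ℝ => ‖B (z + t • e)‖ ^ 2) (2 * inner ℝ (B (z + t • e)) (B e)) t := by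
  have h : HasDerivAt (fun t : ℝ => B (z + t • e)) (B e) t := by
    have h1 : HasDerivAt (fun t : ℝ => B z + t • B e) (B e) t := by
      simpa using ((hasDerivAt_id t).smul_const (B e)).const_add (B z)
    simpa [map_add, map_smul] using h1
  exact h.norm_sq

lemma hker_mul_hasLineDerivAt {n : ℕ} {c p δ : ℝ} {g g' : ℝ → ℝ} (hδ : 0 < δ)
    (h0 : ∀ q ≤ δ, g q = 0) (hg : ∀ q, HasDerivAt g (g' q) q) (B : En n →L[ℝ] En n)
    (e z : En n) :
    HasLineDerivAt ℝ (fun z => hker c p B z * g (‖B z‖ ^ 2))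
      (hker c p B z * (g' (‖B z‖ ^ 2) - p / 2 * g (‖B z‖ ^ 2) / ‖B z‖ ^ 2)
        * (2 * inner ℝ (B z) (B e))) z e := by
  unfold HasLineDerivAt
  have h1 := (hasDerivAt_rpow_mul (a := p / 2) hδ h0 hg (‖B (z + (0:ℝ) • e)‖ ^ 2)).const_mul c
  have h2 := h1.comp (0:ℝ) (hasDerivAt_normSq_line B z e 0)
  simp only [zero_smul, add_zero] at h2
  have h3 : (fun t : ℝ => (fun z => hker c p B z * g (‖B z‖ ^ 2)) (z + t • e))
      = (fun y => c * (y ^ (-(p / 2)) * g y)) ∘ fun t : ℝ => ‖B (z + t • e)‖ ^ 2 := by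
    ext t; simp [hker_eq, mul_assoc]
  rw [h3]
  refine h2.congr_deriv ?_
  rw [hker_eq]; ring

lemma hker_mul_hasLineDerivAt₂ {n : ℕ} {c p δ : ℝ} {g g' : ℝ → ℝ} (hδ : 0 < δ)
    (h0 : ∀ q ≤ δ, g q = 0) (hg : ∀ q, HasDerivAt g (g' q) q) (B : En n →L[ℝ] En n)
    (e z : En n) :
    HasLineDerivAt ℝ (fun z => hker c p B z * g (‖B z‖ ^ 2) * (2 * inner ℝ (B z) (B e)))
      (hker c p B z * ((g' (‖B z‖ ^ 2) - p / 2 * g (‖B z‖ ^ 2) / ‖B z‖ ^ 2)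
        * (2 * inner ℝ (B z) (B e)) ^ 2 + g (‖B z‖ ^ 2) * (2 * ‖B e‖ ^ 2))) z e := by
  have h1 := hker_mul_hasLineDerivAt (c := c) (p := p) hδ h0 hg B e z
  unfold HasLineDerivAt at h1 ⊢
  have h2 : HasDerivAt (fun t : ℝ => 2 * inner ℝ (B (z + t • e)) (B e)) (2 * ‖B e‖ ^ 2) 0 := by
    have h3 : HasDerivAt (fun t : ℝ => 2 * (inner ℝ (B z) (B e) + t * ‖B e‖ ^ 2))
        (2 * ‖B e‖ ^ 2) 0 := by
      simpa using (((hasDerivAt_id (0:ℝ)).mul_const (‖B e‖ ^ 2)).const_add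
        (inner ℝ (B z) (B e))).const_mul 2
    convert h3 using 1
    ext t
    rw [map_add, map_smul, inner_add_left, inner_smul_left, real_inner_self_eq_norm_sq]
    simp
  refine (h1.mul h2).congr_deriv ?_
  simp only [zero_smul, add_zero]
  ring

/-- `B` is bounded above and below by multiples of the norm. -/
def Elliptic {n : ℕ} (lam Lam : ℝ) (B : En n →L[ℝ] En n) : Prop :=
  ∀ z, lam * ‖z‖ ≤ ‖B z‖ ∧ ‖B z‖ ≤ Lam * ‖z‖

lemma hker_le {n : ℕ} {c p lam Lam : ℝ} {B : En n →L[ℝ] En n} (hc : 0 ≤ c) (hp : 0 < p)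
    (hpn : p ≤ n + 2) (hl : 0 < lam) (hl1 : lam ≤ 1) (hB : Elliptic lam Lam B) (z : En n) :
    hker c p B z ≤ c * (lam⁻¹) ^ (n + 2) * ‖z‖ ^ (-p) := by
  rw [hker, mul_assoc]
  refine mul_le_mul_of_nonneg_left ?_ hc
  by_cases hz : z = 0
  · subst hz
    simp [Real.zero_rpow (neg_ne_zero.2 hp.ne')]
  have hz' : 0 < ‖z‖ := norm_pos_iff.2 hz
  calc ‖B z‖ ^ (-p) ≤ (lam * ‖z‖) ^ (-p) :=
        Real.rpow_le_rpow_of_nonpos (by positivity) (hB z).1 (by linarith)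
    _ = lam ^ (-p) * ‖z‖ ^ (-p) := Real.mul_rpow hl.le hz'.le
    _ ≤ _ := by
        refine mul_le_mul_of_nonneg_right ?_ (Real.rpow_nonneg hz'.le _)
        rw [Real.rpow_neg hl.le, ← Real.inv_rpow hl.le, ← Real.rpow_natCast]
        exact Real.rpow_le_rpow_of_exponent_le (one_le_inv_iff₀.2 ⟨hl, hl1⟩)
          (by push_cast; exact hpn)

lemma hker_ge {n : ℕ} {c p lam Lam : ℝ} {B : En n →L[ℝ] En n} (hc : 0 ≤ c) (hp : 0 < p)
    (hpn : p ≤ n + 2) (hl : 0 < lam) (hL : 1 ≤ Lam) (hB : Elliptic lam Lam B) (z : En n) :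
    c * (Lam⁻¹) ^ (n + 2) * ‖z‖ ^ (-p) ≤ hker c p B z := by
  rw [hker, mul_assoc]
  refine mul_le_mul_of_nonneg_left ?_ hc
  by_cases hz : z = 0
  · subst hz
    simp [Real.zero_rpow (neg_ne_zero.2 hp.ne')]
  have hz' : 0 < ‖z‖ := norm_pos_iff.2 hz
  have hBz : 0 < ‖B z‖ := lt_of_lt_of_le (by positivity) (hB z).1
  calc (Lam⁻¹) ^ (n + 2) * ‖z‖ ^ (-p) ≤ Lam ^ (-p) * ‖z‖ ^ (-p) := by
        refine mul_le_mul_of_nonneg_right ?_ (Real.rpow_nonneg hz'.le _)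
        have hL0 : 0 < Lam := by linarith
        rw [Real.rpow_neg hL0.le, ← Real.inv_rpow hL0.le, ← Real.rpow_natCast]
        exact Real.rpow_le_rpow_of_exponent_ge (by positivity) (inv_le_one_of_one_le₀ hL)
          (by push_cast; exact hpn)
    _ = (Lam * ‖z‖) ^ (-p) := (Real.mul_rpow (by linarith) hz'.le).symm
    _ ≤ ‖B z‖ ^ (-p) := Real.rpow_le_rpow_of_nonpos hBz (hB z).2 (by linarith)

lemma integrable_of_decay {n : ℕ} (hn : 0 < n) {s D b : ℝ} (hs : 0 < s) (hb : 0 < b)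
    {f : En n → ℝ} (hf : Measurable f)
    (h1 : ∀ z, b ≤ ‖z‖ → |f z| ≤ D * ‖z‖ ^ (-((n:ℝ) + 2 * s))) (h0 : ∀ z, ‖z‖ < b → f z = 0) :
    Integrable f ∧ ∫ z, |f z| ≤ D * (sphereMass n * (b ^ (-(2 * s)) / (2 * s))) := by
  obtain ⟨hi, hv⟩ := radial_compl hn (α := -((n:ℝ) + 2 * s)) (a := b) (by linarith) hb
  rw [← integrable_indicator_iff (measurableSet_norm_ge b)] at hi
  have hle : ∀ z, |f z| ≤ D * ({z : En n | b ≤ ‖z‖}).indicator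
      (fun z => ‖z‖ ^ (-((n:ℝ) + 2 * s))) z := by
    intro z
    by_cases h : b ≤ ‖z‖
    · rw [indicator_of_mem (show z ∈ {z : En n | b ≤ ‖z‖} from h)]; exact h1 z h
    · rw [indicator_of_notMem (show z ∉ {z : En n | b ≤ ‖z‖} from h), h0 z (not_le.1 h)]; simp
  have hint : Integrable f := (hi.const_mul D).mono' hf.aestronglyMeasurable
    (ae_of_all _ fun z => by rw [Real.norm_eq_abs]; exact hle z)
  refine ⟨hint, (integral_mono hint.abs (hi.const_mul D) hle).trans_eq ?_⟩
  rw [integral_const_mul, integral_indicator (measurableSet_norm_ge b), hv]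
  congr 3
  · congr 1; ring
  · ring

lemma abs_integral_mul_le {n : ℕ} {κ v : En n → ℝ} {M : ℝ} (hκ : Integrable κ)
    (hv : ∀ x, |v x| ≤ M) : |∫ z, κ z * v z| ≤ M * ∫ z, |κ z| := by
  rw [← integral_const_mul]
  refine (abs_integral_le_integral_abs).trans ?_
  refine integral_mono_of_nonneg (ae_of_all _ fun z => abs_nonneg _) (hκ.abs.const_mul M)
    (ae_of_all _ fun z => ?_)
  simp only [abs_mul]
  rw [mul_comm]
  exact mul_le_mul_of_nonneg_right (hv z) (abs_nonneg _)

lemma integrable_mul_bdd {n : ℕ} {κ v : En n → ℝ} {M : ℝ} (hκ : Integrable κ)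
    (hvc : Continuous v) (hv : ∀ x, |v x| ≤ M) : Integrable fun z => κ z * v z :=
  hκ.mul_bdd hvc.aestronglyMeasurable (ae_of_all _ fun z => by simpa using hv z)

lemma HasLineDerivAt.comp_const_add' {n : ℕ} {v : En n → ℝ} {v' : ℝ} {x z e : En n}
    (h : HasLineDerivAt ℝ v v' (x + z) e) : HasLineDerivAt ℝ (fun z => v (x + z)) v' z e := by
  unfold HasLineDerivAt at h ⊢
  simpa [add_assoc] using h

lemma integral_mul_lineDeriv {n : ℕ} {κ κ' v v' : En n → ℝ} {e : En n} {M M' : ℝ}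
    (hκ : Integrable κ) (hκ' : Integrable κ') (hd : ∀ z, HasLineDerivAt ℝ κ (κ' z) z e)
    (hvd : ∀ z, HasLineDerivAt ℝ v (v' z) z e) (hv : Continuous v) (hv' : Continuous v')
    (hb : ∀ z, |v z| ≤ M) (hb' : ∀ z, |v' z| ≤ M') :
    ∫ z, κ z * v' z = -∫ z, κ' z * v z := by
  have := integral_bilinear_hasLineDerivAt_right_eq_neg_left_of_integrable (μ := volume)
    (B := ContinuousLinearMap.mul ℝ ℝ) (f := κ) (f' := κ') (g := v) (g' := v') (v := e)
    (integrable_mul_bdd hκ' hv hb) (integrable_mul_bdd hκ hv' hb') (integrable_mul_bdd hκ hv hb)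
    (fun z _ => hd z) (fun z _ => hvd z)
  simpa using this

/-- The smooth part of the kernel away from the origin. -/
def farK {n : ℕ} (s lam : ℝ) (B : En n →L[ℝ] En n) (z : En n) : ℝ :=
  hker (cns n s) (n + 2 * s) B z * cut (‖B z‖ ^ 2 / (lam / 8) ^ 2)

lemma cut_div_hasDerivAt (δ q : ℝ) :
    HasDerivAt (fun q => cut (q / δ)) (deriv cut (q / δ) / δ) q := by
  have := (cut_hasDerivAt (q / δ)).comp q ((hasDerivAt_id q).div_const δ)
  refine this.congr_deriv ?_
  ring

lemma cut_div_zero {δ q : ℝ} (hδ : 0 < δ) (hq : q ≤ δ) : cut (q / δ) = 0 :=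
  cut_zero ((div_le_one hδ).2 hq)

lemma farProfile_hasDerivAt {δ a : ℝ} (hδ : 0 < δ) (q : ℝ) :
    HasDerivAt (fun q => deriv cut (q / δ) / δ - a * cut (q / δ) / q)
      (deriv (deriv cut) (q / δ) / δ ^ 2 -
        a * (deriv cut (q / δ) / δ * q - cut (q / δ)) / q ^ 2) q := by
  by_cases hq : 0 < q
  · have h1 := ((cut_hasDerivAt₂ (q / δ)).comp q ((hasDerivAt_id q).div_const δ)).div_const δ
    have h2 := ((cut_div_hasDerivAt δ q).const_mul a).div (hasDerivAt_id q) hq.ne'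
    refine (h1.sub h2).congr_deriv ?_
    simp only [id]
    field_simp
  · have hq1 : q / δ < 1 := by
      rw [div_lt_one hδ]; linarith
    have hev : (fun q => deriv cut (q / δ) / δ - a * cut (q / δ) / q) =ᶠ[nhds q] fun _ => 0 := by
      filter_upwards [Iio_mem_nhds (show q < δ by linarith)] with x hx
      have hx' : x / δ ≤ 1 := (div_le_one hδ).2 (le_of_lt hx)
      rw [cut_zero hx', cut_deriv_left hx']
      simp
    rw [cut_deriv₂_outside (Or.inl hq1), cut_zero hq1.le, cut_deriv_left hq1.le]
    simpa using (hasDerivAt_const q (0:ℝ)).congr_of_eventuallyEq hev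

lemma far_integral_bound {n : ℕ} (hn : 0 < n) {lam Lam : ℝ} (hl : 0 < lam) (hl1 : lam ≤ 1)
    (hL : 1 ≤ Lam) : ∃ C : ℝ, 0 < C ∧ ∀ s ∈ Ioo (0:ℝ) 1, ∀ B : En n →L[ℝ] En n,
    Elliptic lam Lam B → ∀ (D : ℝ) (κ : En n → ℝ), 0 ≤ D → Measurable κ →
    (∀ z, |κ z| ≤ D * hker (cns n s) (n + 2 * s) B z) →
    (∀ z, ‖B z‖ ^ 2 ≤ (lam / 8) ^ 2 → κ z = 0) → Integrable κ ∧ ∫ z, |κ z| ≤ C * D := by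
  obtain ⟨a, b, ha, hab, hc⟩ := cns_bounds hn
  have hS := sphereMass_pos hn
  set r := lam / 8 / Lam with hr
  have hL0 : 0 < Lam := by linarith
  have hr0 : 0 < r := by positivity
  have hr1 : r ≤ 1 := by
    rw [hr, div_div, div_le_one (by positivity)]; linarith
  have hb0 : 0 < b := ha.trans_le hab
  refine ⟨(lam⁻¹) ^ (n + 2) * (sphereMass n * (r⁻¹ ^ 2 * b)), by positivity, ?_⟩
  intro s hs B hB D κ hD hκ h1 h0
  obtain ⟨hc1, hc2⟩ := hc s hs
  have hs0 := hs.1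
  have hs1 := hs.2
  have hc0 : 0 ≤ cns n s := le_trans (by
    have : 0 < 1 - s := by linarith
    positivity) hc1
  have hp : 0 < (n:ℝ) + 2 * s := by positivity
  obtain ⟨hi, hv⟩ := integrable_of_decay hn hs0 hr0 hκ (D := D * (cns n s * (lam⁻¹) ^ (n + 2)))
    (fun z _ => (h1 z).trans (by
      rw [mul_assoc D]
      exact mul_le_mul_of_nonneg_left (hker_le hc0 hp (by linarith) hl hl1 hB z) hD))
    (fun z hz => h0 z (by
      have : ‖B z‖ ≤ lam / 8 := by
        refine (hB z).2.trans ?_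
        rw [hr, lt_div_iff₀ hL0] at hz
        linarith
      exact pow_le_pow_left₀ (norm_nonneg _) this 2))
  refine ⟨hi, hv.trans ?_⟩
  have hrs : r ^ (-(2 * s)) ≤ r⁻¹ ^ 2 := by
    rw [Real.rpow_neg hr0.le, ← Real.inv_rpow hr0.le, ← Real.rpow_natCast]
    exact Real.rpow_le_rpow_of_exponent_le (by rw [one_le_inv₀ hr0]; exact hr1)
      (by push_cast; linarith)
  have hcs : cns n s * (r ^ (-(2 * s)) / (2 * s)) ≤ r⁻¹ ^ 2 * b := by
    rw [mul_div_assoc', div_le_iff₀ (by positivity)]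
    calc cns n s * r ^ (-(2 * s)) ≤ (b * (s * (1 - s))) * r⁻¹ ^ 2 :=
          mul_le_mul hc2 hrs (by positivity) (hc0.trans hc2)
      _ ≤ _ := by
        have : 0 ≤ r⁻¹ ^ 2 * b * s := by positivity
        nlinarith
  calc D * (cns n s * lam⁻¹ ^ (n + 2)) * (sphereMass n * (r ^ (-(2 * s)) / (2 * s)))
      = D * lam⁻¹ ^ (n + 2) * sphereMass n * (cns n s * (r ^ (-(2 * s)) / (2 * s))) := by ring
    _ ≤ D * lam⁻¹ ^ (n + 2) * sphereMass n * (r⁻¹ ^ 2 * b) := by gcongr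
    _ = _ := by ring

lemma abs_two_inner_le {n : ℕ} {lam Lam : ℝ} {B : En n →L[ℝ] En n} (hB : Elliptic lam Lam B)
    {e : En n} (he : ‖e‖ = 1) (z : En n) : |2 * inner ℝ (B z) (B e)| ≤ 2 * Lam * ‖B z‖ := by
  rw [abs_mul, abs_two]
  have h1 := abs_real_inner_le_norm (B z) (B e)
  have h2 := (hB e).2
  rw [he, mul_one] at h2
  nlinarith [mul_le_mul_of_nonneg_left h2 (norm_nonneg (B z))]

def farProfile (δ a q : ℝ) : ℝ := deriv cut (q / δ) / δ - a * cut (q / δ) / q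

def farProfile' (δ a q : ℝ) : ℝ := deriv (deriv cut) (q / δ) / δ ^ 2 -
        a * (deriv cut (q / δ) / δ * q - cut (q / δ)) / q ^ 2

lemma farProfile_zero {δ a q : ℝ} (hδ : 0 < δ) (hq : q ≤ δ) : farProfile δ a q = 0 := by
  have h : q / δ ≤ 1 := (div_le_one hδ).2 hq
  simp [farProfile, cut_zero h, cut_deriv_left h]

lemma farProfile_bound {C δ a a₀ q : ℝ} (hC : ∀ t, |t * deriv cut t| ≤ C ∧
    |t ^ 2 * deriv (deriv cut) t| ≤ C) (hδ : 0 < δ) (ha : 0 ≤ a) (ha₀ : a ≤ a₀) (hq : 0 < q) :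
    |farProfile δ a q| ≤ (C + a₀) / q ∧
    |farProfile' δ a q - a * farProfile δ a q / q| ≤ (C + a₀ * (C + 1) + a₀ * (C + a₀)) / q ^ 2 := by
  obtain ⟨h1, h2⟩ := hC (q / δ)
  have hc0 := cut_nonneg (q / δ)
  have hc1 := cut_le_one (q / δ)
  have hC0 : 0 ≤ C := (abs_nonneg _).trans h1
  set X := q / δ * deriv cut (q / δ) with hX
  set Y := (q / δ) ^ 2 * deriv (deriv cut) (q / δ) with hY
  set c := cut (q / δ) with hc
  have e1 : farProfile δ a q = (X - a * c) / q := by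
    rw [farProfile, hX]; field_simp; rfl
  have e2 : farProfile' δ a q = (Y - a * (X - c)) / q ^ 2 := by
    rw [farProfile', hX, hY, ← hc]; field_simp
  have b1 : |X - a * c| ≤ C + a₀ := by
    rw [abs_le] at h1 ⊢
    constructor <;> nlinarith
  have b2 : |Y - a * (X - c)| ≤ C + a₀ * (C + 1) := by
    have : |X - c| ≤ C + 1 := by rw [abs_le] at h1 ⊢; constructor <;> linarith
    calc _ ≤ |Y| + |a * (X - c)| := abs_sub _ _
      _ ≤ C + a₀ * (C + 1) := by
        rw [abs_mul a, abs_of_nonneg ha]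
        exact add_le_add h2 (mul_le_mul ha₀ this (abs_nonneg _) (ha.trans ha₀))
  constructor
  · rw [e1, abs_div, abs_of_pos hq]
    gcongr
  · have e3 : farProfile' δ a q - a * farProfile δ a q / q
        = ((Y - a * (X - c)) - a * (X - a * c)) / q ^ 2 := by
      rw [e1, e2]; field_simp
    rw [e3, abs_div, abs_of_pos (by positivity : 0 < q ^ 2)]
    gcongr
    calc _ ≤ |Y - a * (X - c)| + |a * (X - a * c)| := abs_sub _ _
      _ ≤ _ := by
        rw [abs_mul a, abs_of_nonneg ha]
        exact add_le_add b2 (mul_le_mul ha₀ b1 (abs_nonneg _) (ha.trans ha₀))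

lemma farProfile_measurable {δ a : ℝ} : Measurable (farProfile δ a) ∧ Measurable (farProfile' δ a) := by
  have h0 := cut_contDiff.continuous.measurable
  have h1 := cut_deriv_continuous.measurable
  have h2 := cut_deriv₂_continuous.measurable
  unfold farProfile farProfile'
  constructor <;> fun_prop

set_option maxHeartbeats 1000000 in
lemma far_tail {n : ℕ} (hn : 0 < n) {lam Lam : ℝ} (hl : 0 < lam) (hl1 : lam ≤ 1)
    (hL : 1 ≤ Lam) : ∃ C : ℝ, 0 < C ∧ ∀ s ∈ Ioo (0:ℝ) 1, ∀ B : En n →L[ℝ] En n,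
    Elliptic lam Lam B → ∀ e : En n, ‖e‖ = 1 → ∀ (u u' u'' : En n → ℝ) (M M' M'' : ℝ),
    Continuous u → Continuous u' → Continuous u'' → (∀ x, |u x| ≤ M) → (∀ x, |u' x| ≤ M') →
    (∀ x, |u'' x| ≤ M'') → (∀ x, HasLineDerivAt ℝ u (u' x) x e) →
    (∀ x, HasLineDerivAt ℝ u' (u'' x) x e) → ∀ x,
    |∫ z, farK s lam B z * u (x + z)| ≤ C * M ∧ |∫ z, farK s lam B z * u' (x + z)| ≤ C * M ∧
    |∫ z, farK s lam B z * u'' (x + z)| ≤ C * M := by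
  obtain ⟨Cf, hCf, hfar⟩ := far_integral_bound hn hl hl1 hL
  obtain ⟨Cc, hCc1, hCc⟩ := cut_deriv_bounds
  set a₀ : ℝ := (n + 2) / 2 with ha₀
  have ha₀0 : 0 < a₀ := by positivity
  set r := lam / 8 with hr
  have hr0 : 0 < r := by positivity
  set D₁ := (Cc + a₀) * (2 * Lam) / r with hD₁
  set D₂ := (Cc + a₀ * (Cc + 1) + a₀ * (Cc + a₀)) * (4 * Lam ^ 2) / r ^ 2
    + (Cc + a₀) * (2 * Lam ^ 2) / r ^ 2 with hD₂
  have hD₁0 : 0 ≤ D₁ := by positivity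
  have hD₂0 : 0 ≤ D₂ := by positivity
  refine ⟨Cf * (1 + D₁ + D₂), by positivity, ?_⟩
  intro s hs B hB e he u u' u'' M M' M'' hu hu' hu'' hM hM' hM'' hd hd' x
  have hM0 : 0 ≤ M := (abs_nonneg _).trans (hM 0)
  have hc0 : 0 ≤ cns n s := by
    obtain ⟨a, b, ha, hab, hc⟩ := cns_bounds hn
    refine le_trans ?_ (hc s hs).1
    have : 0 < 1 - s := by linarith [hs.2]
    have := hs.1
    positivity
  have hδ : 0 < r ^ 2 := by positivity
  set a := ((n:ℝ) + 2 * s) / 2 with ha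
  have ha0 : 0 ≤ a := by have := hs.1; positivity
  have haa : a ≤ a₀ := by rw [ha, ha₀]; linarith [hs.2]
  set H := hker (cns n s) (n + 2 * s) B with hH
  have hH0 : ∀ z, 0 ≤ H z := fun z => hker_nonneg hc0 B z
  have hHm : Measurable H := hker_measurable B
  have hBm : Measurable fun z : En n => ‖B z‖ := B.continuous.norm.measurable
  have hIm : Measurable fun z : En n => (2 * inner ℝ (B z) (B e) : ℝ) :=
    ((B.continuous.inner continuous_const).const_mul 2 |>.measurable)
  obtain ⟨hfm, hfm'⟩ := @farProfile_measurable (r ^ 2) a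
  set κ₀ := farK s lam B with hκ₀
  set κ₁ : En n → ℝ := fun z => H z * farProfile (r ^ 2) a (‖B z‖ ^ 2) * (2 * inner ℝ (B z) (B e))
    with hκ₁
  set κ₂ : En n → ℝ := fun z => H z * ((farProfile' (r ^ 2) a (‖B z‖ ^ 2)
    - a * farProfile (r ^ 2) a (‖B z‖ ^ 2) / ‖B z‖ ^ 2) * (2 * inner ℝ (B z) (B e)) ^ 2
    + farProfile (r ^ 2) a (‖B z‖ ^ 2) * (2 * ‖B e‖ ^ 2)) with hκ₂
  have hBe : ‖B e‖ ≤ Lam := by simpa [he] using (hB e).2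
  obtain ⟨i0, v0⟩ := hfar s hs B hB 1 κ₀ zero_le_one
    (hHm.mul (cut_contDiff.continuous.measurable.comp ((hBm.pow_const 2).div_const _)))
    (fun z => by
      rw [hκ₀, farK, abs_mul, abs_of_nonneg (hH0 z), abs_of_nonneg (cut_nonneg _), one_mul]
      exact mul_le_of_le_one_right (hH0 z) (cut_le_one _))
    (fun z hz => by rw [hκ₀, farK, cut_div_zero hδ hz, mul_zero])
  have hpos : ∀ z, ¬ ‖B z‖ ^ 2 ≤ r ^ 2 → r < ‖B z‖ := fun z hz => by
    by_contra h
    exact hz (pow_le_pow_left₀ (norm_nonneg _) (not_lt.1 h) 2)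
  have z1 : ∀ z, ‖B z‖ ^ 2 ≤ r ^ 2 → κ₁ z = 0 := fun z hz => by
    simp [hκ₁, farProfile_zero hδ hz]
  have z2 : ∀ z, ‖B z‖ ^ 2 < r ^ 2 → κ₂ z = 0 := fun z hz => by
    have h : ‖B z‖ ^ 2 / r ^ 2 < 1 := (div_lt_one hδ).2 hz
    simp [hκ₂, farProfile_zero hδ hz.le, farProfile', cut_zero h.le, cut_deriv_left h.le,
      cut_deriv₂_outside (Or.inl h)]
  have z2' : ∀ z, ‖B z‖ ^ 2 ≤ r ^ 2 → κ₂ z = 0 := fun z hz => by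
    rcases hz.lt_or_eq with h | h
    · exact z2 z h
    have h1 : deriv (deriv cut) 1 = 0 := by
      have hcl : IsClosed {t | deriv (deriv cut) t = 0} :=
        isClosed_eq cut_deriv₂_continuous continuous_const
      have : closure (Iio (1:ℝ)) ⊆ {t | deriv (deriv cut) t = 0} :=
        hcl.closure_subset_iff.2 fun t ht => cut_deriv₂_outside (Or.inl ht)
      rw [closure_Iio] at this
      exact this self_mem_Iic
    have h2 : ‖B z‖ ^ 2 / r ^ 2 = 1 := by rw [h, div_self hδ.ne']
    simp only [hκ₂, farProfile_zero hδ hz, farProfile', h2, cut_zero le_rfl, cut_deriv_left le_rfl,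
      h1]
    ring
  obtain ⟨i1, v1⟩ := hfar s hs B hB D₁ κ₁ hD₁0 (by fun_prop)
    (fun z => by
      by_cases hz : ‖B z‖ ^ 2 ≤ r ^ 2
      · rw [z1 z hz, abs_zero]; exact mul_nonneg hD₁0 (hH0 z)
      have hb := hpos z hz
      have hb0 := hr0.trans hb
      have h1 := (farProfile_bound hCc hδ ha0 haa (pow_pos hb0 2)).1
      have h2 := abs_two_inner_le hB he z
      rw [hκ₁]
      simp only
      rw [abs_mul, abs_mul, abs_of_nonneg (hH0 z), mul_assoc, mul_comm D₁]
      refine mul_le_mul_of_nonneg_left ?_ (hH0 z)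
      calc _ ≤ (Cc + a₀) / ‖B z‖ ^ 2 * (2 * Lam * ‖B z‖) := by gcongr
        _ = (Cc + a₀) * (2 * Lam) / ‖B z‖ := by field_simp
        _ ≤ D₁ := by rw [hD₁]; gcongr)
    z1
  obtain ⟨i2, v2⟩ := hfar s hs B hB D₂ κ₂ hD₂0 (by fun_prop)
    (fun z => by
      by_cases hz : ‖B z‖ ^ 2 ≤ r ^ 2
      · rw [z2' z hz, abs_zero]; exact mul_nonneg hD₂0 (hH0 z)
      have hb := hpos z hz
      have hb0 := hr0.trans hb
      obtain ⟨h1, h1'⟩ := farProfile_bound hCc hδ ha0 haa (pow_pos hb0 2)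
      have h2 := abs_two_inner_le hB he z
      rw [hκ₂]
      simp only
      rw [abs_mul, abs_of_nonneg (hH0 z), mul_comm D₂]
      refine mul_le_mul_of_nonneg_left ?_ (hH0 z)
      refine (abs_add_le _ _).trans ?_
      rw [abs_mul, abs_mul, abs_pow, abs_of_nonneg (by positivity : (0:ℝ) ≤ 2 * ‖B e‖ ^ 2)]
      calc _ ≤ (Cc + a₀ * (Cc + 1) + a₀ * (Cc + a₀)) / (‖B z‖ ^ 2) ^ 2 * (2 * Lam * ‖B z‖) ^ 2
            + (Cc + a₀) / ‖B z‖ ^ 2 * (2 * Lam ^ 2) := by gcongr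
        _ = (Cc + a₀ * (Cc + 1) + a₀ * (Cc + a₀)) * (4 * Lam ^ 2) / ‖B z‖ ^ 2
            + (Cc + a₀) * (2 * Lam ^ 2) / ‖B z‖ ^ 2 := by field_simp; ring
        _ ≤ D₂ := by rw [hD₂]; gcongr)
    z2'
  have d0 : ∀ z, HasLineDerivAt ℝ κ₀ (κ₁ z) z e := fun z => 
    hker_mul_hasLineDerivAt hδ (fun q hq => cut_div_zero hδ hq) (fun q => cut_div_hasDerivAt _ q) B e z
  have d1 : ∀ z, HasLineDerivAt ℝ κ₁ (κ₂ z) z e := fun z => 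
    hker_mul_hasLineDerivAt₂ hδ (fun q hq => farProfile_zero hδ hq)
      (fun q => farProfile_hasDerivAt hδ q) B e z
  have cs : Continuous fun z : En n => x + z := continuous_const.add continuous_id
  have e1 := integral_mul_lineDeriv i0 i1 d0 (fun z => (hd (x + z)).comp_const_add')
    (hu.comp cs) (hu'.comp cs) (fun z => hM _) (fun z => hM' _)
  have e2 := integral_mul_lineDeriv i0 i1 d0 (fun z => (hd' (x + z)).comp_const_add')
    (hu'.comp cs) (hu''.comp cs) (fun z => hM' _) (fun z => hM'' _)
  have e3 := integral_mul_lineDeriv i1 i2 d1 (fun z => (hd (x + z)).comp_const_add')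
    (hu.comp cs) (hu'.comp cs) (fun z => hM _) (fun z => hM' _)
  have b0 := abs_integral_mul_le (v := fun z => u (x + z)) i0 (fun z => hM _)
  have b1 := abs_integral_mul_le (v := fun z => u (x + z)) i1 (fun z => hM _)
  have b2 := abs_integral_mul_le (v := fun z => u (x + z)) i2 (fun z => hM _)
  have f0 : Cf * 1 * M ≤ Cf * (1 + D₁ + D₂) * M := by gcongr; linarith
  have f1 : Cf * D₁ * M ≤ Cf * (1 + D₁ + D₂) * M := by gcongr; linarith
  have f2 : Cf * D₂ * M ≤ Cf * (1 + D₁ + D₂) * M := by gcongr; linarith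
  refine ⟨?_, ?_, ?_⟩
  · linarith [mul_le_mul_of_nonneg_left v0 hM0]
  · rw [e1, abs_neg]
    linarith [mul_le_mul_of_nonneg_left v1 hM0]
  · rw [e2, abs_neg, e3, abs_neg]
    linarith [mul_le_mul_of_nonneg_left v2 hM0]

lemma cns_nonneg {n : ℕ} (hn : 0 < n) {s : ℝ} (hs : s ∈ Ioo (0:ℝ) 1) : 0 ≤ cns n s := by
  obtain ⟨a, b, ha, hab, hc⟩ := cns_bounds hn
  have h1 : 0 < 1 - s := sub_pos.2 hs.2
  have h2 := hs.1
  exact (by positivity : 0 ≤ a * (s * (1 - s))).trans (hc s hs).1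

lemma hker_integral_compl {n : ℕ} (hn : 0 < n) {lam Lam : ℝ} (hl : 0 < lam) (hl1 : lam ≤ 1) :
    ∃ C : ℝ, 0 < C ∧ ∀ s ∈ Ioo (0:ℝ) 1, ∀ B : En n →L[ℝ] En n, Elliptic lam Lam B →
    ∀ (b D : ℝ) (κ : En n → ℝ), 0 < b → 0 ≤ D → Measurable κ →
    (∀ z, b ≤ ‖z‖ → |κ z| ≤ D * hker (cns n s) (n + 2 * s) B z) → (∀ z, ‖z‖ < b → κ z = 0) →
    Integrable κ ∧ ∫ z, |κ z| ≤ C * D * b ^ (-(2 * s)) := by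
  obtain ⟨a, c, ha, hac, hc⟩ := cns_bounds hn
  have hS := sphereMass_pos hn
  have hcp : 0 < c := ha.trans_le hac
  refine ⟨(lam⁻¹) ^ (n + 2) * sphereMass n * c, by positivity, ?_⟩
  intro s hs B hB b D κ hb hD hκ h1 h0
  have hs0 := hs.1
  have hs1 := hs.2
  have hc0 := cns_nonneg hn hs
  obtain ⟨hi, hv⟩ := integrable_of_decay hn hs0 hb hκ (D := D * (cns n s * (lam⁻¹) ^ (n + 2)))
    (fun z hz => (h1 z hz).trans (by
      rw [mul_assoc D]
      exact mul_le_mul_of_nonneg_left (hker_le hc0 (by positivity) (by linarith) hl hl1 hB z) hD))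
    h0
  refine ⟨hi, hv.trans ?_⟩
  have hcs : cns n s / (2 * s) ≤ c := by
    rw [div_le_iff₀ (by positivity)]
    have := mul_pos hcp hs0
    nlinarith [(hc s hs).2]
  calc D * (cns n s * lam⁻¹ ^ (n + 2)) * (sphereMass n * (b ^ (-(2 * s)) / (2 * s)))
      = D * lam⁻¹ ^ (n + 2) * sphereMass n * b ^ (-(2 * s)) * (cns n s / (2 * s)) := by ring
    _ ≤ D * lam⁻¹ ^ (n + 2) * sphereMass n * b ^ (-(2 * s)) * c := by gcongr
    _ = _ := by ring

lemma norm_rpow_neg_mul_sq_le {n : ℕ} (p : ℝ) (z : En n) :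
    ‖z‖ ^ (-p) * ‖z‖ ^ 2 ≤ ‖z‖ ^ (2 - p) := by
  by_cases hz : z = 0
  · subst hz
    simpa using Real.rpow_nonneg (le_refl (0:ℝ)) _
  · have : 0 < ‖z‖ := norm_pos_iff.2 hz
    rw [← Real.rpow_natCast, ← Real.rpow_add this]
    apply le_of_eq; congr 1; push_cast; ring

lemma hker_integral_ball {n : ℕ} (hn : 0 < n) {lam Lam : ℝ} (hl : 0 < lam) (hl1 : lam ≤ 1) :
    ∃ C : ℝ, 0 < C ∧ ∀ s ∈ Ioo (0:ℝ) 1, ∀ B : En n →L[ℝ] En n, Elliptic lam Lam B →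
    ∀ (b D : ℝ) (κ : En n → ℝ), 0 < b → 0 ≤ D → Measurable κ →
    (∀ z, ‖z‖ ≤ b → |κ z| ≤ D * (hker (cns n s) (n + 2 * s) B z * ‖z‖ ^ 2)) →
    (∀ z, b < ‖z‖ → κ z = 0) →
    Integrable κ ∧ ∫ z, |κ z| ≤ C * D * b ^ (2 - 2 * s) := by
  obtain ⟨a, c, ha, hac, hc⟩ := cns_bounds hn
  have hS := sphereMass_pos hn
  have hcp : 0 < c := ha.trans_le hac
  refine ⟨(lam⁻¹) ^ (n + 2) * sphereMass n * c, by positivity, ?_⟩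
  intro s hs B hB b D κ hb hD hκ h1 h0
  have hs0 := hs.1
  have hs1 := hs.2
  have hs1' : 0 < 2 - 2 * s := by linarith
  have hc0 := cns_nonneg hn hs
  obtain ⟨hi, hv⟩ := radial_ball hn (α := 2 - ((n:ℝ) + 2 * s)) (a := b) (by linarith) hb
  rw [← integrable_indicator_iff measurableSet_closedBall] at hi
  set D' := D * (cns n s * (lam⁻¹) ^ (n + 2)) with hD'
  have hle : ∀ z, |κ z| ≤ D' * (closedBall (0 : En n) b).indicator
      (fun z => ‖z‖ ^ (2 - ((n:ℝ) + 2 * s))) z := by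
    intro z
    by_cases h : ‖z‖ ≤ b
    · rw [indicator_of_mem (show z ∈ closedBall (0 : En n) b by simpa using h)]
      refine (h1 z h).trans ?_
      rw [hD', mul_assoc D]
      refine mul_le_mul_of_nonneg_left ?_ hD
      calc _ ≤ cns n s * lam⁻¹ ^ (n + 2) * ‖z‖ ^ (-((n:ℝ) + 2 * s)) * ‖z‖ ^ 2 :=
            mul_le_mul_of_nonneg_right (hker_le hc0 (by positivity) (by linarith) hl hl1 hB z)
              (by positivity)
        _ ≤ _ := by
            rw [mul_assoc (cns n s * _)]
            exact mul_le_mul_of_nonneg_left (norm_rpow_neg_mul_sq_le _ z) (by positivity)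
    · rw [indicator_of_notMem (show z ∉ closedBall (0 : En n) b by simpa using h),
        h0 z (not_le.1 h)]
      simp
  have hint : Integrable κ := (hi.const_mul D').mono' hκ.aestronglyMeasurable
    (ae_of_all _ fun z => by rw [Real.norm_eq_abs]; exact hle z)
  refine ⟨hint, (integral_mono hint.abs (hi.const_mul D') hle).trans ?_⟩
  rw [integral_const_mul, integral_indicator measurableSet_closedBall, hv,
    show (n:ℝ) + (2 - (n + 2 * s)) = 2 - 2 * s by ring]
  have hcs : cns n s / (2 - 2 * s) ≤ c := by
    rw [div_le_iff₀ hs1']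
    have := mul_pos hcp (sub_pos.2 hs1)
    nlinarith [(hc s hs).2]
  calc D' * (sphereMass n * (b ^ (2 - 2 * s) / (2 - 2 * s)))
      = D * lam⁻¹ ^ (n + 2) * sphereMass n * b ^ (2 - 2 * s) * (cns n s / (2 - 2 * s)) := by
        rw [hD']; ring
    _ ≤ D * lam⁻¹ ^ (n + 2) * sphereMass n * b ^ (2 - 2 * s) * c := by gcongr
    _ = _ := by ring

/-- The kernel truncated smoothly at scale `ρ`, and completely at the smaller scale `ε`. -/
def truncK {n : ℕ} (s ρ ε : ℝ) (B : En n →L[ℝ] En n) (z : En n) : ℝ :=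
  hker (cns n s) (n + 2 * s) B z * (ramp (‖B z‖ ^ 2 / ρ ^ 2) * cut (‖B z‖ ^ 2 / ε ^ 2))

lemma truncK_measurable {n : ℕ} {s ρ ε : ℝ} (B : En n →L[ℝ] En n) :
    Measurable (truncK s ρ ε B) := by
  have hBm : Measurable fun z : En n => ‖B z‖ := B.continuous.norm.measurable
  have hc := cut_contDiff.continuous.measurable
  have hr : Measurable ramp := by unfold ramp; fun_prop
  have hH := @hker_measurable n (cns n s) (n + 2 * s) B
  unfold truncK
  fun_prop

lemma truncK_nonneg {n : ℕ} (hn : 0 < n) {s ρ ε : ℝ} (hs : s ∈ Ioo (0:ℝ) 1)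
    (B : En n →L[ℝ] En n) (z : En n) : 0 ≤ truncK s ρ ε B z :=
  mul_nonneg (hker_nonneg (cns_nonneg hn hs) B z)
    (mul_nonneg (ramp_nonneg (by positivity)) (cut_nonneg _))

lemma truncK_le {n : ℕ} (hn : 0 < n) {s ρ ε : ℝ} (hs : s ∈ Ioo (0:ℝ) 1)
    (B : En n →L[ℝ] En n) (z : En n) :
    truncK s ρ ε B z ≤ hker (cns n s) (n + 2 * s) B z * min 1 (2 * (‖B z‖ ^ 2 / ρ ^ 2)) := by
  refine mul_le_mul_of_nonneg_left ?_ (hker_nonneg (cns_nonneg hn hs) B z)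
  exact (mul_le_of_le_one_right (ramp_nonneg (by positivity)) (cut_le_one _)).trans
    (le_min (ramp_le_one _) ramp_le)

lemma truncK_integral_le {n : ℕ} (hn : 0 < n) {lam Lam : ℝ} (hl : 0 < lam) (hl1 : lam ≤ 1) :
    ∃ C : ℝ, 0 < C ∧ ∀ s ∈ Ioo (0:ℝ) 1, ∀ B : En n →L[ℝ] En n, Elliptic lam Lam B →
    ∀ ρ ε : ℝ, 0 < ρ → Integrable (truncK s ρ ε B) ∧
      ∫ z, truncK s ρ ε B z ≤ C * ρ ^ (-(2 * s)) := by
  obtain ⟨C₁, hC₁, h₁⟩ := hker_integral_compl hn (Lam := Lam) hl hl1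
  obtain ⟨C₂, hC₂, h₂⟩ := hker_integral_ball hn (Lam := Lam) hl hl1
  refine ⟨C₁ + C₂ * (2 * Lam ^ 2), by positivity, ?_⟩
  intro s hs B hB ρ ε hρ
  have hm := @truncK_measurable n s ρ ε B
  have h0 : ∀ z, 0 ≤ truncK s ρ ε B z := truncK_nonneg hn hs B
  have hle : ∀ z, truncK s ρ ε B z ≤ _ := truncK_le hn hs B
  have hH : ∀ z, 0 ≤ hker (cns n s) (n + 2 * s) B z := fun z => hker_nonneg (cns_nonneg hn hs) B z
  set S := {z : En n | ρ ≤ ‖z‖} with hS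
  have hSm : MeasurableSet S := measurableSet_norm_ge ρ
  obtain ⟨i1, v1⟩ := h₁ s hs B hB ρ 1 (S.indicator (truncK s ρ ε B)) hρ zero_le_one
    (hm.indicator hSm) (fun z hz => by
      rw [indicator_of_mem (show z ∈ S from hz), abs_of_nonneg (h0 z), one_mul]
      exact (hle z).trans (mul_le_of_le_one_right (hH z) (min_le_left _ _)))
    (fun z hz => indicator_of_notMem (show z ∉ S from not_le.2 hz) _)
  obtain ⟨i2, v2⟩ := h₂ s hs B hB ρ (2 * Lam ^ 2 / ρ ^ 2) (Sᶜ.indicator (truncK s ρ ε B)) hρ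
    (by positivity) (hm.indicator hSm.compl) (fun z hz => by
      have hb : |Sᶜ.indicator (truncK s ρ ε B) z| ≤ truncK s ρ ε B z := by
        rw [abs_of_nonneg (indicator_nonneg (fun z _ => h0 z) z)]
        exact indicator_le_self' (fun z _ => h0 z) z
      refine hb.trans ((hle z).trans ?_)
      rw [← mul_assoc, mul_comm _ (hker _ _ _ _), mul_assoc]
      refine mul_le_mul_of_nonneg_left ((min_le_right _ _).trans ?_) (hH z)
      have := pow_le_pow_left₀ (norm_nonneg _) (hB z).2 2
      calc 2 * (‖B z‖ ^ 2 / ρ ^ 2) ≤ 2 * ((Lam * ‖z‖) ^ 2 / ρ ^ 2) := by gcongr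
        _ = _ := by ring)
    (fun z hz => indicator_of_notMem (fun h => (show z ∉ S from h) hz.le) _)
  have hsum : S.indicator (truncK s ρ ε B) + Sᶜ.indicator (truncK s ρ ε B) = truncK s ρ ε B :=
    indicator_self_add_compl S _
  have hi : Integrable (truncK s ρ ε B) := hsum ▸ i1.add i2
  refine ⟨hi, ?_⟩
  have h3 : ∫ z, truncK s ρ ε B z = (∫ z, S.indicator (truncK s ρ ε B) z)
      + ∫ z, Sᶜ.indicator (truncK s ρ ε B) z := by
    rw [← integral_add i1 i2]
    exact congrArg _ hsum.symm
  rw [h3]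
  have h4 := fun f : En n → ℝ => (le_abs_self (∫ z, f z)).trans abs_integral_le_integral_abs
  have e : ρ ^ (2 - 2 * s) = ρ ^ 2 * ρ ^ (-(2 * s)) := by
    rw [← Real.rpow_natCast, ← Real.rpow_add hρ]; congr 1
  rw [e] at v2
  calc _ ≤ C₁ * 1 * ρ ^ (-(2 * s)) + C₂ * (2 * Lam ^ 2 / ρ ^ 2) * (ρ ^ 2 * ρ ^ (-(2 * s))) :=
        add_le_add ((h4 _).trans v1) ((h4 _).trans v2)
    _ = _ := by field_simp

lemma truncK_integral_ge {n : ℕ} (hn : 0 < n) {lam Lam : ℝ} (hl : 0 < lam) (hl1 : lam ≤ 1)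
    (hL : 1 ≤ Lam) : ∃ c : ℝ, 0 < c ∧ ∀ s ∈ Ioo (0:ℝ) 1, ∀ B : En n →L[ℝ] En n,
    Elliptic lam Lam B → ∀ ρ : ℝ, 0 < ρ → ∃ ε : ℝ, 0 < ε ∧ 2 * ε ^ 2 ≤ ρ ^ 2 ∧
      c * ρ ^ (-(2 * s)) ≤ ∫ z, truncK s ρ ε B z := by
  obtain ⟨a₀, c₀, ha₀, -, hc⟩ := cns_bounds hn
  obtain ⟨C, hC, hint⟩ := truncK_integral_le hn (Lam := Lam) hl hl1
  have hS := sphereMass_pos hn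
  have hL0 : 0 < Lam := by linarith
  set c₂ := a₀ * (Lam⁻¹) ^ (n + 2) * lam ^ 2 * sphereMass n * (Lam⁻¹) ^ 2 / 4 with hc₂
  have hc₂0 : 0 < c₂ := by positivity
  refine ⟨c₂ / 2, by positivity, ?_⟩
  intro s hs B hB ρ hρ
  have hs0 := hs.1
  have hs1 := hs.2
  have hs1' : 0 < 2 - 2 * s := by linarith
  have hs1'' : 0 < 1 - s := by linarith
  have hc0 := cns_nonneg hn hs
  set a := ρ / Lam with ha
  have ha0 : 0 < a := by positivity
  set b := a * (1 / 2 : ℝ) ^ (1 / (2 - 2 * s)) with hb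
  have hb0 : 0 < b := by positivity
  have hba : b ≤ a := by
    refine mul_le_of_le_one_right ha0.le (Real.rpow_le_one (by norm_num) (by norm_num) ?_)
    positivity
  have hbpow : b ^ (2 - 2 * s) = a ^ (2 - 2 * s) / 2 := by
    rw [hb, Real.mul_rpow ha0.le (by positivity), ← Real.rpow_mul (by norm_num),
      one_div_mul_cancel hs1'.ne', Real.rpow_one]
    ring
  have haρ : a ≤ ρ := div_le_self hρ.le hL
  set ε := lam * b / 2 with hε
  have hε0 : 0 < ε := by positivity
  have hεb : 2 * ε ^ 2 ≤ (lam * b) ^ 2 := by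
    rw [hε]; nlinarith [sq_nonneg (lam * b)]
  have hερ : 2 * ε ^ 2 ≤ ρ ^ 2 := hεb.trans (pow_le_pow_left₀ (by positivity)
    ((mul_le_of_le_one_left hb0.le hl1).trans (hba.trans haρ)) 2)
  refine ⟨ε, hε0, hερ, ?_⟩
  obtain ⟨hi, -⟩ := hint s hs B hB ρ ε hρ
  set k := cns n s * (Lam⁻¹) ^ (n + 2) with hk
  have hk0 : 0 ≤ k := by positivity
  have hka : a₀ * (s * (1 - s)) * (Lam⁻¹) ^ (n + 2) ≤ k :=
    mul_le_mul_of_nonneg_right (hc s hs).1 (by positivity)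
  have hge : ∀ z, k * ‖z‖ ^ (-((n:ℝ) + 2 * s)) ≤ hker (cns n s) (n + 2 * s) B z := fun z =>
    hker_ge hc0 (by positivity) (by linarith) hl hL hB z
  have h0 : ∀ z, 0 ≤ truncK s ρ ε B z := truncK_nonneg hn hs B
  have hcut : ∀ z, b ≤ ‖z‖ → cut (‖B z‖ ^ 2 / ε ^ 2) = 1 := fun z hz => by
    refine cut_one ?_
    rw [le_div_iff₀ (by positivity)]
    exact hεb.trans (pow_le_pow_left₀ (by positivity)
      ((mul_le_mul_of_nonneg_left hz hl.le).trans (hB z).1) 2)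
  have eρ : ρ ^ (2 - 2 * s) = ρ ^ 2 * ρ ^ (-(2 * s)) := by
    rw [← Real.rpow_natCast, ← Real.rpow_add hρ]; congr 1
  have hfar : c₂ * (1 - s) * ρ ^ (-(2 * s)) ≤ ∫ z, truncK s ρ ε B z := by
    obtain ⟨j, v⟩ := radial_compl hn (α := -((n:ℝ) + 2 * s)) (a := ρ / lam) (by linarith)
      (by positivity)
    have hm := measurableSet_norm_ge (n := n) (ρ / lam)
    rw [← integrable_indicator_iff hm] at j
    have hle : ∀ z, k * ({z : En n | ρ / lam ≤ ‖z‖}).indicator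
        (fun z => ‖z‖ ^ (-((n:ℝ) + 2 * s))) z ≤ truncK s ρ ε B z := by
      intro z
      by_cases h : ρ / lam ≤ ‖z‖
      · rw [indicator_of_mem (show z ∈ {z : En n | ρ / lam ≤ ‖z‖} from h), truncK, hcut z
          ((hba.trans haρ).trans ((le_div_self hρ.le hl hl1).trans h)), ramp_one, one_mul, mul_one]
        · exact hge z
        · rw [one_le_div (by positivity)]
          rw [div_le_iff₀' hl] at h
          exact pow_le_pow_left₀ hρ.le (h.trans (hB z).1) 2
      · rw [indicator_of_notMem (show z ∉ {z : En n | ρ / lam ≤ ‖z‖} from h), mul_zero]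
        exact h0 z
    refine le_trans ?_ (integral_mono (j.const_mul k) hi hle)
    rw [integral_const_mul, integral_indicator hm, v, show -((n:ℝ) + -(n + 2 * s)) = 2 * s by ring,
      show (n:ℝ) + -(n + 2 * s) = -(2 * s) by ring, Real.div_rpow hρ.le hl.le]
    have h1 : lam ^ 2 ≤ (lam ^ (-(2 * s)))⁻¹ := by
      rw [Real.rpow_neg hl.le, inv_inv, ← Real.rpow_natCast]
      exact Real.rpow_le_rpow_of_exponent_ge hl hl1 (by push_cast; linarith)
    have h2 : (Lam⁻¹) ^ 2 ≤ 1 := pow_le_one₀ (by positivity) (inv_le_one_of_one_le₀ hL)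
    calc c₂ * (1 - s) * ρ ^ (-(2 * s))
        = (a₀ * (s * (1 - s)) * (Lam⁻¹) ^ (n + 2)) * (sphereMass n *
          (ρ ^ (-(2 * s)) * lam ^ 2 / (2 * s))) * ((Lam⁻¹) ^ 2 / 2) := by
          rw [hc₂]; field_simp; ring
      _ ≤ (a₀ * (s * (1 - s)) * (Lam⁻¹) ^ (n + 2)) * (sphereMass n *
          (ρ ^ (-(2 * s)) * lam ^ 2 / (2 * s))) * 1 := by gcongr; linarith
      _ ≤ k * (sphereMass n * (ρ ^ (-(2 * s)) / lam ^ (-(2 * s)) / (2 * s))) := by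
          rw [mul_one, div_eq_mul_inv (ρ ^ _) (lam ^ _)]; gcongr
  have hnear : c₂ * s * ρ ^ (-(2 * s)) ≤ ∫ z, truncK s ρ ε B z := by
    obtain ⟨j, v⟩ := radial_ball hn (α := 2 - ((n:ℝ) + 2 * s)) (a := a) (by linarith) ha0
    obtain ⟨j', v'⟩ := radial_ball hn (α := 2 - ((n:ℝ) + 2 * s)) (a := b) (by linarith) hb0
    rw [← integrable_indicator_iff measurableSet_closedBall] at j j'
    set W : En n → ℝ := fun z => ‖z‖ ^ (2 - ((n:ℝ) + 2 * s)) with hW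
    have hle : ∀ z, k * (lam ^ 2 / ρ ^ 2) * ((closedBall (0 : En n) a).indicator W z
        - (closedBall (0 : En n) b).indicator W z) ≤ truncK s ρ ε B z := by
      intro z
      by_cases h : ‖z‖ ≤ b
      · rw [indicator_of_mem (show z ∈ closedBall (0 : En n) b by simpa using h),
          indicator_of_mem (show z ∈ closedBall (0 : En n) a by simpa using h.trans hba), sub_self,
          mul_zero]
        exact h0 z
      rw [indicator_of_notMem (show z ∉ closedBall (0 : En n) b by simpa using h), sub_zero]
      push Not at h
      by_cases h' : ‖z‖ ≤ a
      · rw [indicator_of_mem (show z ∈ closedBall (0 : En n) a by simpa using h'), truncK,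
          hcut z h.le, mul_one]
        have hz : 0 < ‖z‖ := hb0.trans h
        have hq : ‖B z‖ ^ 2 / ρ ^ 2 ≤ 1 := by
          rw [div_le_one (by positivity)]
          refine pow_le_pow_left₀ (norm_nonneg _) ((hB z).2.trans ?_) 2
          rwa [ha, le_div_iff₀' hL0] at h'
        have e : W z = ‖z‖ ^ (-((n:ℝ) + 2 * s)) * ‖z‖ ^ 2 := by
          rw [hW, ← Real.rpow_natCast, ← Real.rpow_add hz]
          push_cast; ring_nf
        calc k * (lam ^ 2 / ρ ^ 2) * W z
            = k * ‖z‖ ^ (-((n:ℝ) + 2 * s)) * ((lam * ‖z‖) ^ 2 / ρ ^ 2) := by rw [e]; ring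
          _ ≤ hker (cns n s) (n + 2 * s) B z * (‖B z‖ ^ 2 / ρ ^ 2) := by
              gcongr
              · exact hker_nonneg hc0 B z
              · exact hge z
              · exact (hB z).1
          _ ≤ _ := mul_le_mul_of_nonneg_left (ramp_ge (by positivity) hq) (hker_nonneg hc0 B z)
      · rw [indicator_of_notMem (show z ∉ closedBall (0 : En n) a by simpa using h'), mul_zero]
        exact h0 z
    refine le_trans ?_ (integral_mono ((j.sub j').const_mul _) hi hle)
    have e2 : ∫ z, ((closedBall (0 : En n) a).indicator W z
        - (closedBall (0 : En n) b).indicator W z)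
        = sphereMass n * (a ^ (2 - 2 * s) / 2 / (2 - 2 * s)) := by
      rw [integral_sub j j', integral_indicator measurableSet_closedBall,
        integral_indicator measurableSet_closedBall, v, v',
        show (n:ℝ) + (2 - (n + 2 * s)) = 2 - 2 * s by ring, hbpow]
      ring
    have e3 := integral_const_mul (μ := (volume : Measure (En n))) (k * (lam ^ 2 / ρ ^ 2))
      (fun z => (closedBall (0 : En n) a).indicator W z - (closedBall (0 : En n) b).indicator W z)
    refine le_trans ?_ e3.ge
    rw [e2, ha, Real.div_rpow hρ.le hL0.le, eρ]
    have h1 : (Lam⁻¹) ^ 2 ≤ (Lam ^ (2 - 2 * s))⁻¹ := by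
      rw [inv_pow]
      refine inv_anti₀ (by positivity) ?_
      rw [← Real.rpow_natCast]
      exact Real.rpow_le_rpow_of_exponent_le hL (by push_cast; linarith)
    calc c₂ * s * ρ ^ (-(2 * s))
        = (a₀ * (s * (1 - s)) * (Lam⁻¹) ^ (n + 2)) * (lam ^ 2 / ρ ^ 2) * (sphereMass n *
          (ρ ^ 2 * ρ ^ (-(2 * s)) * (Lam⁻¹) ^ 2 / 2 / (2 - 2 * s))) := by
          rw [hc₂, show 2 - 2 * s = 2 * (1 - s) by ring]; field_simp; ring
      _ ≤ k * (lam ^ 2 / ρ ^ 2) * (sphereMass n *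
          (ρ ^ 2 * ρ ^ (-(2 * s)) / Lam ^ (2 - 2 * s) / 2 / (2 - 2 * s))) := by
          rw [div_eq_mul_inv _ (Lam ^ (2 - 2 * s))]; gcongr
  have : 0 < ρ ^ (-(2 * s)) := by positivity
  nlinarith

/-- Radial profile of the near part of the truncated kernel. -/
def nearProfile (δ ρ ε q : ℝ) : ℝ := ramp (q / ρ ^ 2) * cut (q / ε ^ 2) * (1 - cut (q / δ))

def nearProfile' (δ ρ ε q : ℝ) : ℝ :=
  (2 * max (1 - q / ρ ^ 2) 0 / ρ ^ 2 * cut (q / ε ^ 2)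
    + ramp (q / ρ ^ 2) * (deriv cut (q / ε ^ 2) / ε ^ 2)) * (1 - cut (q / δ))
    + ramp (q / ρ ^ 2) * cut (q / ε ^ 2) * (-(deriv cut (q / δ) / δ))

lemma nearProfile_hasDerivAt (δ ρ ε q : ℝ) :
    HasDerivAt (nearProfile δ ρ ε) (nearProfile' δ ρ ε q) q := by
  have h1 := (ramp_hasDerivAt (q / ρ ^ 2)).comp q ((hasDerivAt_id q).div_const (ρ ^ 2))
  have h2 := cut_div_hasDerivAt (ε ^ 2) q
  have h3 := (cut_div_hasDerivAt δ q).const_sub 1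
  refine ((h1.mul h2).mul h3).congr_deriv ?_
  simp only [nearProfile', Function.comp_def, Pi.mul_apply, id]
  ring

lemma nearProfile_bound {C δ ρ ε a a₀ q : ℝ} (hC : ∀ t, |t * deriv cut t| ≤ C)
    (hδ : 0 < δ) (hρ : 0 < ρ) (hε : 0 < ε) (ha : 0 ≤ a) (ha₀ : a ≤ a₀) (hq : 0 < q) :
    |nearProfile' δ ρ ε q - a * nearProfile δ ρ ε q / q|
      ≤ (1 + 2 * C + a₀) * min 1 (2 * (q / ρ ^ 2)) / q := by
  set t := q / ρ ^ 2 with ht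
  have ht0 : 0 ≤ t := by positivity
  set m := min 1 (2 * t) with hm
  have hm0 : 0 ≤ m := le_min zero_le_one (by positivity)
  obtain ⟨r1, r2⟩ := ramp_deriv_bound ht0
  have r3 : 0 ≤ ramp t := ramp_nonneg ht0
  have r4 : ramp t ≤ m := le_min (ramp_le_one _) ramp_le
  set X := t * (2 * max (1 - t) 0) with hX
  set R := ramp t
  have y1 := hC (q / ε ^ 2)
  have y2 := hC (q / δ)
  have c1 := cut_nonneg (q / ε ^ 2)
  have c2 := cut_le_one (q / ε ^ 2)
  have c3 := cut_nonneg (q / δ)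
  have c4 := cut_le_one (q / δ)
  set Y := q / ε ^ 2 * deriv cut (q / ε ^ 2) with hY
  set Z := q / δ * deriv cut (q / δ) with hZ
  set c := cut (q / ε ^ 2)
  set k := cut (q / δ)
  have e : nearProfile' δ ρ ε q - a * nearProfile δ ρ ε q / q
      = (X * (c * (1 - k)) + R * Y * (1 - k) - R * c * Z - a * R * (c * (1 - k))) / q := by
    rw [nearProfile', nearProfile, hX, hY, hZ, ht]
    field_simp
    ring
  rw [e, abs_div, abs_of_pos hq]
  refine div_le_div_of_nonneg_right ?_ hq.le
  have hC0 : 0 ≤ C := (abs_nonneg _).trans y1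
  have k0 : 0 ≤ c * (1 - k) := mul_nonneg c1 (by linarith)
  have k1 : c * (1 - k) ≤ 1 := mul_le_one₀ c2 (by linarith) (by linarith)
  have b1 : |X * (c * (1 - k))| ≤ m := by
    rw [abs_mul, abs_of_nonneg r1, abs_of_nonneg k0]
    exact (mul_le_of_le_one_right r1 k1).trans r2
  have b2 : |R * Y * (1 - k)| ≤ m * C := by
    rw [abs_mul, abs_mul, abs_of_nonneg r3, abs_of_nonneg (by linarith : 0 ≤ 1 - k)]
    exact (mul_le_of_le_one_right (by positivity) (by linarith)).trans
      (mul_le_mul r4 y1 (abs_nonneg _) hm0)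
  have b3 : |R * c * Z| ≤ m * C := by
    rw [abs_mul, abs_mul, abs_of_nonneg r3, abs_of_nonneg c1]
    exact mul_le_mul ((mul_le_of_le_one_right r3 c2).trans r4) y2 (abs_nonneg _) hm0
  have b4 : |a * R * (c * (1 - k))| ≤ a₀ * m := by
    rw [abs_mul, abs_mul, abs_of_nonneg r3, abs_of_nonneg k0, abs_of_nonneg ha]
    exact (mul_le_of_le_one_right (by positivity) k1).trans
      (mul_le_mul ha₀ r4 r3 (ha.trans ha₀))
  rw [abs_le] at *
  constructor <;> linarith [b1.1, b1.2, b2.1, b2.2, b3.1, b3.2, b4.1, b4.2]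

set_option maxHeartbeats 1000000 in
lemma near_kernel {n : ℕ} (hn : 0 < n) {lam Lam : ℝ} (hl : 0 < lam) (hl1 : lam ≤ 1)
    (hL : 1 ≤ Lam) : ∃ C : ℝ, 1 ≤ C ∧ ∀ s ∈ Ioo (0:ℝ) 1, ∀ B : En n →L[ℝ] En n,
    Elliptic lam Lam B → ∀ e : En n, ‖e‖ = 1 → ∀ ρ : ℝ, 0 < ρ → ρ ≤ lam / 8 →
    ∃ φ φ₁ φ₁' τ : En n → ℝ, Measurable φ ∧ Integrable φ ∧ Integrable φ₁ ∧ Integrable φ₁' ∧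
    Integrable τ ∧
    (∀ z, φ (-z) = φ z) ∧ (∀ z, 0 ≤ φ z) ∧ (∀ z, φ z ≤ hker (cns n s) (n + 2 * s) B z) ∧
    (∀ z, φ z = φ₁ z + farK s lam B z) ∧ (∀ z, HasLineDerivAt ℝ φ₁ (φ₁' z) z e) ∧
    (∀ z, |φ₁ z| ≤ φ z) ∧ (∀ z, 1 / 4 ≤ ‖z‖ → φ₁ z = 0 ∧ φ₁' z = 0) ∧
    (∀ z, ρ / lam ≤ ‖z‖ → φ z = hker (cns n s) (n + 2 * s) B z) ∧
    (∀ z, |φ₁' z| ≤ C / ρ ^ 2 * ((hker (cns n s) (n + 2 * s) B z - φ z) * ‖z‖) + τ z) ∧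
    (∀ z, 0 ≤ τ z) ∧ (∫ z, τ z ≤ C / ρ * ρ ^ (-(2 * s))) ∧
    C⁻¹ * ρ ^ (-(2 * s)) ≤ ∫ z, φ z ∧ (∫ z, φ z ≤ C * ρ ^ (-(2 * s))) ∧
    Integrable (fun z => (hker (cns n s) (n + 2 * s) B z - φ z) * ‖z‖ ^ 2) ∧
    ∫ z, (hker (cns n s) (n + 2 * s) B z - φ z) * ‖z‖ ^ 2 ≤ C * (ρ ^ 2 * ρ ^ (-(2 * s))) := by
  obtain ⟨C₁, hC₁, h₁⟩ := hker_integral_compl hn (Lam := Lam) hl hl1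
  obtain ⟨C₂, hC₂, h₂⟩ := hker_integral_ball hn (Lam := Lam) hl hl1
  obtain ⟨C₃, hC₃, h₃⟩ := truncK_integral_le hn (Lam := Lam) hl hl1
  obtain ⟨c₄, hc₄, h₄⟩ := truncK_integral_ge hn hl hl1 hL
  obtain ⟨Cc, hCc1, hCc⟩ := cut_deriv_bounds
  have hL0 : 0 < Lam := by linarith
  set a₀ : ℝ := (n + 2) / 2 with ha₀
  have ha₀0 : 0 < a₀ := by positivity
  set Cg := 1 + 2 * Cc + a₀ with hCg
  have hCg0 : 0 < Cg := by positivity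
  set C := 1 + 16 * Cg * Lam ^ 2 + C₁ * (4 * Cg * Lam) * (2 * Lam) ^ 2 + c₄⁻¹ + C₃
    + C₂ * (lam⁻¹) ^ 2 with hC
  have hC1 : 1 ≤ C := by rw [hC]; linarith [show 0 ≤ 16 * Cg * Lam ^ 2 + C₁ * (4 * Cg * Lam) * (2 * Lam) ^ 2 + c₄⁻¹ + C₃
    + C₂ * (lam⁻¹) ^ 2 by positivity]
  have hCb : 0 < C := by linarith
  have k1 : 16 * Cg * Lam ^ 2 ≤ C := by
    rw [hC]; linarith [show 0 ≤ C₁ * (4 * Cg * Lam) * (2 * Lam) ^ 2 + c₄⁻¹ + C₃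
    + C₂ * (lam⁻¹) ^ 2 by positivity]
  have k2 : C₁ * (4 * Cg * Lam) * (2 * Lam) ^ 2 ≤ C := by
    rw [hC]; linarith [show 0 ≤ 16 * Cg * Lam ^ 2 + c₄⁻¹ + C₃ + C₂ * (lam⁻¹) ^ 2 by positivity]
  have k3 : c₄⁻¹ ≤ C := by
    rw [hC]; linarith [show 0 ≤ 16 * Cg * Lam ^ 2 + C₁ * (4 * Cg * Lam) * (2 * Lam) ^ 2 + C₃
    + C₂ * (lam⁻¹) ^ 2 by positivity]
  have k4 : C₃ ≤ C := by
    rw [hC]; linarith [show 0 ≤ 16 * Cg * Lam ^ 2 + C₁ * (4 * Cg * Lam) * (2 * Lam) ^ 2 + c₄⁻¹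
    + C₂ * (lam⁻¹) ^ 2 by positivity]
  have k5 : C₂ * (lam⁻¹) ^ 2 ≤ C := by
    rw [hC]; linarith [show 0 ≤ 16 * Cg * Lam ^ 2 + C₁ * (4 * Cg * Lam) * (2 * Lam) ^ 2 + c₄⁻¹
    + C₃ by positivity]
  clear_value C
  refine ⟨C, hC1, ?_⟩
  intro s hs B hB e he ρ hρ hρ8
  have hs0 := hs.1
  have hs1 := hs.2
  have hc0 := cns_nonneg hn hs
  obtain ⟨ε, hε, hερ, hlow⟩ := h₄ s hs B hB ρ hρ
  set δ := (lam / 8) ^ 2 with hδ'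
  have hδ : 0 < δ := by positivity
  have hρδ : ρ ^ 2 ≤ δ := pow_le_pow_left₀ hρ.le hρ8 2
  set a := ((n:ℝ) + 2 * s) / 2 with ha
  have ha0 : 0 ≤ a := by positivity
  have haa : a ≤ a₀ := by rw [ha, ha₀]; linarith [hs.2]
  set H := hker (cns n s) (n + 2 * s) B with hH
  have hH0 : ∀ z, 0 ≤ H z := fun z => hker_nonneg hc0 B z
  have hHm : Measurable H := hker_measurable B
  have hBm : Measurable fun z : En n => ‖B z‖ := B.continuous.norm.measurable
  have hIm : Measurable fun z : En n => (2 * inner ℝ (B z) (B e) : ℝ) :=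
    ((B.continuous.inner continuous_const).const_mul 2 |>.measurable)
  have hcm := cut_contDiff.continuous.measurable
  have hcm' := cut_deriv_continuous.measurable
  have hrm : Measurable ramp := by unfold ramp; fun_prop
  have hpm : Measurable (nearProfile δ ρ ε) := by unfold nearProfile; fun_prop
  have hpm' : Measurable (nearProfile' δ ρ ε) := by unfold nearProfile'; fun_prop
  set φ := truncK s ρ ε B with hφ
  have hφm : Measurable φ := truncK_measurable B
  have hφ0 : ∀ z, 0 ≤ φ z := truncK_nonneg hn hs B
  have hφle : ∀ z, φ z ≤ H z * min 1 (2 * (‖B z‖ ^ 2 / ρ ^ 2)) := truncK_le hn hs B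
  have hφH : ∀ z, φ z ≤ H z := fun z =>
    (hφle z).trans (mul_le_of_le_one_right (hH0 z) (min_le_left _ _))
  obtain ⟨iφ, vφ⟩ := h₃ s hs B hB ρ ε hρ
  set φ₁ : En n → ℝ := fun z => H z * nearProfile δ ρ ε (‖B z‖ ^ 2) with hφ₁
  set φ₁' : En n → ℝ := fun z => H z * (nearProfile' δ ρ ε (‖B z‖ ^ 2)
    - a * nearProfile δ ρ ε (‖B z‖ ^ 2) / ‖B z‖ ^ 2) * (2 * inner ℝ (B z) (B e)) with hφ₁'
  have hφ₁'m : Measurable φ₁' := by fun_prop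
  have hp0 : ∀ q ≤ ε ^ 2, nearProfile δ ρ ε q = 0 := fun q hq => by
    rw [nearProfile, cut_div_zero (by positivity) hq]; ring
  have hp0' : ∀ q ≤ ε ^ 2, nearProfile' δ ρ ε q = 0 := fun q hq => by
    rw [nearProfile', cut_div_zero (by positivity) hq,
      cut_deriv_left ((div_le_one (by positivity)).2 hq)]; ring
  have hbase : ∀ z, 0 < ‖B z‖ →
      |φ₁' z| ≤ H z * (Cg * min 1 (2 * (‖B z‖ ^ 2 / ρ ^ 2)) * (2 * Lam) / ‖B z‖) := by
    intro z hz
    have h1 := nearProfile_bound (fun t => (hCc t).1) hδ hρ hε ha0 haa (pow_pos hz 2)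
    have h2 := abs_two_inner_le hB he z
    rw [hφ₁']
    simp only
    rw [abs_mul, abs_mul, abs_of_nonneg (hH0 z), mul_assoc]
    refine mul_le_mul_of_nonneg_left ?_ (hH0 z)
    calc _ ≤ Cg * min 1 (2 * (‖B z‖ ^ 2 / ρ ^ 2)) / ‖B z‖ ^ 2 * (2 * Lam * ‖B z‖) :=
          mul_le_mul h1 h2 (abs_nonneg _) ((abs_nonneg _).trans h1)
      _ = _ := by field_simp
  have hbase' : ∀ z, ∀ b > 0, b ≤ ‖B z‖ → |φ₁' z| ≤ 2 * Cg * Lam / b * H z := by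
    intro z b hb hbz
    refine (hbase z (hb.trans_le hbz)).trans ?_
    rw [mul_comm]
    refine mul_le_mul_of_nonneg_right ?_ (hH0 z)
    calc _ ≤ Cg * 1 * (2 * Lam) / b := by gcongr; exact min_le_left _ _
      _ = _ := by ring
  have iφ₁' : Integrable φ₁' := by
    refine (h₁ s hs B hB (ε / Lam) (2 * Cg * Lam / ε) φ₁' (by positivity) (by positivity) hφ₁'m
      (fun z _ => ?_) (fun z hz => ?_)).1
    · by_cases h : ε ≤ ‖B z‖
      · exact hbase' z ε hε h
      · have hq : ‖B z‖ ^ 2 ≤ ε ^ 2 := pow_le_pow_left₀ (norm_nonneg _) (not_le.1 h).le 2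
        simp only [hφ₁', hp0 _ hq, hp0' _ hq, mul_zero, zero_div, sub_zero, zero_mul, abs_zero]
        have := hH0 z
        positivity
    · have hq : ‖B z‖ ^ 2 ≤ ε ^ 2 := by
        refine pow_le_pow_left₀ (norm_nonneg _) ((hB z).2.trans ?_) 2
        rw [lt_div_iff₀ hL0] at hz
        linarith
      simp only [hφ₁', hp0 _ hq, hp0' _ hq, mul_zero, zero_div, sub_zero, zero_mul]
  set S := {z : En n | ρ ^ 2 < 2 * ‖B z‖ ^ 2} with hS
  have hSm : MeasurableSet S :=
    measurableSet_lt measurable_const ((hBm.pow_const 2).const_mul 2)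
  set τ : En n → ℝ := S.indicator fun z => |φ₁' z| with hτ
  have hτm : Measurable τ := hφ₁'m.abs.indicator hSm
  have hτ0 : ∀ z, 0 ≤ τ z := fun z => indicator_nonneg (fun z _ => abs_nonneg _) z
  have hSz : ∀ z ∈ S, ρ / 2 ≤ ‖B z‖ := fun z hz => by
    by_contra h
    push Not at h
    have := pow_lt_pow_left₀ h (norm_nonneg _) two_ne_zero
    have h3 : ρ ^ 2 < 2 * ‖B z‖ ^ 2 := hz
    nlinarith [sq_nonneg ρ]
  obtain ⟨iτ, vτ⟩ := h₁ s hs B hB (ρ / (2 * Lam)) (4 * Cg * Lam / ρ) τ (by positivity)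
    (by positivity) hτm (fun z _ => by
      rw [abs_of_nonneg (hτ0 z)]
      by_cases h : z ∈ S
      · rw [hτ, indicator_of_mem h]
        refine (hbase' z (ρ / 2) (by positivity) (hSz z h)).trans (le_of_eq ?_)
        field_simp; ring
      · rw [hτ, indicator_of_notMem h]
        have := hH0 z
        positivity)
    (fun z hz => by
      refine indicator_of_notMem (fun h => ?_) _
      have h1 := (hSz z h).trans (hB z).2
      rw [lt_div_iff₀ (by positivity)] at hz
      nlinarith)
  have hP0 : ∀ z, 0 ≤ H z - φ z := fun z => sub_nonneg.2 (hφH z)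
  have hφeq : ∀ z, ρ ≤ ‖B z‖ → φ z = H z := fun z hz => by
    have hq : ρ ^ 2 ≤ ‖B z‖ ^ 2 := pow_le_pow_left₀ hρ.le hz 2
    rw [hφ, truncK, ramp_one ((one_le_div (by positivity)).2 hq), cut_one, mul_one, mul_one]
    rw [le_div_iff₀ (by positivity)]
    exact hερ.trans hq
  have hφeq' : ∀ z, ρ / lam ≤ ‖z‖ → φ z = H z := fun z hz => hφeq z (by
    rw [div_le_iff₀' hl] at hz
    exact hz.trans (hB z).1)
  obtain ⟨iQ, vQ⟩ := h₂ s hs B hB (ρ / lam) 1 (fun z => (H z - φ z) * ‖z‖ ^ 2) (by positivity)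
    zero_le_one ((hHm.sub hφm).mul (measurable_norm.pow_const 2))
    (fun z _ => by
      rw [one_mul, abs_of_nonneg (mul_nonneg (hP0 z) (by positivity))]
      exact mul_le_mul_of_nonneg_right (by linarith [hφ0 z]) (by positivity))
    (fun z hz => by rw [hφeq' z hz.le, sub_self, zero_mul])
  have hρs : 0 < ρ ^ (-(2 * s)) := by positivity
  have hφ₁le : ∀ z, |φ₁ z| ≤ φ z := fun z => by
    have c3 := cut_nonneg (‖B z‖ ^ 2 / δ)
    have c4 := cut_le_one (‖B z‖ ^ 2 / δ)
    have : φ₁ z = φ z * (1 - cut (‖B z‖ ^ 2 / δ)) := by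
      simp only [hφ₁, hφ, truncK, nearProfile]; ring
    rw [this, abs_mul, abs_of_nonneg (hφ0 z),
      abs_of_nonneg (by linarith : 0 ≤ 1 - cut (‖B z‖ ^ 2 / δ))]
    exact mul_le_of_le_one_right (hφ0 z) (by linarith)
  refine ⟨φ, φ₁, φ₁', τ, hφm, iφ, ?_, iφ₁', iτ, ?_, hφ0, hφH, ?_, ?_, hφ₁le, ?_, hφeq', ?_, hτ0,
    ?_, ?_, ?_, iQ, ?_⟩
  · exact iφ.mono' (by fun_prop : Measurable φ₁).aestronglyMeasurable (ae_of_all _ hφ₁le)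
  · intro z; simp [hφ, truncK, hker_neg]
  · intro z
    by_cases h : ‖B z‖ ^ 2 ≤ δ
    · have hf : farK s lam B z = H z * cut (‖B z‖ ^ 2 / δ) := rfl
      have ht : φ z = H z * (ramp (‖B z‖ ^ 2 / ρ ^ 2) * cut (‖B z‖ ^ 2 / ε ^ 2)) := rfl
      simp only [hφ₁, ht, nearProfile, hf, cut_div_zero hδ h]; ring
    · have h1 : ρ ≤ ‖B z‖ := by
        by_contra h2
        exact h ((pow_le_pow_left₀ (norm_nonneg _) (not_le.1 h2).le 2).trans hρδ)
      have hq : ρ ^ 2 ≤ ‖B z‖ ^ 2 := pow_le_pow_left₀ hρ.le h1 2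
      rw [hφeq z h1]
      simp only [hφ₁, nearProfile, farK]
      rw [ramp_one ((one_le_div (by positivity)).2 hq), cut_one (t := ‖B z‖ ^ 2 / ε ^ 2)]
      · ring
      · rw [le_div_iff₀ (by positivity)]
        exact hερ.trans hq
  · intro z
    exact hker_mul_hasLineDerivAt (by positivity : 0 < ε ^ 2) hp0
      (fun q => nearProfile_hasDerivAt δ ρ ε q) B e z
  · intro z hz
    have hq : 2 ≤ ‖B z‖ ^ 2 / δ := by
      rw [le_div_iff₀ hδ, hδ']
      have : lam / 4 ≤ ‖B z‖ := by nlinarith [(hB z).1]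
      have := pow_le_pow_left₀ (by positivity) this 2
      nlinarith [sq_nonneg lam]
    simp only [hφ₁, hφ₁', nearProfile, nearProfile', cut_one hq, cut_deriv_right hq]
    constructor <;> ring
  · intro z
    by_cases h : z ∈ S
    · rw [hτ, indicator_of_mem h]
      have := hP0 z
      have : 0 ≤ C / ρ ^ 2 * ((H z - φ z) * ‖z‖) := by positivity
      linarith
    · rw [hτ, indicator_of_notMem h, add_zero]
      by_cases hz : ‖B z‖ = 0
      · have : |φ₁' z| = 0 := by
          have hq : ‖B z‖ ^ 2 ≤ ε ^ 2 := by rw [hz, zero_pow two_ne_zero]; positivity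
          simp only [hφ₁', hp0 _ hq, hp0' _ hq, mul_zero, zero_div, sub_zero, zero_mul, abs_zero]
        rw [this]
        have := hP0 z
        positivity
      have hz' : 0 < ‖B z‖ := lt_of_le_of_ne (norm_nonneg _) (Ne.symm hz)
      have hq : ‖B z‖ ^ 2 / ρ ^ 2 ≤ 1 / 2 := by
        rw [div_le_iff₀ (by positivity)]
        have : ¬ ρ ^ 2 < 2 * ‖B z‖ ^ 2 := h
        linarith
      have h4 : H z ≤ 4 * (H z - φ z) := by
        have : φ z ≤ H z * (3 / 4) := by
          rw [hφ, truncK]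
          refine mul_le_mul_of_nonneg_left ?_ (hH0 z)
          exact (mul_le_of_le_one_right (ramp_nonneg (by positivity)) (cut_le_one _)).trans
            (ramp_le_half hq)
        linarith
      calc |φ₁' z| ≤ H z * (Cg * min 1 (2 * (‖B z‖ ^ 2 / ρ ^ 2)) * (2 * Lam) / ‖B z‖) := hbase z hz'
        _ ≤ 4 * (H z - φ z) * (Cg * (2 * (‖B z‖ ^ 2 / ρ ^ 2)) * (2 * Lam) / ‖B z‖) := by
            have := hP0 z
            gcongr
            exact min_le_right _ _
        _ = 16 * Cg * Lam / ρ ^ 2 * ((H z - φ z) * ‖B z‖) := by field_simp; ring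
        _ ≤ 16 * Cg * Lam / ρ ^ 2 * ((H z - φ z) * (Lam * ‖z‖)) := by
            have := hP0 z
            have := (hB z).2
            gcongr
        _ = 16 * Cg * Lam ^ 2 / ρ ^ 2 * ((H z - φ z) * ‖z‖) := by ring
        _ ≤ _ := by
            have := hP0 z
            gcongr
  · refine ((le_abs_self (∫ z, τ z)).trans abs_integral_le_integral_abs).trans (vτ.trans ?_)
    rw [Real.div_rpow hρ.le (by positivity), Real.rpow_neg (by positivity : 0 ≤ 2 * Lam), div_inv_eq_mul]
    have : (2 * Lam) ^ (2 * s) ≤ (2 * Lam) ^ 2 := by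
      rw [← Real.rpow_natCast]
      exact Real.rpow_le_rpow_of_exponent_le (by linarith) (by push_cast; linarith)
    calc _ ≤ C₁ * (4 * Cg * Lam / ρ) * (ρ ^ (-(2 * s)) * (2 * Lam) ^ 2) := by gcongr
      _ = C₁ * (4 * Cg * Lam) * (2 * Lam) ^ 2 / ρ * ρ ^ (-(2 * s)) := by ring
      _ ≤ _ := by gcongr
  · refine le_trans ?_ hlow
    gcongr
    exact inv_le_of_inv_le₀ hc₄ k3
  · exact vφ.trans (by gcongr)
  · refine ((le_abs_self (∫ z, (H z - φ z) * ‖z‖ ^ 2)).trans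
      abs_integral_le_integral_abs).trans (vQ.trans ?_)
    have eρ : ρ ^ (2 - 2 * s) = ρ ^ 2 * ρ ^ (-(2 * s)) := by
      rw [← Real.rpow_natCast, ← Real.rpow_add hρ]; congr 1
    rw [Real.div_rpow hρ.le hl.le, eρ, div_eq_mul_inv, ← Real.inv_rpow hl.le]
    have : (lam⁻¹) ^ (2 - 2 * s) ≤ (lam⁻¹) ^ 2 := by
      rw [← Real.rpow_natCast]
      exact Real.rpow_le_rpow_of_exponent_le ((one_le_inv₀ hl).2 hl1) (by push_cast; linarith)
    calc _ ≤ C₂ * 1 * (ρ ^ 2 * ρ ^ (-(2 * s)) * (lam⁻¹) ^ 2) := by gcongr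
      _ = C₂ * (lam⁻¹) ^ 2 * (ρ ^ 2 * ρ ^ (-(2 * s))) := by ring
      _ ≤ _ := by gcongr

lemma integrable_mul_hker {n : ℕ} (hn : 0 < n) {s lam Lam : ℝ} (hs : s ∈ Ioo (0:ℝ) 1)
    (hl : 0 < lam) (hl1 : lam ≤ 1) {B : En n →L[ℝ] En n} (hB : Elliptic lam Lam B) {g : En n → ℝ}
    (hg : Measurable g) {D : ℝ} (h : ∀ z, |g z| ≤ D * min (‖z‖ ^ 2) 1) :
    Integrable fun z => g z * hker (cns n s) (n + 2 * s) B z := by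
  obtain ⟨C₁, hC₁, h₁⟩ := hker_integral_compl hn (Lam := Lam) hl hl1
  obtain ⟨C₂, hC₂, h₂⟩ := hker_integral_ball hn (Lam := Lam) hl hl1
  set H := hker (cns n s) (n + 2 * s) B with hH
  have hH0 : ∀ z, 0 ≤ H z := fun z => hker_nonneg (cns_nonneg hn hs) B z
  set F := fun z => g z * H z with hF
  have hFm : Measurable F := hg.mul (hker_measurable B)
  have hD : 0 ≤ D := by
    obtain ⟨z, hz⟩ := (@exists_ne _ (nontrivial_En hn) (0 : En n))
    have h1 := (abs_nonneg _).trans (h z)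
    have : 0 < min (‖z‖ ^ 2) 1 := lt_min (pow_pos (norm_pos_iff.2 hz) 2) one_pos
    exact nonneg_of_mul_nonneg_left h1 this
  set S := {z : En n | 1 ≤ ‖z‖} with hS
  have hSm : MeasurableSet S := measurableSet_norm_ge 1
  have i1 := (h₁ s hs B hB 1 D (S.indicator F) one_pos hD (hFm.indicator hSm)
    (fun z hz => by
      rw [indicator_of_mem (show z ∈ S from hz), hF, abs_mul, abs_of_nonneg (hH0 z)]
      exact mul_le_mul_of_nonneg_right ((h z).trans
        (mul_le_of_le_one_right hD (min_le_right _ _))) (hH0 z))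
    (fun z hz => indicator_of_notMem (show z ∉ S from not_le.2 hz) _)).1
  have i2 := (h₂ s hs B hB 1 D (Sᶜ.indicator F) one_pos hD (hFm.indicator hSm.compl)
    (fun z hz => by
      have : |Sᶜ.indicator F z| ≤ |F z| := by
        by_cases h : z ∈ Sᶜ
        · rw [indicator_of_mem h]
        · rw [indicator_of_notMem h, abs_zero]; exact abs_nonneg _
      refine this.trans ?_
      rw [hF, abs_mul, abs_of_nonneg (hH0 z), mul_comm (hker _ _ _ _), ← mul_assoc]
      exact mul_le_mul_of_nonneg_right ((h z).trans
        (mul_le_mul_of_nonneg_left (min_le_left _ _) hD)) (hH0 z))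
    (fun z hz => indicator_of_notMem (fun h => (show z ∉ S from h) hz.le) _)).1
  exact (indicator_self_add_compl S F) ▸ i1.add i2

/-- The operator with kernel `hker`, in symmetrized form. -/
def symOp {n : ℕ} (s : ℝ) (B : En n →L[ℝ] En n) (v : En n → ℝ) (x : En n) : ℝ :=
  1 / 2 * ∫ z, (2 * v x - v (x + z) - v (x - z)) * hker (cns n s) (n + 2 * s) B z

lemma symOp_split {n : ℕ} (hn : 0 < n) {s lam Lam : ℝ} (hs : s ∈ Ioo (0:ℝ) 1)
    (hl : 0 < lam) (hl1 : lam ≤ 1) {B : En n →L[ℝ] En n} (hB : Elliptic lam Lam B)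
    {v : En n → ℝ} (hv : Continuous v) {M : ℝ} (hM : ∀ x, |v x| ≤ M) {x : En n} {D : ℝ}
    (hD : ∀ z, |2 * v x - v (x + z) - v (x - z)| ≤ D * min (‖z‖ ^ 2) 1) {φ : En n → ℝ}
    (hφ : Integrable φ) (hφe : ∀ z, φ (-z) = φ z) :
    Integrable (fun z => (2 * v x - v (x + z) - v (x - z)) *
      (hker (cns n s) (n + 2 * s) B z - φ z)) ∧
    symOp s B v x = 1 / 2 * (∫ z, (2 * v x - v (x + z) - v (x - z)) *
      (hker (cns n s) (n + 2 * s) B z - φ z)) + v x * (∫ z, φ z) - ∫ z, φ z * v (x + z) := by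
  have cp : Continuous fun z => v (x + z) := hv.comp (continuous_const.add continuous_id)
  have cm : Continuous fun z => v (x - z) := hv.comp (continuous_const.sub continuous_id)
  have cd : Continuous fun z => 2 * v x - v (x + z) - v (x - z) := (continuous_const.sub cp).sub cm
  have iH := integrable_mul_hker hn hs hl hl1 hB cd.measurable hD
  have ip := integrable_mul_bdd hφ cp (fun z => hM _)
  have im := integrable_mul_bdd hφ cm (fun z => hM _)
  have e : (∫ z, φ z * v (x - z)) = ∫ z, φ z * v (x + z) := by
    rw [← integral_neg_eq_self]
    congr 1; ext z; rw [hφe, sub_neg_eq_add]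
  have i1 : Integrable fun z => 2 * v x * φ z - φ z * v (x + z) := (hφ.const_mul _).sub ip
  have iφ : Integrable fun z => 2 * v x * φ z - φ z * v (x + z) - φ z * v (x - z) :=
    i1.sub im
  have eφ : ∫ z, (2 * v x * φ z - φ z * v (x + z) - φ z * v (x - z))
      = 2 * v x * (∫ z, φ z) - 2 * ∫ z, φ z * v (x + z) := by
    rw [integral_sub i1 im, integral_sub (hφ.const_mul _) ip,
      integral_const_mul, e]
    ring
  have hfun : (fun z => (2 * v x - v (x + z) - v (x - z)) *
      (hker (cns n s) (n + 2 * s) B z - φ z)) = fun z =>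
      (2 * v x - v (x + z) - v (x - z)) * hker (cns n s) (n + 2 * s) B z -
        (2 * v x * φ z - φ z * v (x + z) - φ z * v (x - z)) := by
    ext z; ring
  rw [hfun]
  refine ⟨iH.sub iφ, ?_⟩
  rw [integral_sub iH iφ, eφ, symOp]
  ring

lemma quot_expand_lower {η η₀ r a d : ℝ} (h0 : 0 < η₀) (h1 : η₀ / 2 ≤ η) (h2 : η ≤ 2 * η₀)
    (h3 : |η₀ - η| ≤ 2 * r) :
    2 * a * d / η₀ + d ^ 2 / (4 * η₀) - 64 * a ^ 2 / η₀ ^ 3 * r ^ 2 ≤ (2 * a * d + d ^ 2) / η := by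
  have hη : 0 < η := by linarith
  have hr : 0 ≤ r := by linarith [abs_nonneg (η₀ - η)]
  have i1 : 1 / (2 * η₀) ≤ 1 / η := one_div_le_one_div_of_le hη h2
  have i2 : |1 / η - 1 / η₀| ≤ 4 * r / η₀ ^ 2 := by
    rw [div_sub_div _ _ hη.ne' h0.ne', one_mul, mul_one, abs_div,
      abs_of_pos (by positivity : 0 < η * η₀), div_le_div_iff₀ (by positivity) (by positivity)]
    calc |η₀ - η| * η₀ ^ 2 ≤ 2 * r * η₀ ^ 2 := by gcongr
      _ = 4 * r * (η₀ / 2 * η₀) := by ring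
      _ ≤ 4 * r * (η * η₀) := by gcongr
  obtain ⟨t, ht⟩ : ∃ t, t = 1 / η - 1 / η₀ := ⟨_, rfl⟩
  rw [← ht] at i2
  have e1 : (2 * a * d + d ^ 2) / η = 2 * a * d / η₀ + 2 * a * t * d + d ^ 2 * (1 / η) := by
    rw [ht]; field_simp; ring
  have i3 : t ^ 2 ≤ 16 * r ^ 2 / η₀ ^ 4 := by
    have := sq_le_sq' (by linarith [(abs_le.1 i2).1]) (abs_le.1 i2).2
    calc t ^ 2 ≤ (4 * r / η₀ ^ 2) ^ 2 := this
      _ = _ := by field_simp; ring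
  have i4 : d ^ 2 * (1 / (2 * η₀)) ≤ d ^ 2 * (1 / η) :=
    mul_le_mul_of_nonneg_left i1 (sq_nonneg d)
  have i5 : -(d ^ 2 / (4 * η₀) + 4 * η₀ * a ^ 2 * t ^ 2) ≤ 2 * a * t * d := by
    have : 0 ≤ (d + 4 * η₀ * a * t) ^ 2 / (4 * η₀) := by positivity
    have e : (d + 4 * η₀ * a * t) ^ 2 / (4 * η₀)
        = d ^ 2 / (4 * η₀) + 2 * a * t * d + 4 * η₀ * a ^ 2 * t ^ 2 := by
      field_simp; ring
    linarith
  have i6 : 4 * η₀ * a ^ 2 * t ^ 2 ≤ 64 * a ^ 2 / η₀ ^ 3 * r ^ 2 := by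
    calc 4 * η₀ * a ^ 2 * t ^ 2 ≤ 4 * η₀ * a ^ 2 * (16 * r ^ 2 / η₀ ^ 4) := by gcongr
      _ = _ := by field_simp; ring
  have e2 : d ^ 2 * (1 / (2 * η₀)) = d ^ 2 / (4 * η₀) + d ^ 2 / (4 * η₀) := by
    field_simp; ring
  linarith

lemma max_point_upper {η η₀ r a d w M σ : ℝ} (h0 : 0 < η₀) (h1 : η₀ / 2 ≤ η) (h2 : η ≤ 2 * η₀)
    (h3 : |η₀ - η| ≤ 2 * r) (hσ : 0 ≤ σ) (hM : 0 < M)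
    (h4 : η ^ 2 * (max w 0) ^ 2 ≤ M ^ 2 - σ * (2 * a * d + d ^ 2)) :
    w ≤ M / η - σ / M * a / η₀ * d - σ / (8 * M) / η₀ * d ^ 2
      + 32 * (σ * a ^ 2 / M) / η₀ ^ 3 * r ^ 2 := by
  have hη : 0 < η := by linarith
  have hle : η * w ≤ M - σ / (2 * M) * (2 * a * d + d ^ 2) := by
    have e1 : η * w ≤ η * max w 0 := mul_le_mul_of_nonneg_left (le_max_left _ _) hη.le
    have e2 : 2 * M * (η * max w 0) ≤ 2 * M ^ 2 - σ * (2 * a * d + d ^ 2) := by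
      nlinarith [sq_nonneg (η * max w 0 - M)]
    have e3 : M - σ / (2 * M) * (2 * a * d + d ^ 2)
        = (2 * M ^ 2 - σ * (2 * a * d + d ^ 2)) / (2 * M) := by field_simp
    rw [e3, le_div_iff₀ (by positivity)]
    linarith [mul_le_mul_of_nonneg_left e1 (by positivity : 0 ≤ 2 * M)]
  have hw' : w ≤ M / η - σ / (2 * M) * ((2 * a * d + d ^ 2) / η) := by
    rw [← mul_div_assoc, ← sub_div, le_div_iff₀ hη]; linarith
  have hfin := mul_le_mul_of_nonneg_left (quot_expand_lower (a := a) (d := d) h0 h1 h2 h3)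
    (by positivity : 0 ≤ σ / (2 * M))
  have e4 : σ / (2 * M) * (2 * a * d / η₀ + d ^ 2 / (4 * η₀) - 64 * a ^ 2 / η₀ ^ 3 * r ^ 2)
      = σ / M * a / η₀ * d + σ / (8 * M) / η₀ * d ^ 2
        - 32 * (σ * a ^ 2 / M) / η₀ ^ 3 * r ^ 2 := by
    field_simp; ring
  linarith

lemma diff2_lower {n : ℕ} {x z : En n} {η₀ ηp ηm w₀ wp wm a dp dm M σ : ℝ} (hx : ‖x‖ ≤ 3 / 4)
    (hη₀ : η₀ = 9 / 16 - ‖x‖ ^ 2) (hηp : ηp = 9 / 16 - ‖x + z‖ ^ 2)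
    (hηm : ηm = 9 / 16 - ‖x - z‖ ^ 2) (h0 : 0 < η₀) (hz : ‖z‖ ≤ η₀ / 8) (hσ : 0 ≤ σ) (hM : 0 < M)
    (hw : η₀ * w₀ = M)
    (hp : ηp ^ 2 * (max wp 0) ^ 2 ≤ M ^ 2 - σ * (2 * a * dp + dp ^ 2))
    (hm : ηm ^ 2 * (max wm 0) ^ 2 ≤ M ^ 2 - σ * (2 * a * dm + dm ^ 2)) :
    -(64 * (M + σ * a ^ 2 / M) / η₀ ^ 3) * ‖z‖ ^ 2 + σ / M * a / η₀ * (dp + dm)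
      + σ / (8 * M) / η₀ * (dp ^ 2 + dm ^ 2) ≤ 2 * w₀ - wp - wm := by
  have hη1 : η₀ ≤ 9 / 16 := by rw [hη₀]; nlinarith [sq_nonneg ‖x‖]
  set k := ‖z‖ ^ 2 with hk
  set h := 2 * inner ℝ x z with hh
  have ep : ηp = η₀ - h - k := by rw [hηp, hη₀, norm_add_sq_real]; ring
  have em : ηm = η₀ + h - k := by rw [hηm, hη₀, norm_sub_sq_real]; ring
  have hz0 := norm_nonneg z
  have hhb : |h| ≤ 3 / 2 * ‖z‖ := by
    rw [hh, abs_mul, abs_two]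
    have := abs_real_inner_le_norm x z
    nlinarith
  have hkz : k ≤ ‖z‖ / 8 := by rw [hk]; nlinarith
  have hk0 : 0 ≤ k := by positivity
  have hh2 : h ^ 2 ≤ 9 / 4 * k := by
    have := sq_le_sq' (by linarith [(abs_le.1 hhb).1]) (abs_le.1 hhb).2
    rw [hk]; nlinarith
  obtain ⟨hb1, hb2⟩ := abs_le.1 hhb
  have p1 : η₀ / 2 ≤ ηp := by rw [ep]; linarith
  have p2 : ηp ≤ 2 * η₀ := by rw [ep]; linarith
  have m1 : η₀ / 2 ≤ ηm := by rw [em]; linarith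
  have m2 : ηm ≤ 2 * η₀ := by rw [em]; linarith
  have hp0 : 0 < ηp := by linarith
  have hm0 : 0 < ηm := by linarith
  have kp := max_point_upper h0 p1 p2 (r := ‖z‖) (by rw [ep, abs_le]; constructor <;> linarith) hσ hM hp
  have km := max_point_upper h0 m1 m2 (r := ‖z‖) (by rw [em, abs_le]; constructor <;> linarith) hσ hM hm
  rw [← hk] at kp km
  have hθ : M / ηp + M / ηm ≤ 2 * (M / η₀) + 64 * M / η₀ ^ 3 * k := by
    have e : M / ηp + M / ηm - 2 * (M / η₀)
        = M * (2 * h ^ 2 + k * (2 * η₀ - 2 * k)) / (η₀ * ηp * ηm) := by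
      field_simp
      rw [ep, em]; ring
    have i : M * (2 * h ^ 2 + k * (2 * η₀ - 2 * k)) / (η₀ * ηp * ηm) ≤ 64 * M / η₀ ^ 3 * k := by
      rw [div_le_iff₀ (by positivity)]
      have j1 : η₀ / 2 * (η₀ / 2) ≤ ηp * ηm := mul_le_mul p1 m1 (by linarith) hp0.le
      have j2 : 2 * h ^ 2 + k * (2 * η₀ - 2 * k) ≤ 16 * k := by
        linarith [mul_le_mul_of_nonneg_left hη1 hk0, mul_nonneg hk0 hk0]
      calc M * (2 * h ^ 2 + k * (2 * η₀ - 2 * k)) ≤ M * (16 * k) := by gcongr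
        _ = 64 * M / η₀ ^ 3 * k * (η₀ * (η₀ / 2 * (η₀ / 2))) := by field_simp; ring
        _ ≤ 64 * M / η₀ ^ 3 * k * (η₀ * (ηp * ηm)) := by gcongr
        _ = _ := by ring
    linarith
  have hw₀ : w₀ = M / η₀ := by rw [← hw]; field_simp
  have e5 : -(64 * (M + σ * a ^ 2 / M) / η₀ ^ 3) * k
      = -(64 * M / η₀ ^ 3 * k) - 2 * (32 * (σ * a ^ 2 / M) / η₀ ^ 3 * k) := by ring
  rw [e5, hw₀]
  linarith

lemma le_of_sq_le_affine {A S M : ℝ} (hA : 1 ≤ A) (hS : 0 ≤ S)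
    (h : M ^ 2 ≤ A * S * M + A * S ^ 2) : M ≤ 2 * A * S := by
  by_contra! hc
  have hAS : 0 ≤ A * S := by positivity
  have hM : 0 < M := by linarith
  have h1 : A * S * M ≥ A * S * (2 * A * S) := mul_le_mul_of_nonneg_left hc.le hAS
  have h2 : A * S ^ 2 ≤ A * S * (2 * A * S) := by
    have : A * S ^ 2 * 1 ≤ A * S ^ 2 * (2 * A) := by
      apply mul_le_mul_of_nonneg_left (by linarith) (by positivity)
    linarith
  nlinarith [mul_lt_mul_of_pos_right hc hM]

set_option maxHeartbeats 1000000 in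
lemma max_value_le {C κ σ G T N G₀ M w₀ η₀ R : ℝ} (hC : 1 ≤ C) (hκ : 0 < κ)
    (hκC : κ ≤ 1 / (16 * C)) (hσ : σ = 8 * C ^ 4 / κ ^ 2) (hG : 0 ≤ G) (hT : 0 ≤ T) (hN : 0 ≤ N)
    (hG₀ : 0 ≤ G₀) (hw₀ : 0 < w₀) (hη₀ : 0 < η₀) (hη1 : η₀ ≤ 1) (hM : η₀ * w₀ = M) (hR : 1 ≤ R)
    (h : C⁻¹ * R * w₀ ≤ G + T + 32 * C * κ ^ 2 * R * w₀ + 128 * C * κ ^ 2 * R * σ * N ^ 2 / (M * η₀)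
      + 2 * N * σ / (M * η₀) * (G₀ + 2 * N * C * R + T) + 2 * C ^ 3 * w₀ * R / (σ * κ ^ 2)
      + 2 * N * C * R / (κ * η₀)) :
    M ≤ 2 * (2 * C + 4 * C ^ 2 / κ + 2 * C * (128 * C * κ ^ 2 * σ + 4 * σ * C + 2 * σ)) *
      (G + T + N + √(N * G₀)) := by
  have hC0 : 0 < C := by linarith
  have hM0 : 0 < M := by rw [← hM]; positivity
  have hσ0 : 0 < σ := by rw [hσ]; positivity
  have hR0 : 0 < R := by linarith
  have hS0 : 0 ≤ √(N * G₀) := Real.sqrt_nonneg _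
  have hSq : √(N * G₀) ^ 2 = N * G₀ := Real.sq_sqrt (by positivity)
  apply le_of_sq_le_affine
  · have : 0 ≤ 4 * C ^ 2 / κ := by positivity
    have : 0 ≤ 2 * C * (128 * C * κ ^ 2 * σ + 4 * σ * C + 2 * σ) := by positivity
    linarith
  · positivity
  have e1 : 2 * C ^ 3 * w₀ * R / (σ * κ ^ 2) = C⁻¹ * R * w₀ / 4 := by
    rw [hσ]; field_simp; ring
  have e2 : 32 * C * κ ^ 2 * R * w₀ ≤ C⁻¹ * R * w₀ / 8 := by
    have : 32 * C * κ ^ 2 ≤ 32 * C * (1 / (16 * C)) ^ 2 := by gcongr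
    have e : 32 * C * (1 / (16 * C)) ^ 2 = C⁻¹ / 8 := by field_simp; norm_num
    rw [e] at this
    calc _ = 32 * C * κ ^ 2 * (R * w₀) := by ring
      _ ≤ C⁻¹ / 8 * (R * w₀) := by gcongr
      _ = _ := by ring
  have hpos : 0 ≤ C⁻¹ * R * w₀ := by positivity
  have h2 : C⁻¹ * R * w₀ / 2 ≤ G + T + 128 * C * κ ^ 2 * R * σ * N ^ 2 / (M * η₀)
      + 2 * N * σ / (M * η₀) * (G₀ + 2 * N * C * R + T) + 2 * N * C * R / (κ * η₀) := by
    linarith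
  have h3 := mul_le_mul_of_nonneg_left h2 (by positivity : 0 ≤ 2 * C * η₀ * M / R)
  have e3 : 2 * C * η₀ * M / R * (C⁻¹ * R * w₀ / 2) = M ^ 2 := by
    have : 2 * C * η₀ * M / R * (C⁻¹ * R * w₀ / 2) = M * (η₀ * w₀) := by field_simp
    rw [this, hM]; ring
  have e4 : 2 * C * η₀ * M / R * (G + T + 128 * C * κ ^ 2 * R * σ * N ^ 2 / (M * η₀)
      + 2 * N * σ / (M * η₀) * (G₀ + 2 * N * C * R + T) + 2 * N * C * R / (κ * η₀))
      = 2 * C * M * (G + T) * (η₀ / R) + 2 * C * (128 * C * κ ^ 2 * σ * N ^ 2)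
        + 4 * C * N * σ * (G₀ + T) * (1 / R) + 4 * C * N * σ * (2 * N * C) + 4 * C ^ 2 * N / κ * M := by
    field_simp; ring
  rw [e3, e4] at h3
  have r1 : η₀ / R ≤ 1 := by rw [div_le_one hR0]; linarith
  have r2 : 1 / R ≤ 1 := by rw [div_le_one hR0]; linarith
  have k1 : 2 * C * M * (G + T) * (η₀ / R) ≤ 2 * C * M * (G + T) :=
    mul_le_of_le_one_right (by positivity) r1
  have k2 : 4 * C * N * σ * (G₀ + T) * (1 / R) ≤ 4 * C * N * σ * (G₀ + T) :=
    mul_le_of_le_one_right (by positivity) r2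
  obtain ⟨S, hS⟩ : ∃ S, S = G + T + N + √(N * G₀) := ⟨_, rfl⟩
  obtain ⟨q, hq⟩ : ∃ q, q = √(N * G₀) := ⟨_, rfl⟩
  rw [← hq] at hS hSq hS0
  have s1 : N ^ 2 + N * G₀ + 2 * (N * T) ≤ S ^ 2 := by
    rw [← hSq, hS]
    have := mul_nonneg hN hG
    have := mul_nonneg hN hS0
    have := mul_nonneg hT hS0
    have := mul_nonneg hG hS0
    have := mul_nonneg hT hG
    nlinarith [sq_nonneg G, sq_nonneg T]
  have nn1 := mul_nonneg hN hG₀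
  have nn2 := mul_nonneg hN hT
  have nn3 := sq_nonneg N
  have s2 : G + T ≤ S := by rw [hS]; linarith
  have s3 : N ≤ S := by rw [hS]; linarith
  have t1 : 2 * C * M * (G + T) ≤ 2 * C * M * S := by gcongr
  have t2 : 4 * C ^ 2 * N / κ * M ≤ 4 * C ^ 2 * S / κ * M := by gcongr
  have t3 : 2 * C * (128 * C * κ ^ 2 * σ * N ^ 2) ≤ 2 * C * (128 * C * κ ^ 2 * σ * S ^ 2) := by
    gcongr
  have t4 : 4 * C * N * σ * (2 * N * C) ≤ 2 * C * (4 * σ * C) * S ^ 2 := by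
    calc _ = 2 * C * (4 * σ * C) * N ^ 2 := by ring
      _ ≤ _ := by gcongr
  have t5 : 4 * C * N * σ * (G₀ + T) ≤ 2 * C * (2 * σ) * S ^ 2 := by
    calc _ = 2 * C * (2 * σ) * (N * G₀ + N * T) := by ring
      _ ≤ _ := by gcongr; linarith
  have hx : 0 ≤ 2 * C * (128 * C * κ ^ 2 * σ + 4 * σ * C + 2 * σ) * S * M := by
    have : 0 ≤ S := hN.trans s3
    positivity
  have hy : 0 ≤ (2 * C + 4 * C ^ 2 / κ) * S ^ 2 := by positivity
  rw [← hq, ← hS]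
  have ee : (2 * C + 4 * C ^ 2 / κ + 2 * C * (128 * C * κ ^ 2 * σ + 4 * σ * C + 2 * σ)) * S * M
     + (2 * C + 4 * C ^ 2 / κ + 2 * C * (128 * C * κ ^ 2 * σ + 4 * σ * C + 2 * σ)) * S ^ 2
     = 2 * C * M * S + 4 * C ^ 2 * S / κ * M + 2 * C * (128 * C * κ ^ 2 * σ * S ^ 2)
      + 2 * C * (4 * σ * C) * S ^ 2 + 2 * C * (2 * σ) * S ^ 2
      + 2 * C * (128 * C * κ ^ 2 * σ + 4 * σ * C + 2 * σ) * S * M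
      + (2 * C + 4 * C ^ 2 / κ) * S ^ 2 := by ring
  rw [ee]
  linarith

lemma integrable_mul_sq {n : ℕ} {P d : En n → ℝ} (iP : Integrable fun z => P z * ‖z‖ ^ 2)
    (hP : Measurable P) (hP0 : ∀ z, 0 ≤ P z) (hd : Continuous d) {L : ℝ}
    (hL : ∀ z, |d z| ≤ L * ‖z‖) : Integrable fun z => P z * d z ^ 2 := by
  refine (iP.const_mul (L ^ 2)).mono' (hP.mul (hd.pow 2).measurable).aestronglyMeasurable
    (ae_of_all _ fun z => ?_)
  rw [Real.norm_eq_abs, abs_of_nonneg (mul_nonneg (hP0 z) (sq_nonneg _))]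
  have := pow_le_pow_left₀ (abs_nonneg _) (hL z) 2
  rw [sq_abs, mul_pow] at this
  calc P z * d z ^ 2 ≤ P z * (L ^ 2 * ‖z‖ ^ 2) := mul_le_mul_of_nonneg_left this (hP0 z)
    _ = _ := by ring

lemma half_integral_lower {n : ℕ} {P d V W : En n → ℝ} {K α β : ℝ}
    (iP : Integrable fun z => P z * ‖z‖ ^ 2) (hPe : ∀ z, P (-z) = P z)
    (iE : Integrable fun z => P z * d z ^ 2) (iV : Integrable fun z => V z * P z)
    (iW : Integrable fun z => W z * P z)
    (h : ∀ z, P z * (-K * ‖z‖ ^ 2 - α * V z + β * (d z ^ 2 + d (-z) ^ 2)) ≤ W z * P z) :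
    -(K / 2) * (∫ z, P z * ‖z‖ ^ 2) - α * (1 / 2 * ∫ z, V z * P z) + β * (∫ z, P z * d z ^ 2)
      ≤ 1 / 2 * ∫ z, W z * P z := by
  have iE' : Integrable fun z => P z * d (-z) ^ 2 := by
    have := iE.comp_neg
    simpa only [hPe] using this
  have eE : (∫ z, P z * d (-z) ^ 2) = ∫ z, P z * d z ^ 2 := by
    rw [← integral_neg_eq_self]
    simp only [hPe, neg_neg]
  have j1 : Integrable fun z => -K * (P z * ‖z‖ ^ 2) - α * (V z * P z) :=
    (iP.const_mul _).sub (iV.const_mul _)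
  have j2 : Integrable fun z => β * (P z * d z ^ 2) + β * (P z * d (-z) ^ 2) :=
    (iE.const_mul _).add (iE'.const_mul _)
  have e : ∫ z, (-K * (P z * ‖z‖ ^ 2) - α * (V z * P z)
      + (β * (P z * d z ^ 2) + β * (P z * d (-z) ^ 2))) ≤ ∫ z, W z * P z :=
    integral_mono (j1.add j2) iW fun z => le_trans (le_of_eq (by ring)) (h z)
  rw [integral_add j1 j2, integral_sub (iP.const_mul _) (iV.const_mul _),
    integral_add (iE.const_mul _) (iE'.const_mul _), integral_const_mul, integral_const_mul,
    integral_const_mul, integral_const_mul, eE] at e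
  linarith

lemma drift_bound {n : ℕ} {P d φ' τ : En n → ℝ} {c N μ : ℝ}
    (iP : Integrable fun z => P z * ‖z‖ ^ 2) (hP0 : ∀ z, 0 ≤ P z)
    (iE : Integrable fun z => P z * d z ^ 2) (iτ : Integrable τ) (hτ : ∀ z, 0 ≤ τ z) (hc : 0 ≤ c)
    (hN : 0 ≤ N) (hμ : 0 < μ) (hφ' : ∀ z, |φ' z| ≤ c * (P z * ‖z‖) + τ z)
    (hsupp : ∀ z, 1 / 4 ≤ ‖z‖ → φ' z = 0) (hd : ∀ z, ‖z‖ < 1 / 4 → |d z| ≤ 2 * N) :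
    |∫ z, φ' z * d z| ≤ c * (μ * (∫ z, P z * d z ^ 2) + (∫ z, P z * ‖z‖ ^ 2) / (4 * μ))
      + 2 * N * ∫ z, τ z := by
  have j1 : Integrable fun z => c * μ * (P z * d z ^ 2) + c / (4 * μ) * (P z * ‖z‖ ^ 2) :=
    (iE.const_mul _).add (iP.const_mul _)
  have hle : ‖∫ z, φ' z * d z‖ ≤ ∫ z, (c * μ * (P z * d z ^ 2) + c / (4 * μ) * (P z * ‖z‖ ^ 2)
      + 2 * N * τ z) := by
    refine norm_integral_le_of_norm_le (j1.add (iτ.const_mul _)) (ae_of_all _ fun z => ?_)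
    have n1 : 0 ≤ c * μ * (P z * d z ^ 2) := by have := hP0 z; positivity
    have n2 : 0 ≤ c / (4 * μ) * (P z * ‖z‖ ^ 2) := by have := hP0 z; positivity
    have n3 : 0 ≤ 2 * N * τ z := by have := hτ z; positivity
    rw [Real.norm_eq_abs, abs_mul]
    rcases le_or_gt (1 / 4) ‖z‖ with hz | hz
    · rw [hsupp z hz, abs_zero, zero_mul]; linarith
    · have y : ‖z‖ * |d z| ≤ μ * d z ^ 2 + 1 / (4 * μ) * ‖z‖ ^ 2 := by
        have h0 : 0 ≤ (2 * μ * |d z| - ‖z‖) ^ 2 / (4 * μ) := by positivity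
        have e : (2 * μ * |d z| - ‖z‖) ^ 2 / (4 * μ)
            = μ * |d z| ^ 2 + 1 / (4 * μ) * ‖z‖ ^ 2 - ‖z‖ * |d z| := by field_simp; ring
        rw [sq_abs] at e
        linarith
      calc |φ' z| * |d z| ≤ (c * (P z * ‖z‖) + τ z) * |d z| := by gcongr; exact hφ' z
        _ = c * P z * (‖z‖ * |d z|) + τ z * |d z| := by ring
        _ ≤ c * P z * (μ * d z ^ 2 + 1 / (4 * μ) * ‖z‖ ^ 2) + τ z * (2 * N) := by
            have := hP0 z; have := hτ z
            have := hd z hz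
            gcongr
        _ = _ := by ring
  rw [integral_add j1 (iτ.const_mul _), integral_add (iE.const_mul _) (iP.const_mul _),
    integral_const_mul, integral_const_mul, integral_const_mul, Real.norm_eq_abs] at hle
  refine hle.trans (le_of_eq ?_)
  ring

set_option maxHeartbeats 4000000 in
/-- The interior estimate: `w = ∂_e v` is bounded above at the centre of the unit ball when `v`
is a supersolution and `w` a subsolution, up to constants, of the same elliptic operator. -/
theorem lineDeriv_upper_bound {n : ℕ} (hn : 0 < n) {lam Lam : ℝ} (hl : 0 < lam) (hl1 : lam ≤ 1)
    (hL : 1 ≤ Lam) : ∃ C : ℝ, 0 < C ∧ ∀ s ∈ Ioo (0:ℝ) 1, ∀ e : En n, ‖e‖ = 1 →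
    ∀ v w : En n → ℝ, Continuous v → Continuous w → (∃ M, ∀ x, |v x| ≤ M) →
    (∃ M, ∀ x, |w x| ≤ M) → (∃ L, ∀ x z, |v (x + z) - v x| ≤ L * ‖z‖) →
    (∀ x, HasLineDerivAt ℝ v (w x) x e) →
    (∀ x, ∃ D, ∀ z, |2 * v x - v (x + z) - v (x - z)| ≤ D * min (‖z‖ ^ 2) 1) →
    (∀ x, ∃ D, ∀ z, |2 * w x - w (x + z) - w (x - z)| ≤ D * min (‖z‖ ^ 2) 1) →
    ∀ N T G G₀ : ℝ, 0 ≤ N → 0 ≤ T → 0 ≤ G → 0 ≤ G₀ → (∀ x, ‖x‖ < 1 → |v x| ≤ N) →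
    (∀ x, ‖x‖ < 3 / 4 → ∃ B, Elliptic lam Lam B ∧ |∫ z, farK s lam B z * v (x + z)| ≤ T ∧
      |∫ z, farK s lam B z * w (x + z)| ≤ T ∧ -G₀ ≤ symOp s B v x ∧ symOp s B w x ≤ G) →
    w 0 ≤ C * (G + T + N + √(N * G₀)) := by
  obtain ⟨C, hC, hnear⟩ := near_kernel hn hl hl1 hL
  have hC0 : 0 < C := by linarith
  obtain ⟨κ, hκdef⟩ : ∃ κ, κ = min (lam / 8) (1 / (16 * C)) := ⟨_, rfl⟩
  have hκ : 0 < κ := by rw [hκdef]; exact lt_min (by positivity) (by positivity)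
  have hκl : κ ≤ lam / 8 := by rw [hκdef]; exact min_le_left _ _
  have hκC : κ ≤ 1 / (16 * C) := by rw [hκdef]; exact min_le_right _ _
  obtain ⟨σ, hσ⟩ : ∃ σ, σ = 8 * C ^ 4 / κ ^ 2 := ⟨_, rfl⟩
  have hσ0 : 0 < σ := by rw [hσ]; positivity
  obtain ⟨A, hA⟩ : ∃ A, A = 2 * C + 4 * C ^ 2 / κ
    + 2 * C * (128 * C * κ ^ 2 * σ + 4 * σ * C + 2 * σ) := ⟨_, rfl⟩
  have hA0 : 0 < A := by rw [hA]; positivity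
  refine ⟨2 * (2 * A * 2 + 4 * (1 + σ)), by positivity, ?_⟩
  intro s hs e he v w hv hw hvb hwb hvL hvw hDv hDw N T G G₀ hN hT hG hG₀ hvN hB
  obtain ⟨Mv, hMv⟩ := hvb
  obtain ⟨Mw, hMw⟩ := hwb
  obtain ⟨Lv, hLv⟩ := hvL
  obtain ⟨S, hS⟩ : ∃ S, S = G + T + N + √(N * G₀) := ⟨_, rfl⟩
  have hS0 : 0 ≤ S := by rw [hS]; positivity
  have hNS : N ≤ S := by rw [hS]; linarith [Real.sqrt_nonneg (N * G₀)]
  obtain ⟨x, hx, hmax⟩ := (isCompact_closedBall (0 : En n) (3 / 4)).exists_isMaxOn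
    ⟨0, mem_closedBall_self (by norm_num)⟩
    (show ContinuousOn (fun x : En n => (9 / 16 - ‖x‖ ^ 2) ^ 2 * (max (w x) 0) ^ 2
      + σ * (v x - N) ^ 2) _ from by fun_prop)
  rw [mem_closedBall, dist_zero_right] at hx
  have hmax' : ∀ y : En n, ‖y‖ ≤ 3 / 4 → (9 / 16 - ‖y‖ ^ 2) ^ 2 * (max (w y) 0) ^ 2
      + σ * (v y - N) ^ 2 ≤ (9 / 16 - ‖x‖ ^ 2) ^ 2 * (max (w x) 0) ^ 2 + σ * (v x - N) ^ 2 :=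
    fun y hy => hmax (by rwa [mem_closedBall, dist_zero_right])
  obtain ⟨η₀, hη₀⟩ : ∃ η₀, η₀ = 9 / 16 - ‖x‖ ^ 2 := ⟨_, rfl⟩
  have hη₀0 : 0 ≤ η₀ := by rw [hη₀]; nlinarith [norm_nonneg x]
  have hη1 : η₀ ≤ 1 := by rw [hη₀]; nlinarith [norm_nonneg x]
  have hvx := hvN x (by linarith)
  have ha1 : v x - N ≤ 0 := by linarith [(abs_le.1 hvx).2]
  have ha2 : -(2 * N) ≤ v x - N := by linarith [(abs_le.1 hvx).1]
  have hasq : (v x - N) ^ 2 ≤ 4 * N ^ 2 := by nlinarith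
  have hmain : η₀ * max (w x) 0 ≤ 2 * A * S := by
    by_cases h0 : η₀ * max (w x) 0 ≤ 0
    · exact h0.trans (by positivity)
    push Not at h0
    have hη₀p : 0 < η₀ := lt_of_le_of_ne hη₀0 fun h => by rw [← h, zero_mul] at h0; exact lt_irrefl _ h0
    have hwp : 0 < w x := by
      by_contra! h
      rw [max_eq_right h, mul_zero] at h0
      exact lt_irrefl _ h0
    rw [max_eq_left hwp.le]
    rw [max_eq_left hwp.le, ← hη₀] at hmax'
    clear h0
    obtain ⟨M, hM⟩ : ∃ M, η₀ * w x = M := ⟨_, rfl⟩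
    have hM0 : 0 < M := by rw [← hM]; positivity
    have hx34 : ‖x‖ < 3 / 4 := by
      by_contra! h
      have : ‖x‖ = 3 / 4 := le_antisymm hx h
      rw [hη₀, this] at hη₀p
      norm_num at hη₀p
    obtain ⟨B, hBe, hTv, hTw, hSv, hSw⟩ := hB x hx34
    obtain ⟨ρ, hρ⟩ : ∃ ρ, ρ = κ * η₀ := ⟨_, rfl⟩
    have hρ0 : 0 < ρ := by rw [hρ]; positivity
    have hρl : ρ ≤ lam / 8 := by
      rw [hρ]; exact (mul_le_of_le_one_right hκ.le hη1).trans hκl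
    obtain ⟨φ, φ₁, φ₁', τ, hφm, iφ, iφ₁, iφ₁', iτ, hφe, hφ0, hφH, hφs, hφd, hφ₁, hφ₁s, hφeq, hφ₁', hτ0,
      hτ, hm1, hm2, iQ, hQ⟩   := hnear s hs B hBe e he ρ hρ0 hρl
    obtain ⟨P, hP⟩ : ∃ P : En n → ℝ, P = fun z => hker (cns n s) (n + 2 * s) B z - φ z :=
      ⟨_, rfl⟩
    have hPz : ∀ z, hker (cns n s) (n + 2 * s) B z - φ z = P z := fun z => by rw [hP]
    have hP0 : ∀ z, 0 ≤ P z := fun z => by rw [← hPz]; linarith [hφH z]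
    have hPm : Measurable P := by rw [hP]; exact (hker_measurable B).sub hφm
    have hPe : ∀ z, P (-z) = P z := fun z => by rw [← hPz, ← hPz, hφe, hker_neg]
    obtain ⟨R, hR⟩ : ∃ R, R = ρ ^ (-(2 * s)) := ⟨_, rfl⟩
    have hR1 : 1 ≤ R := by
      rw [hR]
      exact Real.one_le_rpow_of_pos_of_le_one_of_nonpos hρ0 (by linarith) (by linarith [hs.1])
    rw [← hR] at hτ hm1 hm2 hQ
    simp only [hPz] at hφ₁' iQ hQ
    obtain ⟨Dv, hDv⟩ := hDv x
    obtain ⟨Dw, hDw⟩ := hDw x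
    obtain ⟨iv, ev⟩ := symOp_split hn hs hl hl1 hBe hv hMv hDv iφ hφe
    obtain ⟨iw, ew⟩ := symOp_split hn hs hl hl1 hBe hw hMw hDw iφ hφe
    simp only [hPz] at iv ev iw ew
    have cv : Continuous fun z => v (x + z) := hv.comp (continuous_const.add continuous_id)
    have cw : Continuous fun z => w (x + z) := hw.comp (continuous_const.add continuous_id)
    have cd : Continuous fun z => v (x + z) - v x := cv.sub continuous_const
    have iE := integrable_mul_sq iQ hPm hP0 cd (hLv x)
    have ifar : Integrable (farK s lam B) := by
      have : farK s lam B = fun z => φ z - φ₁ z := by ext z; rw [hφs]; ring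
      rw [this]; exact iφ.sub iφ₁
    have hsplit : ∀ q : En n → ℝ, Continuous q → ∀ Mq, (∀ z, |q z| ≤ Mq) →
        ∫ z, φ z * q z = (∫ z, φ₁ z * q z) + ∫ z, farK s lam B z * q z := by
      intro q hq Mq hMq
      rw [← integral_add (integrable_mul_bdd iφ₁ hq hMq) (integrable_mul_bdd ifar hq hMq)]
      congr 1; ext z; rw [hφs]; ring
    rw [hsplit _ cv Mv fun z => hMv _] at ev
    rw [hsplit _ cw Mw fun z => hMw _] at ew
    have hvin : ∀ z, ‖z‖ < 1 / 4 → |v (x + z)| ≤ N := fun z hz =>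
      hvN _ ((norm_add_le _ _).trans_lt (by linarith))
    -- bound for the tail of `v`
    have hv1 : |∫ z, φ₁ z * v (x + z)| ≤ N * ∫ z, φ z := by
      rw [← integral_const_mul, ← Real.norm_eq_abs]
      refine norm_integral_le_of_norm_le (iφ.const_mul _) (ae_of_all _ fun z => ?_)
      rw [Real.norm_eq_abs, abs_mul]
      rcases le_or_gt (1 / 4) ‖z‖ with hz | hz
      · rw [(hφ₁s z hz).1, abs_zero, zero_mul]; exact mul_nonneg hN (hφ0 z)
      · rw [mul_comm]
        exact mul_le_mul (hvin z hz) (hφ₁ z) (abs_nonneg _) hN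
    -- the drift of `w`
    have hw1 : |∫ z, φ₁ z * w (x + z)| ≤ C / ρ ^ 2 * (σ * ρ ^ 2 / (8 * M * C * η₀) *
        (∫ z, P z * (v (x + z) - v x) ^ 2) + (∫ z, P z * ‖z‖ ^ 2) / (4 *
          (σ * ρ ^ 2 / (8 * M * C * η₀)))) + 2 * N * ∫ z, τ z := by
      have e1 : ∫ z, φ₁ z * w (x + z) = -∫ z, φ₁' z * (v (x + z) - v x) := by
        refine integral_mul_lineDeriv (M := Mv + |v x|) iφ₁ iφ₁' hφd (fun z => ?_) cd cw
          (fun z => ?_) fun z => hMw _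
        · have := (hvw (x + z)).comp_const_add'
          simpa [HasLineDerivAt] using HasDerivAt.sub_const (v x) this
        · exact (abs_sub _ _).trans (add_le_add_left (hMv _) _)
      rw [e1, abs_neg]
      refine drift_bound iQ hP0 iE iτ hτ0 (by positivity) hN (by positivity) hφ₁'
        (fun z hz => (hφ₁s z hz).2) fun z hz => ?_
      have := hvin z hz
      rw [abs_le] at this hvx ⊢
      constructor <;> linarith
    -- lower bound of the singular part
    obtain ⟨K, hK⟩ : ∃ K, K = 64 * (M + σ * (v x - N) ^ 2 / M) / η₀ ^ 3 := ⟨_, rfl⟩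
    have hw2 := half_integral_lower (K := K) (α := σ / M * (v x - N) / η₀)
      (β := σ / (8 * M) / η₀) iQ hPe iE iv iw (fun z => by
        rcases le_or_gt (ρ / lam) ‖z‖ with hz | hz
        · have : P z = 0 := by rw [← hPz, hφeq z hz, sub_self]
          rw [this]; simp
        · rw [mul_comm _ (P z)]
          refine mul_le_mul_of_nonneg_left ?_ (hP0 z)
          have hz8 : ‖z‖ ≤ η₀ / 8 := by
            refine hz.le.trans ?_
            rw [hρ, div_le_iff₀ hl]
            nlinarith
          have hin : ‖x‖ + ‖z‖ ≤ 3 / 4 := by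
            rw [hη₀] at hz8
            nlinarith [norm_nonneg x]
          have hMsq : η₀ ^ 2 * w x ^ 2 = M ^ 2 := by rw [← hM]; ring
          have q1 := hmax' (x + z) ((norm_add_le _ _).trans hin)
          have q2 := hmax' (x - z) ((norm_sub_le _ _).trans hin)
          rw [hMsq] at q1 q2
          have := diff2_lower (wp := w (x + z)) (wm := w (x - z)) (a := v x - N)
            (dp := v (x + z) - v x) (dm := v (x - z) - v x) hx hη₀ rfl rfl hη₀p hz8 hσ0.le hM0 hM
            (by linarith) (by linarith)
          rw [← hK] at this
          rw [← sub_eq_add_neg]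
          linarith)
    obtain ⟨Q, hQd⟩ : ∃ Q, Q = ∫ z, P z * ‖z‖ ^ 2 := ⟨_, rfl⟩
    obtain ⟨E, hEd⟩ : ∃ E, E = ∫ z, P z * (v (x + z) - v x) ^ 2 := ⟨_, rfl⟩
    obtain ⟨Iv, hIv⟩ : ∃ Iv, Iv = 1 / 2 * ∫ z, (2 * v x - v (x + z) - v (x - z)) * P z := ⟨_, rfl⟩
    obtain ⟨m, hmd⟩ : ∃ m, m = ∫ z, φ z := ⟨_, rfl⟩
    rw [← hQd] at hw2 hw1 hQ
    rw [← hEd] at hw2 hw1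
    rw [← hIv] at hw2 ev
    rw [← hmd] at ev ew hm1 hm2 hv1
    rw [ev] at hSv
    rw [ew] at hSw
    rw [abs_le] at hTv hTw hv1 hw1
    have hm0 : 0 ≤ m := le_trans (by positivity) hm1
    have hIvlow : -(G₀ + 2 * N * C * R + T) ≤ Iv := by
      have g1 : v x * m ≤ N * m := mul_le_mul_of_nonneg_right (abs_le.1 hvx).2 hm0
      have g2 : N * m ≤ N * (C * R) := mul_le_mul_of_nonneg_left hm2 hN
      linarith
    have hα : -(2 * N * σ / (M * η₀) * (G₀ + 2 * N * C * R + T))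
        ≤ -(σ / M * (v x - N) / η₀ * Iv) := by
      have g0 : 0 ≤ -(σ / M * (v x - N) / η₀) := by
        have : -(σ / M * (v x - N) / η₀) = σ / M * (N - v x) / η₀ := by ring
        rw [this]
        have : 0 ≤ N - v x := by linarith
        positivity
      have g1 : -(σ / M * (v x - N) / η₀) ≤ 2 * N * σ / (M * η₀) := by
        have : -(σ / M * (v x - N) / η₀) = (N - v x) * σ / (M * η₀) := by field_simp; ring
        rw [this]
        gcongr
        linarith
      have g2 : 0 ≤ G₀ + 2 * N * C * R + T := by positivity
      calc -(2 * N * σ / (M * η₀) * (G₀ + 2 * N * C * R + T))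
          ≤ -(-(σ / M * (v x - N) / η₀) * (G₀ + 2 * N * C * R + T)) :=
            neg_le_neg (mul_le_mul_of_nonneg_right g1 g2)
        _ = -(σ / M * (v x - N) / η₀) * -(G₀ + 2 * N * C * R + T) := by ring
        _ ≤ -(σ / M * (v x - N) / η₀) * Iv := mul_le_mul_of_nonneg_left hIvlow g0
        _ = _ := by ring
    have hKQ : K / 2 * Q ≤ 32 * C * κ ^ 2 * R * w x
        + 128 * C * κ ^ 2 * R * σ * N ^ 2 / (M * η₀) := by
      have hKle : K ≤ 64 * (M + σ * (4 * N ^ 2) / M) / η₀ ^ 3 := by rw [hK]; gcongr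
      have hK0 : 0 ≤ K := by rw [hK]; positivity
      calc K / 2 * Q ≤ K / 2 * (C * (ρ ^ 2 * R)) := by gcongr
        _ ≤ 64 * (M + σ * (4 * N ^ 2) / M) / η₀ ^ 3 / 2 * (C * (ρ ^ 2 * R)) := by gcongr
        _ = _ := by rw [hρ, ← hM]; field_simp; ring
    have hdrift : C / ρ ^ 2 * (σ * ρ ^ 2 / (8 * M * C * η₀) * E
        + Q / (4 * (σ * ρ ^ 2 / (8 * M * C * η₀)))) ≤ σ / (8 * M) / η₀ * E
          + 2 * C ^ 3 * w x * R / (σ * κ ^ 2) := by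
      calc _ = σ / (8 * M) / η₀ * E + 2 * C ^ 2 * M * η₀ / (σ * ρ ^ 4) * Q := by field_simp; ring
        _ ≤ σ / (8 * M) / η₀ * E + 2 * C ^ 2 * M * η₀ / (σ * ρ ^ 4) * (C * (ρ ^ 2 * R)) := by
          gcongr
        _ = _ := by rw [hρ, ← hM]; field_simp
    have hτN : 2 * N * ∫ z, τ z ≤ 2 * N * C * R / (κ * η₀) := by
      calc _ ≤ 2 * N * (C / ρ * R) := by gcongr
        _ = _ := by rw [hρ]; ring
    have hmw : C⁻¹ * R * w x ≤ w x * m := by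
      rw [mul_comm (w x)]
      exact mul_le_mul_of_nonneg_right hm1 hwp.le
    have hfinal : C⁻¹ * R * w x ≤ G + T + 32 * C * κ ^ 2 * R * w x
        + 128 * C * κ ^ 2 * R * σ * N ^ 2 / (M * η₀)
        + 2 * N * σ / (M * η₀) * (G₀ + 2 * N * C * R + T) + 2 * C ^ 3 * w x * R / (σ * κ ^ 2)
        + 2 * N * C * R / (κ * η₀) := by
      linarith [hTw.2, hw1.2]
    rw [hM, hA, hS]
    exact max_value_le hC hκ hκC hσ hG hT hN hG₀ hwp hη₀p hη1 hM hR1 hfinal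
  have h0 := hmax' 0 (by rw [norm_zero]; norm_num)
  rw [norm_zero, ← hη₀] at h0
  have h1 : (9 / 16 * max (w 0) 0) ^ 2 ≤ (2 * A * S + 2 * (1 + σ) * S) ^ 2 := by
    have e1 : (η₀ * max (w x) 0) ^ 2 ≤ (2 * A * S) ^ 2 :=
      pow_le_pow_left₀ (mul_nonneg hη₀0 (le_max_right _ _)) hmain 2
    have e2 : σ * (v x - N) ^ 2 ≤ σ * (4 * N ^ 2) := mul_le_mul_of_nonneg_left hasq hσ0.le
    have e3 : σ * (4 * N ^ 2) ≤ (2 * (1 + σ) * S) ^ 2 := by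
      have : N ^ 2 ≤ S ^ 2 := pow_le_pow_left₀ hN hNS 2
      have : σ * (4 * N ^ 2) ≤ σ * (4 * S ^ 2) := by gcongr
      have : σ * (4 * S ^ 2) ≤ (1 + σ) ^ 2 * (4 * S ^ 2) := by
        apply mul_le_mul_of_nonneg_right _ (by positivity)
        nlinarith
      linarith
    have e4 : 0 ≤ 2 * A * S * (2 * (1 + σ) * S) := by positivity
    have e5 : 0 ≤ σ * (v 0 - N) ^ 2 := by positivity
    nlinarith
  have h2 := (abs_le_of_sq_le_sq' h1 (by positivity)).2
  rw [← hS]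
  have h3 := le_max_left (w 0) 0
  have h4 : 0 ≤ A * S := by positivity
  have h5 : 0 ≤ (1 + σ) * S := by positivity
  linarith

lemma integrableOn_hker {n : ℕ} (hn : 0 < n) {s lam Lam : ℝ} (hs : s ∈ Ioo (0:ℝ) 1)
    (hl : 0 < lam) (hl1 : lam ≤ 1) {B : En n →L[ℝ] En n} (hB : Elliptic lam Lam B) {ε : ℝ}
    (hε : 0 < ε) :
    Integrable ({z : En n | ε ≤ ‖z‖}.indicator (hker (cns n s) (n + 2 * s) B)) := by
  obtain ⟨C, hC, h⟩ := hker_integral_compl hn (Lam := Lam) hl hl1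
  refine (h s hs B hB ε 1 _ hε zero_le_one
    ((hker_measurable B).indicator (measurableSet_norm_ge ε)) (fun z hz => ?_) fun z hz => ?_).1
  · rw [indicator_of_mem (show z ∈ {z : En n | ε ≤ ‖z‖} from hz), one_mul,
      abs_of_nonneg (hker_nonneg (cns_nonneg hn hs) B z)]
  · exact indicator_of_notMem (show z ∉ {z : En n | ε ≤ ‖z‖} from not_le.2 hz) _

lemma pv_tendsto_symOp {n : ℕ} (hn : 0 < n) {s lam Lam : ℝ} (hs : s ∈ Ioo (0:ℝ) 1)
    (hl : 0 < lam) (hl1 : lam ≤ 1) {B : En n →L[ℝ] En n} (hB : Elliptic lam Lam B)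
    {v : En n → ℝ} (hv : Continuous v) {M : ℝ} (hM : ∀ x, |v x| ≤ M) {x : En n} {D : ℝ}
    (hD : ∀ z, |2 * v x - v (x + z) - v (x - z)| ≤ D * min (‖z‖ ^ 2) 1) :
    Tendsto (fun ε => ∫ y in {y : En n | ε ≤ dist y x},
      (v x - v y) * hker (cns n s) (n + 2 * s) B (x - y)) (nhdsWithin (0:ℝ) (Ioi 0))
      (nhds (symOp s B v x)) := by
  set H := hker (cns n s) (n + 2 * s) B with hH
  set F : En n → ℝ := fun z => (2 * v x - v (x + z) - v (x - z)) * H z with hF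
  have cp : Continuous fun z => v (x + z) := hv.comp (continuous_const.add continuous_id)
  have cm : Continuous fun z => v (x - z) := hv.comp (continuous_const.sub continuous_id)
  have cd : Continuous fun z => 2 * v x - v (x + z) - v (x - z) :=
    (continuous_const.sub cp).sub cm
  have iF : Integrable F := integrable_mul_hker hn hs hl hl1 hB cd.measurable hD
  have hlim : Tendsto (fun ε => 1 / 2 * ∫ z, {z : En n | ε ≤ ‖z‖}.indicator F z)
      (nhdsWithin (0:ℝ) (Ioi 0)) (nhds (symOp s B v x)) := by
    refine Tendsto.const_mul _ (tendsto_integral_filter_of_dominated_convergence (fun z => ‖F z‖)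
      (Eventually.of_forall fun ε => (iF.1.indicator (measurableSet_norm_ge ε)))
      (Eventually.of_forall fun ε => ae_of_all _ fun z => norm_indicator_le_norm_self _ _) iF.norm
      (ae_of_all _ fun z => ?_))
    apply tendsto_const_nhds.congr'
    rcases eq_or_ne z 0 with rfl | hz
    · refine Eventually.of_forall fun ε => ?_
      have : F 0 = 0 := by simp only [hF, add_zero, sub_zero]; ring
      change F 0 = {z : En n | ε ≤ ‖z‖}.indicator F 0
      rw [indicator_apply, this, ite_self]
    · filter_upwards [Ioo_mem_nhdsGT (norm_pos_iff.2 hz)] with ε hε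
      exact (indicator_of_mem (show z ∈ {z : En n | ε ≤ ‖z‖} from hε.2.le) F).symm
  refine hlim.congr' ?_
  filter_upwards [self_mem_nhdsWithin] with ε hε
  set S := {z : En n | ε ≤ ‖z‖} with hS
  have hSm : MeasurableSet S := measurableSet_norm_ge ε
  have iH := integrableOn_hker hn hs hl hl1 hB hε
  rw [← hH, ← hS] at iH
  have hSe : ∀ z, S.indicator H (-z) = S.indicator H z := fun z => by
    simp only [indicator, hS, mem_ofPred_eq, norm_neg, hH, hker_neg]
  have i0 : Integrable fun z => v x * S.indicator H z := iH.const_mul _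
  have i1 := integrable_mul_bdd iH cp (fun z => hM _)
  have i2 := integrable_mul_bdd iH cm (fun z => hM _)
  have j1 : Integrable fun z => v x * S.indicator H z - S.indicator H z * v (x + z) := i0.sub i1
  have j2 : Integrable fun z => v x * S.indicator H z - S.indicator H z * v (x - z) := i0.sub i2
  have e2 : (∫ z, S.indicator H z * v (x - z)) = ∫ z, S.indicator H z * v (x + z) := by
    rw [← integral_neg_eq_self]
    congr 1; ext z; rw [hSe, sub_neg_eq_add]
  have e1 : (fun z => S.indicator F z) = fun z => (v x * S.indicator H z -
      S.indicator H z * v (x + z)) + (v x * S.indicator H z - S.indicator H z * v (x - z)) := by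
    ext z
    by_cases h : z ∈ S
    · simp only [indicator_of_mem h, hF]; ring
    · simp only [indicator_of_notMem h]; ring
  have e3 : (∫ y in {y : En n | ε ≤ dist y x}, (v x - v y) * H (x - y))
      = ∫ z, (v x * S.indicator H z - S.indicator H z * v (x + z)) := by
    have hm : MeasurableSet {y : En n | ε ≤ dist y x} :=
      measurableSet_le measurable_const (measurable_id.dist measurable_const)
    rw [← integral_indicator hm, ← integral_add_left_eq_self _ x]
    congr 1; ext z
    have hmem : x + z ∈ {y : En n | ε ≤ dist y x} ↔ z ∈ S := by simp [hS, dist_eq_norm]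
    by_cases h : z ∈ S
    · rw [indicator_of_mem (hmem.2 h), indicator_of_mem h]
      have : H (x - (x + z)) = H z := by rw [sub_add_cancel_left, hH, hker_neg]
      rw [this]; ring
    · rw [indicator_of_notMem (fun h' => h (hmem.1 h')), indicator_of_notMem h]; ring
  rw [e3, e1, integral_add j1 j2, integral_sub i0 i1, integral_sub i0 i2, e2]
  ring

/-- The continuous linear map of a matrix. -/
def matCLM {n : ℕ} (A : Matrix (Fin n) (Fin n) ℝ) : En n →L[ℝ] En n :=
  Matrix.toEuclideanCLM (𝕜 := ℝ) A

lemma anorm_eq_norm {n : ℕ} (A : Matrix (Fin n) (Fin n) ℝ) (z : En n) :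
    anorm n A z = ‖matCLM A z‖ := by
  rw [anorm, EuclideanSpace.norm_eq]
  simp [matCLM, Matrix.ofLp_toEuclideanCLM]

lemma inner_matCLM {n : ℕ} (A : Matrix (Fin n) (Fin n) ℝ) (v w : En n) :
    inner ℝ (matCLM A v) w = ∑ i, A.mulVec (fun j => v j) i * w i := by
  simp [matCLM, PiLp.inner_apply, Matrix.ofLp_toEuclideanCLM, mul_comm]

lemma inEllipticClass.elliptic {n : ℕ} {lam Lam : ℝ} (hl : 0 < lam)
    {A : Matrix (Fin n) (Fin n) ℝ} (h : inEllipticClass n lam Lam A) :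
    Elliptic lam Lam (matCLM A) := by
  have hsym : ∀ v w : En n, inner ℝ (matCLM A v) w = inner ℝ (matCLM A w) v := by
    intro v w
    rw [inner_matCLM, inner_matCLM]
    change dotProduct (A.mulVec fun j => v j) (fun i => w i)
      = dotProduct (A.mulVec fun j => w j) (fun i => v i)
    rw [dotProduct_comm, Matrix.dotProduct_mulVec, ← Matrix.mulVec_transpose, h.1]
  have hq : ∀ v : En n, lam * ‖v‖ ^ 2 ≤ inner ℝ (matCLM A v) v ∧
      inner ℝ (matCLM A v) v ≤ Lam * ‖v‖ ^ 2 := by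
    intro v
    rw [inner_matCLM, EuclideanSpace.real_norm_sq_eq]
    exact h.2 fun j => v j
  intro z
  constructor
  · rcases eq_or_ne z 0 with rfl | hz
    · simp
    have hz := norm_pos_iff.2 hz
    have h1 := (hq z).1.trans (real_inner_le_norm _ _)
    exact le_of_mul_le_mul_right (by nlinarith) hz
  · rcases eq_or_ne (matCLM A z) 0 with hz | hz
    · rw [hz, norm_zero]
      rcases eq_or_ne z 0 with rfl | hz'
      · simp
      · have := (hq z)
        have h2 : lam * ‖z‖ ^ 2 ≤ Lam * ‖z‖ ^ 2 := this.1.trans this.2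
        have h3 := norm_pos_iff.2 hz'
        have : lam ≤ Lam := le_of_mul_le_mul_right h2 (by positivity)
        exact mul_nonneg (hl.le.trans this) h3.le
    · have hp := norm_pos_iff.2 hz
      set b := ‖matCLM A z‖ with hb
      set w := (‖z‖ / b) • matCLM A z with hw
      have hwn : ‖w‖ = ‖z‖ := by
        rw [hw, norm_smul, Real.norm_of_nonneg (by positivity), ← hb]; field_simp
      have e1 : inner ℝ (matCLM A z) w = ‖z‖ * b := by
        rw [hw, real_inner_smul_right, real_inner_self_eq_norm_sq, ← hb]; field_simp
      have hz0 : 0 < ‖z‖ := by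
        rw [norm_pos_iff]; rintro rfl; exact hz (map_zero _)
      have p1 := (hq (z + w)).2
      have p2 := (hq (z - w)).1
      have e2 : inner ℝ (matCLM A (z + w)) (z + w) - inner ℝ (matCLM A (z - w)) (z - w)
          = 4 * (‖z‖ * b) := by
        rw [map_add, map_sub, inner_add_left, inner_sub_left, inner_add_right, inner_add_right,
          inner_sub_right, inner_sub_right, hsym w z, e1]
        ring
      have e3 := parallelogram_law_with_norm ℝ z w
      have hLl : 0 ≤ lam * ‖z - w‖ ^ 2 := by positivity
      rw [hwn] at e3
      have hL0 : 0 ≤ Lam := by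
        have h2 : lam * ‖z‖ ^ 2 ≤ Lam * ‖z‖ ^ 2 := (hq z).1.trans (hq z).2
        exact hl.le.trans (le_of_mul_le_mul_right h2 (by positivity))
      have h4 : ‖z + w‖ ^ 2 ≤ 4 * ‖z‖ ^ 2 := by nlinarith [norm_nonneg (z - w)]
      have h5 := mul_le_mul_of_nonneg_left h4 hL0
      refine le_of_mul_le_mul_right ?_ hz0
      nlinarith

lemma opA_eq_symOp {n : ℕ} (hn : 0 < n) {s lam Lam : ℝ} (hs : s ∈ Ioo (0:ℝ) 1)
    (hl : 0 < lam) (hl1 : lam ≤ 1) {A : Matrix (Fin n) (Fin n) ℝ}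
    (hB : Elliptic lam Lam (matCLM A))
    {v : En n → ℝ} (hv : Continuous v) {M : ℝ} (hM : ∀ x, |v x| ≤ M) {x : En n} {D : ℝ}
    (hD : ∀ z, |2 * v x - v (x + z) - v (x - z)| ≤ D * min (‖z‖ ^ 2) 1) :
    opA n s A v x = symOp s (matCLM A) v x := by
  rw [← (pv_tendsto_symOp hn hs hl hl1 hB hv hM hD).limUnder_eq]
  simp only [opA, opK, pvAt, anorm_eq_norm, hker]

lemma second_diff_le {n : ℕ} {v : En n → ℝ} (hv : ContDiff ℝ 2 v) {M : ℝ} (hM : ∀ x, |v x| ≤ M)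
    (r : ℝ) : ∃ D, 0 ≤ D ∧ ∀ x, ‖x‖ ≤ r → ∀ z,
      |2 * v x - v (x + z) - v (x - z)| ≤ D * min (‖z‖ ^ 2) 1 := by
  have h1 : ContDiff ℝ 1 (fderiv ℝ v) := hv.fderiv_right (by norm_num)
  have h2 : Continuous (fderiv ℝ (fderiv ℝ v)) := h1.continuous_fderiv (by norm_num)
  obtain ⟨K, hK⟩ := (isCompact_closedBall (0 : En n) (r + 1)).exists_bound_of_continuousOn
    (f := fderiv ℝ (fderiv ℝ v)) h2.continuousOn
  have hM0 : 0 ≤ M := (abs_nonneg _).trans (hM 0)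
  refine ⟨2 * |K| + 4 * M, by positivity, fun x hx z => ?_⟩
  have hz0 := norm_nonneg z
  rcases le_or_gt 1 ‖z‖ with hz | hz
  · rw [min_eq_right (one_le_pow₀ hz), mul_one]
    have a1 := abs_le.1 (hM x)
    have a2 := abs_le.1 (hM (x + z))
    have a3 := abs_le.1 (hM (x - z))
    rw [abs_le]
    constructor <;> linarith [abs_nonneg K, a1.1, a1.2, a2.1, a2.2, a3.1, a3.2]
  · rw [min_eq_left (pow_le_one₀ hz0 hz.le)]
    have hball : closedBall x ‖z‖ ⊆ closedBall (0 : En n) (r + 1) := by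
      apply closedBall_subset_closedBall'
      rw [dist_zero_right]; linarith
    have hderiv : ∀ y ∈ closedBall x ‖z‖, ‖fderiv ℝ v y - fderiv ℝ v x‖ ≤ |K| * ‖z‖ := by
      intro y hy
      refine ((convex_closedBall x ‖z‖).norm_image_sub_le_of_norm_fderiv_le
        (fun y _ => (h1.differentiable (by norm_num)) y)
        (fun y hy => (hK y (hball hy)).trans (le_abs_self K))
        (mem_closedBall_self hz0) hy).trans ?_
      rw [mem_closedBall, dist_eq_norm] at hy
      gcongr
    have hbd : ∀ y ∈ closedBall x ‖z‖, |v y - v x - fderiv ℝ v x (y - x)| ≤ |K| * ‖z‖ * ‖y - x‖ :=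
      fun y hy => (convex_closedBall x ‖z‖).norm_image_sub_le_of_norm_fderiv_le'
        (fun y _ => (hv.differentiable (by norm_num)) y) hderiv (mem_closedBall_self hz0) hy
    have b1 := hbd (x + z) (by simp [dist_eq_norm])
    have b2 := hbd (x - z) (by simp)
    rw [add_sub_cancel_left, abs_le] at b1
    rw [sub_sub_cancel_left, map_neg, norm_neg, abs_le] at b2
    have : 0 ≤ M * ‖z‖ ^ 2 := by positivity
    rw [abs_le]
    constructor <;> nlinarith

lemma symOp_comb {n : ℕ} {s : ℝ} {B : En n →L[ℝ] En n} {u : En n → ℝ}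
    (hi : ∀ x, Integrable fun z => (2 * u x - u (x + z) - u (x - z)) *
      hker (cns n s) (n + 2 * s) B z) (a b c : ℝ) (p q x : En n) :
    symOp s B (fun y => a * u (y + p) + b * u (y + q) + c * u y) x
      = a * symOp s B u (x + p) + b * symOp s B u (x + q) + c * symOp s B u x := by
  have j1 := (hi (x + p)).const_mul a
  have j2 := (hi (x + q)).const_mul b
  have j3 := (hi x).const_mul c
  have e : symOp s B (fun y => a * u (y + p) + b * u (y + q) + c * u y) x = 1 / 2 *
      ∫ z, ((a * ((2 * u (x + p) - u (x + p + z) - u (x + p - z)) *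
        hker (cns n s) (n + 2 * s) B z) + b * ((2 * u (x + q) - u (x + q + z) - u (x + q - z)) *
        hker (cns n s) (n + 2 * s) B z)) + c * ((2 * u x - u (x + z) - u (x - z)) *
        hker (cns n s) (n + 2 * s) B z)) := by
    rw [symOp]
    congr 2; ext z
    rw [add_right_comm x z p, add_right_comm x z q, sub_add_eq_add_sub x z p,
      sub_add_eq_add_sub x z q]
    ring
  have j12 : Integrable fun z => a * ((2 * u (x + p) - u (x + p + z) - u (x + p - z)) *
        hker (cns n s) (n + 2 * s) B z) + b * ((2 * u (x + q) - u (x + q + z) - u (x + q - z)) *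
        hker (cns n s) (n + 2 * s) B z) := j1.add j2
  rw [e, integral_add j12 j3, integral_add j1 j2, integral_const_mul, integral_const_mul,
    integral_const_mul, symOp, symOp, symOp]
  ring

/-- Convergence of second differences under a common bound gives convergence of the operators,
uniformly over the ellipticity class. -/
lemma symOp_tendsto_unif {n : ℕ} (hn : 0 < n) {s lam Lam : ℝ} (hs : s ∈ Ioo (0:ℝ) 1)
    (hl : 0 < lam) (hl1 : lam ≤ 1) (hL : 1 ≤ Lam) {q : ℝ → En n → ℝ} {q₀ : En n → ℝ} {x : En n}
    {D : ℝ} {l : Filter ℝ} [l.IsCountablyGenerated] (hq : ∀ h, Continuous (q h))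
    (hq₀ : Continuous q₀)
    (hD : ∀ᶠ h in l, ∀ z, |2 * q h x - q h (x + z) - q h (x - z)| ≤ D * min (‖z‖ ^ 2) 1)
    (hD₀ : ∀ z, |2 * q₀ x - q₀ (x + z) - q₀ (x - z)| ≤ D * min (‖z‖ ^ 2) 1)
    (hlim : ∀ z, Tendsto (fun h => 2 * q h x - q h (x + z) - q h (x - z)) l
      (nhds (2 * q₀ x - q₀ (x + z) - q₀ (x - z)))) {ε : ℝ} (hε : 0 < ε) :
    ∀ᶠ h in l, ∀ B : En n →L[ℝ] En n, Elliptic lam Lam B →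
      |symOp s B (q h) x - symOp s B q₀ x| ≤ ε := by
  set Δ : (En n → ℝ) → En n → ℝ := fun v z => 2 * v x - v (x + z) - v (x - z) with hΔ
  have hΔc : ∀ v : En n → ℝ, Continuous v → Continuous (Δ v) := fun v hv =>
    (continuous_const.sub (hv.comp (continuous_const.add continuous_id))).sub
      (hv.comp (continuous_const.sub continuous_id))
  set B₀ : En n →L[ℝ] En n := lam • ContinuousLinearMap.id ℝ (En n) with hB₀
  have hB₀n : ∀ z, ‖B₀ z‖ = lam * ‖z‖ := fun z => by
    simp [hB₀, norm_smul, abs_of_pos hl]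
  have hB₀e : Elliptic lam Lam B₀ := fun z => by
    rw [hB₀n]
    exact ⟨le_rfl, mul_le_mul_of_nonneg_right (hl1.trans hL) (norm_nonneg z)⟩
  have hc := cns_nonneg hn hs
  set H₀ := hker (cns n s) (n + 2 * s) B₀ with hH₀
  have hp : (0:ℝ) < n + 2 * s := by have := hs.1; positivity
  have hHle : ∀ B : En n →L[ℝ] En n, Elliptic lam Lam B → ∀ z,
      hker (cns n s) (n + 2 * s) B z ≤ H₀ z := by
    intro B hB z
    rw [hH₀, hker, hker]
    refine mul_le_mul_of_nonneg_left ?_ hc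
    rcases eq_or_ne z 0 with rfl | hz
    · simp
    · rw [hB₀n]
      exact Real.rpow_le_rpow_of_nonpos (by have := norm_pos_iff.2 hz; positivity) (hB z).1
        (by linarith)
  have hH₀0 : ∀ z, 0 ≤ H₀ z := hker_nonneg hc B₀
  have hdiff : ∀ᶠ h in l, ∀ z, |Δ (q h) z - Δ q₀ z| ≤ 2 * D * min (‖z‖ ^ 2) 1 := by
    filter_upwards [hD] with h hh z
    have := abs_sub (Δ (q h) z) (Δ q₀ z)
    linarith [hh z, hD₀ z]
  have iD : Integrable fun z : En n => 2 * D * min (‖z‖ ^ 2) 1 * H₀ z := by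
    refine integrable_mul_hker hn hs hl hl1 hB₀e (D := |2 * D|)
      (g := fun z => 2 * D * min (‖z‖ ^ 2) 1) (by fun_prop) fun z => ?_
    rw [abs_mul, abs_of_nonneg (le_min (sq_nonneg ‖z‖) zero_le_one)]
  have hint : Tendsto (fun h => ∫ z, |Δ (q h) z - Δ q₀ z| * H₀ z) l (nhds (∫ _z : En n, (0:ℝ))) := by
    refine tendsto_integral_filter_of_dominated_convergence
      (fun z : En n => 2 * D * min (‖z‖ ^ 2) 1 * H₀ z) ?_ ?_ iD ?_
    · exact Eventually.of_forall fun h => ((((hΔc _ (hq h)).sub (hΔc _ hq₀)).abs).measurable.mul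
        (hker_measurable B₀)).aestronglyMeasurable
    · filter_upwards [hdiff] with h hh
      refine ae_of_all _ fun z => ?_
      rw [norm_mul, Real.norm_of_nonneg (hH₀0 z), Real.norm_eq_abs, abs_abs]
      exact mul_le_mul_of_nonneg_right (hh z) (hH₀0 z)
    · refine ae_of_all _ fun z => ?_
      have : Tendsto (fun h => |Δ (q h) z - Δ q₀ z| * H₀ z) l (nhds (|Δ q₀ z - Δ q₀ z| * H₀ z)) :=
        (((hlim z).sub_const _).abs).mul_const _
      simpa using this
  rw [integral_zero] at hint
  filter_upwards [hint.eventually (gt_mem_nhds hε), hD, hdiff] with h h1 h2 h3 B hB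
  have i1 := integrable_mul_hker hn hs hl hl1 hB (hΔc _ (hq h)).measurable h2
  have i2 := integrable_mul_hker hn hs hl hl1 hB (hΔc _ hq₀).measurable hD₀
  have i3 : Integrable fun z => |Δ (q h) z - Δ q₀ z| * H₀ z :=
    integrable_mul_hker hn hs hl hl1 hB₀e ((hΔc _ (hq h)).sub (hΔc _ hq₀)).abs.measurable
      (D := 2 * D) fun z => by rw [abs_abs]; exact h3 z
  have e : symOp s B (q h) x - symOp s B q₀ x
      = 1 / 2 * ∫ z, (Δ (q h) z - Δ q₀ z) * hker (cns n s) (n + 2 * s) B z := by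
    rw [symOp, symOp, ← mul_sub, ← integral_sub i1 i2]
    congr 2; ext z; ring
  have hle : ‖∫ z, (Δ (q h) z - Δ q₀ z) * hker (cns n s) (n + 2 * s) B z‖
      ≤ ∫ z, |Δ (q h) z - Δ q₀ z| * H₀ z := by
    refine norm_integral_le_of_norm_le i3 (ae_of_all _ fun z => ?_)
    rw [norm_mul, Real.norm_eq_abs, Real.norm_of_nonneg (hker_nonneg hc B z)]
    exact mul_le_mul_of_nonneg_left (hHle B hB z) (abs_nonneg _)
  rw [e, abs_mul, abs_of_pos (by norm_num : (0:ℝ) < 1 / 2)]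
  rw [Real.norm_eq_abs] at hle
  linarith [abs_nonneg (∫ z, (Δ (q h) z - Δ q₀ z) * hker (cns n s) (n + 2 * s) B z)]

lemma diff_quot_bound {Ψ Ψ₁ : ℝ → ℝ} {K : ℝ} (h1 : ∀ t, HasDerivAt Ψ (Ψ₁ t) t)
    (hK : ∀ t, |t| ≤ 1 → |Ψ₁ t| ≤ K) {h : ℝ} (hh : 0 < h) (hh1 : h ≤ 1) :
    |h⁻¹ * (Ψ h - Ψ 0)| ≤ K := by
  have := (convex_Icc (0:ℝ) h).norm_image_sub_le_of_norm_hasDerivWithin_le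
    (fun t _ => (h1 t).hasDerivWithinAt) (fun t ht => hK t (by
      rw [abs_of_nonneg ht.1]; exact ht.2.trans hh1)) (left_mem_Icc.2 hh.le) (right_mem_Icc.2 hh.le)
  rw [sub_zero, Real.norm_eq_abs, Real.norm_eq_abs, abs_of_pos hh] at this
  rw [abs_mul, abs_of_pos (inv_pos.2 hh), inv_mul_le_iff₀ hh]
  linarith

lemma symm_hasDerivAt {Ψ Ψ₁ : ℝ → ℝ} (h1 : ∀ t, HasDerivAt Ψ (Ψ₁ t) t) (t : ℝ) :
    HasDerivAt (fun t => Ψ t + Ψ (-t) - 2 * Ψ 0) (Ψ₁ t - Ψ₁ (-t)) t := by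
  have h2 : HasDerivAt (fun t => Ψ (-t)) (Ψ₁ (-t) * -1) t := (h1 (-t)).comp t (hasDerivAt_neg t)
  exact (((h1 t).add h2).sub_const _).congr_deriv (by ring)

lemma second_diff_quot_bound {Ψ Ψ₁ Ψ₂ : ℝ → ℝ} {K : ℝ} (h1 : ∀ t, HasDerivAt Ψ (Ψ₁ t) t)
    (h2 : ∀ t, HasDerivAt Ψ₁ (Ψ₂ t) t) (hK : ∀ t, |t| ≤ 1 → |Ψ₂ t| ≤ K) {h : ℝ} (hh : 0 < h)
    (hh1 : h ≤ 1) : |(h ^ 2)⁻¹ * (Ψ h + Ψ (-h) - 2 * Ψ 0)| ≤ 2 * K := by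
  have hK0 : 0 ≤ K := (abs_nonneg _).trans (hK 0 (by simp))
  have hd : ∀ t ∈ Icc 0 h, ‖Ψ₁ t - Ψ₁ (-t)‖ ≤ 2 * K * h := by
    intro t ht
    have := (convex_Icc (-h) h).norm_image_sub_le_of_norm_hasDerivWithin_le
      (fun t _ => (h2 t).hasDerivWithinAt) (fun t ht => hK t (abs_le.2 ⟨by linarith [ht.1],
        ht.2.trans hh1⟩)) (x := -t) (y := t) ⟨by linarith [ht.2], by linarith [ht.1]⟩
      ⟨by linarith [ht.1], ht.2⟩
    refine this.trans ?_
    rw [sub_neg_eq_add, Real.norm_eq_abs, abs_of_nonneg (by linarith [ht.1])]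
    nlinarith [ht.2]
  have := (convex_Icc (0:ℝ) h).norm_image_sub_le_of_norm_hasDerivWithin_le
    (fun t _ => (symm_hasDerivAt h1 t).hasDerivWithinAt) hd (left_mem_Icc.2 hh.le)
    (right_mem_Icc.2 hh.le)
  rw [sub_zero, Real.norm_eq_abs, Real.norm_eq_abs, abs_of_pos hh, neg_zero] at this
  have e : Ψ h + Ψ (-h) - 2 * Ψ 0 - (Ψ 0 + Ψ 0 - 2 * Ψ 0) = Ψ h + Ψ (-h) - 2 * Ψ 0 := by ring
  rw [e] at this
  rw [abs_mul, abs_of_pos (by positivity), inv_mul_le_iff₀ (by positivity)]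
  linarith

lemma diff_quot_tendsto {Ψ : ℝ → ℝ} {c : ℝ} (h1 : HasDerivAt Ψ c 0) :
    Tendsto (fun h => h⁻¹ * (Ψ h - Ψ 0)) (nhdsWithin 0 (Ioi 0)) (nhds c) := by
  have := h1.tendsto_slope_zero_right
  simpa using this

lemma second_diff_quot_tendsto {Ψ Ψ₁ : ℝ → ℝ} {c : ℝ} (h1 : ∀ t, HasDerivAt Ψ (Ψ₁ t) t)
    (h2 : HasDerivAt Ψ₁ c 0) :
    Tendsto (fun h => (h ^ 2)⁻¹ * (Ψ h + Ψ (-h) - 2 * Ψ 0)) (nhdsWithin 0 (Ioi 0)) (nhds c) := by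
  have h3 : HasDerivAt (fun t => Ψ₁ t - Ψ₁ (-t)) (c + c) 0 := by
    have h4 : HasDerivAt (fun t => Ψ₁ (-t)) (c * -1) 0 := by
      refine HasDerivAt.comp 0 ?_ (hasDerivAt_neg 0)
      rwa [neg_zero]
    exact (h2.sub h4).congr_deriv (by ring)
  have h4 := diff_quot_tendsto h3
  have hc : Continuous fun t => Ψ t + Ψ (-t) - 2 * Ψ 0 :=
    continuous_iff_continuousAt.2 fun t => (symm_hasDerivAt h1 t).continuousAt
  have h5 : Tendsto (fun h => (Ψ h + Ψ (-h) - 2 * Ψ 0) / h ^ 2) (nhdsWithin 0 (Ioi 0)) (nhds c) := by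
    refine HasDerivAt.lhopital_zero_nhdsGT (f' := fun t => Ψ₁ t - Ψ₁ (-t)) (g' := fun t => 2 * t)
      (Eventually.of_forall (symm_hasDerivAt h1))
      (Eventually.of_forall fun t => ((hasDerivAt_pow 2 t).congr_deriv (by norm_num))) ?_ ?_ ?_ ?_
    · filter_upwards [self_mem_nhdsWithin] with t ht
      have : (0:ℝ) < t := ht
      positivity
    · have := hc.tendsto 0
      have e : Ψ 0 + Ψ (-0) - 2 * Ψ 0 = 0 := by rw [neg_zero]; ring
      rw [e] at this
      exact this.mono_left nhdsWithin_le_nhds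
    · have := (continuous_pow (M := ℝ) 2).tendsto 0
      rw [zero_pow two_ne_zero] at this
      exact this.mono_left nhdsWithin_le_nhds
    · have := h4.const_mul (1 / 2)
      have e : 1 / 2 * (c + c) = c := by ring
      rw [e] at this
      refine this.congr fun t => ?_
      rw [neg_zero, sub_self, sub_zero]
      field_simp
  refine h5.congr fun h => ?_
  rw [div_eq_inv_mul]

lemma ContDiff.dd {n : ℕ} {u : En n → ℝ} (hu : ContDiff ℝ (⊤ : ℕ∞) u) (e : En n) :
    ContDiff ℝ (⊤ : ℕ∞) (dd n e u) :=
  (hu.fderiv_right (m := (⊤ : ℕ∞)) (by norm_cast)).clm_apply contDiff_const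

lemma ContDiff.dd2 {n : ℕ} {u : En n → ℝ} (hu : ContDiff ℝ (⊤ : ℕ∞) u) (e : En n) :
    ContDiff ℝ (⊤ : ℕ∞) (dd2 n e u) := (hu.dd e).dd e

lemma hasLineDerivAt_dd {n : ℕ} {u : En n → ℝ} (hu : ContDiff ℝ (⊤ : ℕ∞) u) (e x : En n) :
    HasLineDerivAt ℝ u (dd n e u x) x e :=
  ((hu.differentiable (by simp)) x).hasFDerivAt.hasLineDerivAt e

lemma hasDerivAt_dd {n : ℕ} {u : En n → ℝ} (hu : ContDiff ℝ (⊤ : ℕ∞) u) (e y : En n) (t : ℝ) :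
    HasDerivAt (fun t : ℝ => u (y + t • e)) (dd n e u (y + t • e)) t := by
  have h1 : HasDerivAt (fun t : ℝ => y + t • e) e t := by
    simpa using ((hasDerivAt_id t).smul_const e).const_add y
  exact ((hu.differentiable (by simp)) (y + t • e)).hasFDerivAt.comp_hasDerivAt t h1

lemma hasDerivAt_second_diff {n : ℕ} {u : En n → ℝ} (hu : ContDiff ℝ (⊤ : ℕ∞) u) (e x z : En n)
    (t : ℝ) : HasDerivAt (fun t : ℝ => 2 * u (x + t • e) - u (x + t • e + z) - u (x + t • e - z))
      (2 * dd n e u (x + t • e) - dd n e u (x + t • e + z) - dd n e u (x + t • e - z)) t := by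
  have h1 := hasDerivAt_dd hu e (x + z) t
  have h2 := hasDerivAt_dd hu e (x - z) t
  simp only [add_right_comm x z, sub_add_eq_add_sub x z] at h1 h2
  exact (((hasDerivAt_dd hu e x t).const_mul 2).sub h1).sub h2

lemma abs_dd_le {n : ℕ} {u : En n → ℝ} {M : ℝ} (hM : ∀ x, ‖fderiv ℝ u x‖ ≤ M) {e : En n}
    (he : ‖e‖ = 1) (x : En n) : |dd n e u x| ≤ M := by
  have := (fderiv ℝ u x).le_opNorm e
  rw [he, mul_one] at this
  exact this.trans (hM x)

lemma norm_fderiv_dd_le {n : ℕ} {u : En n → ℝ} (hu : ContDiff ℝ (⊤ : ℕ∞) u) {M : ℝ}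
    (hM : ∀ x, ‖fderiv ℝ (fderiv ℝ u) x‖ ≤ M) {e : En n}
    (he : ‖e‖ = 1) (x : En n) : ‖fderiv ℝ (dd n e u) x‖ ≤ M := by
  have hd : DifferentiableAt ℝ (fderiv ℝ u) x :=
    ((hu.fderiv_right (m := 1) (by norm_cast)).differentiable (by norm_num)) x
  have hM0 : 0 ≤ M := le_trans (norm_nonneg (fderiv ℝ (fderiv ℝ u) x)) (hM x)
  refine ContinuousLinearMap.opNorm_le_bound _ hM0 fun z => ?_
  have h1 : HasFDerivAt (dd n e u) ((ContinuousLinearMap.apply ℝ ℝ e).comp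
      (fderiv ℝ (fderiv ℝ u) x)) x :=
    (ContinuousLinearMap.apply ℝ ℝ e).hasFDerivAt.comp x hd.hasFDerivAt
  rw [h1.fderiv]
  have h2 := ((fderiv ℝ (fderiv ℝ u) x) z).le_opNorm e
  have h3 := (fderiv ℝ (fderiv ℝ u) x).le_opNorm z
  rw [he, mul_one] at h2
  exact h2.trans (h3.trans (mul_le_mul_of_nonneg_right (hM x) (norm_nonneg z)))

lemma abs_dd2_le {n : ℕ} {u : En n → ℝ} (hu : ContDiff ℝ (⊤ : ℕ∞) u) {M : ℝ}
    (hM : ∀ x, ‖fderiv ℝ (fderiv ℝ u) x‖ ≤ M) {e : En n}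
    (he : ‖e‖ = 1) (x : En n) : |dd2 n e u x| ≤ M :=
  abs_dd_le (norm_fderiv_dd_le hu hM he) he x

lemma abs_sub_le_of_fderiv {n : ℕ} {u : En n → ℝ} (hu : ContDiff ℝ (⊤ : ℕ∞) u) {M : ℝ}
    (hM : ∀ x, ‖fderiv ℝ u x‖ ≤ M) (x z : En n) : |u (x + z) - u x| ≤ M * ‖z‖ := by
  have := convex_univ.norm_image_sub_le_of_norm_fderiv_le (𝕜 := ℝ)
    (fun y _ => (hu.differentiable (by simp)) y) (fun y _ => hM y) (mem_univ x) (mem_univ (x + z))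
  rwa [add_sub_cancel_left] at this

lemma second_diff_le_smooth {n : ℕ} {v : En n → ℝ} (hv : ContDiff ℝ (⊤ : ℕ∞) v) {M : ℝ}
    (hM : ∀ x, |v x| ≤ M) (r : ℝ) : ∃ D, 0 ≤ D ∧ ∀ x, ‖x‖ ≤ r → ∀ z,
      |2 * v x - v (x + z) - v (x - z)| ≤ D * min (‖z‖ ^ 2) 1 :=
  second_diff_le (contDiff_infty.1 hv 2) hM r

lemma symOp_dd_quot {n : ℕ} (hn : 0 < n) {s lam Lam : ℝ} (hs : s ∈ Ioo (0:ℝ) 1)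
    (hl : 0 < lam) (hl1 : lam ≤ 1) (hL : 1 ≤ Lam) {u : En n → ℝ} (hu : ContDiff ℝ (⊤ : ℕ∞) u)
    {M : ℝ} (hM : ∀ x, |u x| ≤ M) (hM' : ∀ x, ‖fderiv ℝ u x‖ ≤ M) {e : En n} (he : ‖e‖ = 1)
    (x : En n) {ε : ℝ} (hε : 0 < ε) :
    ∀ᶠ h in nhdsWithin (0:ℝ) (Ioi 0), ∀ B : En n →L[ℝ] En n, Elliptic lam Lam B →
      |h⁻¹ * (symOp s B u (x + h • e) - symOp s B u x) - symOp s B (dd n e u) x| ≤ ε := by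
  obtain ⟨D, hD0, hD⟩ := second_diff_le_smooth (hu.dd e) (abs_dd_le hM' he) (‖x‖ + 1)
  have hnear : ∀ t : ℝ, |t| ≤ 1 → ‖x + t • e‖ ≤ ‖x‖ + 1 := fun t ht => by
    refine (norm_add_le _ _).trans ?_
    rw [norm_smul, he, mul_one, Real.norm_eq_abs]; linarith
  have hΔ : ∀ (h : ℝ) (z : En n), 2 * (h⁻¹ * u (x + h • e) + 0 * u (x + h • e) + -h⁻¹ * u x)
      - (h⁻¹ * u (x + z + h • e) + 0 * u (x + z + h • e) + -h⁻¹ * u (x + z))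
      - (h⁻¹ * u (x - z + h • e) + 0 * u (x - z + h • e) + -h⁻¹ * u (x - z))
      = h⁻¹ * ((2 * u (x + h • e) - u (x + h • e + z) - u (x + h • e - z)) -
        (2 * u (x + (0:ℝ) • e) - u (x + (0:ℝ) • e + z) - u (x + (0:ℝ) • e - z))) := by
    intro h z
    rw [add_right_comm x z, sub_add_eq_add_sub x z, zero_smul, add_zero]; ring
  have hconv := symOp_tendsto_unif hn hs hl hl1 hL
    (q := fun h y => h⁻¹ * u (y + h • e) + 0 * u (y + h • e) + -h⁻¹ * u y) (q₀ := dd n e u) (x := x)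
    (D := D) (l := nhdsWithin (0:ℝ) (Ioi 0))
    (fun h => by have := hu.continuous; fun_prop) (hu.dd e).continuous ?_
    (hD x (by linarith)) ?_ hε
  · filter_upwards [hconv] with h hh B hB
    have hi : ∀ x, Integrable fun z => (2 * u x - u (x + z) - u (x - z)) *
      hker (cns n s) (n + 2 * s) B z := fun x => by
        obtain ⟨D', -, hD'⟩ := second_diff_le_smooth hu hM ‖x‖
        have := hu.continuous
        exact integrable_mul_hker hn hs hl hl1 hB
          (by fun_prop : Continuous fun z => 2 * u x - u (x + z) - u (x - z)).measurable
          (hD' x le_rfl)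
    have := hh B hB
    rw [symOp_comb hi] at this
    refine le_trans (le_of_eq ?_) this
    congr 1; ring
  · filter_upwards [Ioc_mem_nhdsGT (zero_lt_one' ℝ)] with h hh z
    rw [hΔ]
    refine diff_quot_bound (hasDerivAt_second_diff hu e x z) (fun t ht => hD _ (hnear t ht) z)
      hh.1 hh.2
  · intro z
    simp only [hΔ]
    have := hasDerivAt_second_diff hu e x z 0
    have := diff_quot_tendsto this
    simpa only [zero_smul, add_zero] using this

lemma symOp_dd2_quot {n : ℕ} (hn : 0 < n) {s lam Lam : ℝ} (hs : s ∈ Ioo (0:ℝ) 1)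
    (hl : 0 < lam) (hl1 : lam ≤ 1) (hL : 1 ≤ Lam) {u : En n → ℝ} (hu : ContDiff ℝ (⊤ : ℕ∞) u)
    {M : ℝ} (hM : ∀ x, |u x| ≤ M) (hM'' : ∀ x, ‖fderiv ℝ (fderiv ℝ u) x‖ ≤ M) {e : En n}
    (he : ‖e‖ = 1) (x : En n) {ε : ℝ} (hε : 0 < ε) :
    ∀ᶠ h in nhdsWithin (0:ℝ) (Ioi 0), ∀ B : En n →L[ℝ] En n, Elliptic lam Lam B →
      |(h ^ 2)⁻¹ * (symOp s B u (x + h • e) + symOp s B u (x - h • e) - 2 * symOp s B u x)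
        - symOp s B (dd2 n e u) x| ≤ ε := by
  obtain ⟨D, hD0, hD⟩ := second_diff_le_smooth (hu.dd2 e) (abs_dd2_le hu hM'' he) (‖x‖ + 1)
  have hnear : ∀ t : ℝ, |t| ≤ 1 → ‖x + t • e‖ ≤ ‖x‖ + 1 := fun t ht => by
    refine (norm_add_le _ _).trans ?_
    rw [norm_smul, he, mul_one, Real.norm_eq_abs]; linarith
  have hΔ : ∀ (h : ℝ) (z : En n), 2 * ((h ^ 2)⁻¹ * u (x + h • e) + (h ^ 2)⁻¹ * u (x + (-h) • e)
        + -(2 * (h ^ 2)⁻¹) * u x)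
      - ((h ^ 2)⁻¹ * u (x + z + h • e) + (h ^ 2)⁻¹ * u (x + z + (-h) • e)
        + -(2 * (h ^ 2)⁻¹) * u (x + z))
      - ((h ^ 2)⁻¹ * u (x - z + h • e) + (h ^ 2)⁻¹ * u (x - z + (-h) • e)
        + -(2 * (h ^ 2)⁻¹) * u (x - z))
      = (h ^ 2)⁻¹ * ((2 * u (x + h • e) - u (x + h • e + z) - u (x + h • e - z)) +
        (2 * u (x + (-h) • e) - u (x + (-h) • e + z) - u (x + (-h) • e - z)) -
        2 * (2 * u (x + (0:ℝ) • e) - u (x + (0:ℝ) • e + z) - u (x + (0:ℝ) • e - z))) := by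
    intro h z
    rw [add_right_comm x z, sub_add_eq_add_sub x z, add_right_comm x z, sub_add_eq_add_sub x z,
      zero_smul, add_zero]
    ring
  have hconv := symOp_tendsto_unif hn hs hl hl1 hL
    (q := fun h y => (h ^ 2)⁻¹ * u (y + h • e) + (h ^ 2)⁻¹ * u (y + (-h) • e)
      + -(2 * (h ^ 2)⁻¹) * u y) (q₀ := dd2 n e u) (x := x)
    (D := 2 * D) (l := nhdsWithin (0:ℝ) (Ioi 0))
    (fun h => by have := hu.continuous; fun_prop) (hu.dd2 e).continuous ?_
    (fun z => (hD x (by linarith) z).trans ?_) ?_ hε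
  · filter_upwards [hconv] with h hh B hB
    have hi : ∀ x, Integrable fun z => (2 * u x - u (x + z) - u (x - z)) *
      hker (cns n s) (n + 2 * s) B z := fun x => by
        obtain ⟨D', -, hD'⟩ := second_diff_le_smooth hu hM ‖x‖
        have := hu.continuous
        exact integrable_mul_hker hn hs hl hl1 hB
          (by fun_prop : Continuous fun z => 2 * u x - u (x + z) - u (x - z)).measurable
          (hD' x le_rfl)
    have := hh B hB
    rw [symOp_comb hi] at this
    refine le_trans (le_of_eq ?_) this
    rw [neg_smul, ← sub_eq_add_neg]
    congr 1; ring
  · filter_upwards [Ioc_mem_nhdsGT (zero_lt_one' ℝ)] with h hh z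
    rw [hΔ, mul_assoc 2 D]
    exact second_diff_quot_bound (hasDerivAt_second_diff hu e x z)
      (hasDerivAt_second_diff (hu.dd e) e x z) (fun t ht => hD _ (hnear t ht) z) hh.1 hh.2
  · have : 0 ≤ D * min (‖z‖ ^ 2) 1 := by positivity
    linarith
  · intro z
    simp only [hΔ]
    have := second_diff_quot_tendsto (hasDerivAt_second_diff hu e x z)
      (hasDerivAt_second_diff (hu.dd e) e x z 0)
    simp only [zero_smul, add_zero] at this ⊢
    exact this

lemma dd_neg {n : ℕ} (e : En n) (u : En n → ℝ) : dd n (-e) u = fun x => -dd n e u x := by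
  ext x; simp [dd]

lemma symOp_neg {n : ℕ} (s : ℝ) (B : En n →L[ℝ] En n) (v : En n → ℝ) (x : En n) :
    symOp s B (fun x => -v x) x = -symOp s B v x := by
  rw [symOp, symOp, ← mul_neg, ← integral_neg]
  congr 2; ext z; ring

/-- A near-maximizer at `x` is, up to `ε`, a subsolution operator for the first and second
directional derivatives at `x`. -/
lemma exists_near_maximizer {n : ℕ} (hn : 0 < n) {s lam Lam : ℝ} (hs : s ∈ Ioo (0:ℝ) 1)
    (hl : 0 < lam) (hl1 : lam ≤ 1) (hL : 1 ≤ Lam) {u : En n → ℝ} (hu : ContDiff ℝ (⊤ : ℕ∞) u)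
    {M : ℝ} (hM : ∀ x, |u x| ≤ M) (hM' : ∀ x, ‖fderiv ℝ u x‖ ≤ M)
    (hM'' : ∀ x, ‖fderiv ℝ (fderiv ℝ u) x‖ ≤ M) {ι : Type*} {B : ι → En n →L[ℝ] En n}
    (hB : ∀ i, Elliptic lam Lam (B i)) {k : ι → En n → ℝ} {R : ℝ}
    (hle : ∀ x, ‖x‖ < R → ∀ i, symOp s (B i) u x ≤ k i x) {e : En n} (he : ‖e‖ = 1) {x : En n}
    (hex : ∀ ε > 0, ∃ i, k i x - ε ≤ symOp s (B i) u x) {G : ℝ}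
    (hG : ∀ i (h : ℝ), ‖x + h • e‖ < R → |k i (x + h • e) - k i x| ≤ G * |h|)
    (hx : ‖x‖ < R) {ε : ℝ} (hε : 0 < ε) :
    ∃ i, k i x - ε ≤ symOp s (B i) u x ∧ |symOp s (B i) (dd n e u) x| ≤ G + ε ∧
      ∀ G', (∀ i (h : ℝ), ‖x + h • e‖ < R → ‖x - h • e‖ < R →
        k i (x + h • e) + k i (x - h • e) - 2 * k i x ≤ G' * h ^ 2) →
        symOp s (B i) (dd2 n e u) x ≤ G' + ε := by
  have h1 := symOp_dd_quot hn hs hl hl1 hL hu hM hM' he x (half_pos hε)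
  have h2 := symOp_dd_quot hn hs hl hl1 hL hu hM hM' (e := -e) (by rwa [norm_neg]) x (half_pos hε)
  have h3 := symOp_dd2_quot hn hs hl hl1 hL hu hM hM'' he x (half_pos hε)
  have hδ : 0 < min (min 1 (ε / 4)) (R - ‖x‖) := by
    refine lt_min (lt_min one_pos (by positivity)) (by linarith)
  obtain ⟨h, ⟨⟨H1, H2⟩, H3⟩, hh0, hh⟩ :=
    (((h1.and h2).and h3).and (Ioo_mem_nhdsGT hδ)).exists
  have hh1 : h < 1 := hh.trans_le ((min_le_left _ _).trans (min_le_left _ _))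
  have hhε : h < ε / 4 := hh.trans_le ((min_le_left _ _).trans (min_le_right _ _))
  have hhR : h < R - ‖x‖ := hh.trans_le (min_le_right _ _)
  have hb1 : ‖x + h • e‖ < R := by
    refine (norm_add_le _ _).trans_lt ?_
    rw [norm_smul, he, mul_one, Real.norm_of_nonneg hh0.le]; linarith
  have hb2 : ‖x - h • e‖ < R := by
    refine (norm_sub_le _ _).trans_lt ?_
    rw [norm_smul, he, mul_one, Real.norm_of_nonneg hh0.le]; linarith
  obtain ⟨i, hi⟩ := hex (h ^ 3) (by positivity)
  have hh2 : h ^ 2 ≤ ε / 4 := by nlinarith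
  have hh3 : h ^ 3 ≤ h * (ε / 4) := by nlinarith
  have a1 := hle _ hb1 i
  have a2 := hle _ hb2 i
  have g1 := (abs_le.1 (hG i h hb1)).2
  have g2 := (abs_le.1 (hG i (-h) (by rwa [neg_smul, ← sub_eq_add_neg]))).2
  rw [neg_smul, ← sub_eq_add_neg, abs_neg] at g2
  rw [abs_of_pos hh0] at g1 g2
  have b1 := abs_le.1 (H1 _ (hB i))
  have b2 := H2 _ (hB i)
  rw [dd_neg, symOp_neg, smul_neg, ← sub_eq_add_neg] at b2
  replace b2 := abs_le.1 b2
  have b3 := abs_le.1 (H3 _ (hB i))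
  have c1 : h⁻¹ * (symOp s (B i) u (x + h • e) - symOp s (B i) u x) ≤ G + ε / 2 := by
    rw [inv_mul_le_iff₀ hh0]; nlinarith
  have c2 : h⁻¹ * (symOp s (B i) u (x - h • e) - symOp s (B i) u x) ≤ G + ε / 2 := by
    rw [inv_mul_le_iff₀ hh0]; nlinarith
  refine ⟨i, ?_, abs_le.2 ⟨by linarith [b2.1], by linarith [b1.1]⟩, fun G' hG' => ?_⟩
  · nlinarith
  · have g3 := hG' i h hb1 hb2
    have c3 : (h ^ 2)⁻¹ * (symOp s (B i) u (x + h • e) + symOp s (B i) u (x - h • e)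
        - 2 * symOp s (B i) u x) ≤ G' + ε / 2 := by
      rw [inv_mul_le_iff₀ (by positivity)]
      have : 2 * h ^ 3 ≤ h ^ 2 * (ε / 2) := by
        have := mul_le_mul_of_nonneg_left hhε.le (by positivity : 0 ≤ 2 * h ^ 2)
        nlinarith
      nlinarith
    linarith [b3.1]

lemma hker_smul {n : ℕ} {c p r : ℝ} (hr : 0 < r) (B : En n →L[ℝ] En n) (z : En n) :
    hker c p B (r • z) = r ^ (-p) * hker c p B z := by
  rw [hker, hker, map_smul, norm_smul, Real.norm_of_nonneg hr.le,
    Real.mul_rpow hr.le (norm_nonneg _)]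
  ring

lemma symOp_const_mul {n : ℕ} (s : ℝ) (B : En n →L[ℝ] En n) (c : ℝ) (v : En n → ℝ) (x : En n) :
    symOp s B (fun x => c * v x) x = c * symOp s B v x := by
  rw [symOp, symOp, mul_left_comm c, ← integral_const_mul c]
  congr 1
  refine integral_congr_ae (Eventually.of_forall fun z => ?_)
  ring

lemma symOp_comp_affine {n : ℕ} (s : ℝ) (B : En n →L[ℝ] En n) (v : En n → ℝ) (x y : En n) {r : ℝ}
    (hr : 0 < r) :
    symOp s B (fun x => v (y + r • x)) x = r ^ (2 * s) * symOp s B v (y + r • x) := by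
  have h := Measure.integral_comp_smul_of_nonneg volume
    (fun z => (2 * v (y + r • x) - v (y + r • x + z) - v (y + r • x - z)) *
      hker (cns n s) (n + 2 * s) B z) r (hR := hr.le)
  rw [finrank_euclideanSpace_fin, smul_eq_mul] at h
  have h2 : ∀ z, (2 * v (y + r • x) - v (y + r • (x + z)) - v (y + r • (x - z))) *
      hker (cns n s) (n + 2 * s) B z = r ^ ((n:ℝ) + 2 * s) *
      ((2 * v (y + r • x) - v (y + r • x + r • z) - v (y + r • x - r • z)) *
      hker (cns n s) (n + 2 * s) B (r • z)) := fun z => by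
    rw [hker_smul hr, smul_add, smul_sub, ← add_assoc, ← add_sub_assoc, Real.rpow_neg hr.le]
    have : r ^ ((n:ℝ) + 2 * s) ≠ 0 := (Real.rpow_pos_of_pos hr _).ne'
    field_simp
  rw [symOp, symOp]
  simp only [h2]
  rw [integral_const_mul, h, Real.rpow_add hr, Real.rpow_natCast]
  have : r ^ n ≠ 0 := by positivity
  field_simp

lemma HasLineDerivAt.comp_affine {n : ℕ} {u : En n → ℝ} {d r : ℝ} {x y e : En n}
    (h : HasLineDerivAt ℝ u d (y + r • x) e) :
    HasLineDerivAt ℝ (fun x => u (y + r • x)) (r * d) x e := by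
  have h1 : HasDerivAt (fun t : ℝ => r * t) r 0 := by
    simpa using (hasDerivAt_id (0:ℝ)).const_mul r
  have h2 : HasDerivAt (fun t : ℝ => u (y + r • x + t • e)) d (r * 0) := by
    rw [mul_zero]; exact h
  have h3 := h2.comp 0 h1
  rw [mul_comm] at h3
  refine HasDerivAt.congr_of_eventuallyEq h3 (Eventually.of_forall fun t => ?_)
  simp only [Function.comp, smul_add, smul_smul, add_assoc]

lemma le_of_forall_pos_le_continuous {a : ℝ} {F : ℝ → ℝ} (hF : Continuous F)
    (h : ∀ ε > 0, a ≤ F ε) : a ≤ F 0 :=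
  ge_of_tendsto (hF.tendsto 0 |>.mono_left nhdsWithin_le_nhds)
    (eventually_mem_nhdsWithin.mono fun ε hε => h ε hε : ∀ᶠ ε in nhdsWithin (0:ℝ) (Ioi 0), a ≤ F ε)

set_option maxHeartbeats 1000000 in
/-- Scaled one-sided bounds for the first and second directional derivatives at the center of a
ball in which the extremal equation holds. -/
lemma scaled_bounds {n : ℕ} (hn : 0 < n) {lam Lam : ℝ} (hl : 0 < lam) (hl1 : lam ≤ 1)
    (hL : 1 ≤ Lam) : ∃ C : ℝ, 0 < C ∧ ∀ s ∈ Ioo (0:ℝ) 1, ∀ u : En n → ℝ,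
    ContDiff ℝ (⊤ : ℕ∞) u → ∀ M : ℝ,
    (∀ x, |u x| ≤ M ∧ ‖fderiv ℝ u x‖ ≤ M ∧ ‖fderiv ℝ (fderiv ℝ u) x‖ ≤ M) →
    ∀ {ι : Type} (B : ι → En n →L[ℝ] En n) (k : ι → En n → ℝ) (R : ℝ),
    (∀ i, Elliptic lam Lam (B i)) →
    (∀ x, ‖x‖ < R → ∀ i, symOp s (B i) u x ≤ k i x) →
    (∀ x, ‖x‖ < R → ∀ ε > 0, ∃ i, k i x - ε ≤ symOp s (B i) u x) →
    ∀ e : En n, ‖e‖ = 1 → ∀ Minf G : ℝ, (∀ x, |u x| ≤ Minf) → 0 ≤ G →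
    (∀ x, ‖x‖ < R → ∀ i (h : ℝ), ‖x + h • e‖ < R → |k i (x + h • e) - k i x| ≤ G * |h|) →
    ∀ (y : En n) (r : ℝ), 0 < r → ‖y‖ + r ≤ R →
    (∀ N G₀, 0 ≤ G₀ → (∀ x, ‖x‖ < R → ∀ i, -G₀ ≤ k i x) → (∀ x, ‖x‖ < R → |u x| ≤ N) →
      r * dd n e u y ≤ C * (r ^ (1 + 2 * s) * G + Minf + N + √(N * (r ^ (2 * s) * G₀)))) ∧
    (∀ N G₂, 0 ≤ G₂ → (∀ x, ‖x‖ < R → ∀ i (h : ℝ), ‖x + h • e‖ < R → ‖x - h • e‖ < R →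
        k i (x + h • e) + k i (x - h • e) - 2 * k i x ≤ G₂ * h ^ 2) →
      (∀ x, ‖x - y‖ < r → r * |dd n e u x| ≤ N) →
      r ^ 2 * dd2 n e u y ≤
        C * (r ^ (2 + 2 * s) * G₂ + Minf + N + √(N * (r ^ (1 + 2 * s) * G)))) := by
  obtain ⟨C₁, hC₁, H⟩ := lineDeriv_upper_bound hn hl hl1 hL
  obtain ⟨C₂, hC₂, hfar⟩ := far_tail hn hl hl1 hL
  refine ⟨C₁ * (1 + C₂), by positivity, ?_⟩
  intro s hs u hu M hM ι B k R hB hle hex e he Minf G hMinf hG0 hG y r hr hyr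
  have hMu := fun x => (hM x).1
  have hMu' := fun x => (hM x).2.1
  have hMu'' := fun x => (hM x).2.2
  have hMinf0 : 0 ≤ Minf := (abs_nonneg _).trans (hMinf 0)
  have hM0 : 0 ≤ M := (abs_nonneg _).trans (hMu 0)
  have haff : ContDiff ℝ (⊤ : ℕ∞) fun x : En n => y + r • x := by fun_prop
  have sU : ContDiff ℝ (⊤ : ℕ∞) fun x : En n => u (y + r • x) := hu.comp haff
  have sV : ContDiff ℝ (⊤ : ℕ∞) fun x : En n => r * dd n e u (y + r • x) :=
    contDiff_const.mul ((hu.dd e).comp haff)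
  have sW : ContDiff ℝ (⊤ : ℕ∞) fun x : En n => r ^ 2 * dd2 n e u (y + r • x) :=
    contDiff_const.mul ((hu.dd2 e).comp haff)
  have bV : ∀ x : En n, |r * dd n e u (y + r • x)| ≤ r * M := fun x => by
    rw [abs_mul, abs_of_pos hr]
    exact mul_le_mul_of_nonneg_left (abs_dd_le hMu' he _) hr.le
  have bW : ∀ x : En n, |r ^ 2 * dd2 n e u (y + r • x)| ≤ r ^ 2 * M := fun x => by
    rw [abs_mul, abs_of_pos (by positivity : 0 < r ^ 2)]
    exact mul_le_mul_of_nonneg_left (abs_dd2_le hu hMu'' he _) (by positivity)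
  have lU : ∀ x : En n, HasLineDerivAt ℝ (fun x => u (y + r • x)) (r * dd n e u (y + r • x)) x e :=
    fun x => (hasLineDerivAt_dd hu e _).comp_affine
  have lV : ∀ x : En n, HasLineDerivAt ℝ (fun x => r * dd n e u (y + r • x))
      (r ^ 2 * dd2 n e u (y + r • x)) x e := fun x => by
    have := (hasLineDerivAt_dd (hu.dd e) e (y + r • x)).comp_affine
    have h2 := HasDerivAt.const_mul r this
    rw [← mul_assoc, ← sq] at h2
    exact h2
  have lipU : ∀ x z : En n, |u (y + r • (x + z)) - u (y + r • x)| ≤ M * r * ‖z‖ := fun x z => by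
    have := abs_sub_le_of_fderiv hu hMu' (y + r • x) (r • z)
    rwa [norm_smul, Real.norm_of_nonneg hr.le, ← mul_assoc, add_assoc, ← smul_add] at this
  have lipV : ∀ x z : En n, |r * dd n e u (y + r • (x + z)) - r * dd n e u (y + r • x)| ≤
      r * (M * r) * ‖z‖ := fun x z => by
    have := abs_sub_le_of_fderiv (hu.dd e) (norm_fderiv_dd_le hu hMu'' he) (y + r • x) (r • z)
    rw [norm_smul, Real.norm_of_nonneg hr.le, ← mul_assoc, add_assoc, ← smul_add] at this
    rw [← mul_sub, abs_mul, abs_of_pos hr, mul_assoc r]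
    exact mul_le_mul_of_nonneg_left this hr.le
  have dU := fun x : En n => (second_diff_le_smooth sU (fun x => hMu _) ‖x‖).imp
    fun D hD => hD.2 x le_rfl
  have dV := fun x : En n => (second_diff_le_smooth sV bV ‖x‖).imp fun D hD => hD.2 x le_rfl
  have dW := fun x : En n => (second_diff_le_smooth sW bW ‖x‖).imp fun D hD => hD.2 x le_rfl
  have hin : ∀ x : En n, ‖x‖ < 1 → ‖y + r • x‖ < R := fun x hx => by
    refine (norm_add_le _ _).trans_lt ?_
    rw [norm_smul, Real.norm_of_nonneg hr.le]
    nlinarith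
  have hT := fun i x => hfar s hs (B i) (hB i) e he _ _ _ Minf (r * M) (r ^ 2 * M) sU.continuous
    sV.continuous sW.continuous (fun x => hMinf _) bV bW lU lV x
  have hp1 : r ^ (1 + 2 * s) = r * r ^ (2 * s) := by rw [Real.rpow_add hr, Real.rpow_one]
  have hp2 : r ^ (2 + 2 * s) = r ^ 2 * r ^ (2 * s) := by
    rw [Real.rpow_add hr, Real.rpow_two]
  have hrs : 0 < r ^ (2 * s) := Real.rpow_pos_of_pos hr _
  have fin : ∀ a b c d : ℝ, 0 ≤ a → 0 ≤ c → 0 ≤ d → C₁ * (a + C₂ * Minf + c + d) ≤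
      C₁ * (1 + C₂) * (a + Minf + c + d) := fun a b c d ha hc hd => by
    rw [mul_assoc]
    refine mul_le_mul_of_nonneg_left ?_ hC₁.le
    have : 0 ≤ C₂ * (a + c + d) := by positivity
    nlinarith
  constructor
  · intro N G₀ hG₀ hkG hN
    have hN0 : 0 ≤ N := (abs_nonneg _).trans (hN y (by linarith))
    refine le_trans ?_ (fin _ 0 _ _ (by positivity) hN0 (Real.sqrt_nonneg _))
    have key : ∀ ε > 0, r * dd n e u y ≤ C₁ * (r ^ (1 + 2 * s) * (G + ε) + C₂ * Minf + N +
        √(N * (r ^ (2 * s) * (G₀ + ε)))) := fun ε hε => by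
      have := H s hs e he _ _ sU.continuous sV.continuous ⟨M, fun x => hMu _⟩ ⟨_, bV⟩
        ⟨_, lipU⟩ lU dU dV N (C₂ * Minf) (r ^ (1 + 2 * s) * (G + ε)) (r ^ (2 * s) * (G₀ + ε))
        hN0 (by positivity) (by positivity) (by positivity) (fun x hx => hN _ (hin x hx)) ?_
      · simpa using this
      · intro x hx
        have hxR := hin x (by linarith)
        obtain ⟨i, hi, hi', -⟩ := exists_near_maximizer hn hs hl hl1 hL hu hMu hMu' hMu'' hB hle he
          (hex _ hxR) (hG _ hxR) hxR hε
        refine ⟨B i, hB i, (hT i x).1, (hT i x).2.1, ?_, ?_⟩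
        · rw [symOp_comp_affine _ _ _ _ _ hr, ← mul_neg]
          refine mul_le_mul_of_nonneg_left ?_ hrs.le
          linarith [hkG _ hxR i]
        · rw [symOp_const_mul, symOp_comp_affine s (B i) (dd n e u) x y hr, hp1, mul_assoc]
          gcongr
          exact (le_abs_self _).trans hi'
    simpa using le_of_forall_pos_le_continuous (F := fun ε => C₁ * (r ^ (1 + 2 * s) * (G + ε) +
      C₂ * Minf + N + √(N * (r ^ (2 * s) * (G₀ + ε))))) (by fun_prop) key
  · intro N G₂ hG₂ hkG hN
    have hN0 : 0 ≤ N := (mul_nonneg hr.le (abs_nonneg _)).trans (hN y (by simpa using hr))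
    refine le_trans ?_ (fin _ 0 _ _ (by positivity) hN0 (Real.sqrt_nonneg _))
    have key : ∀ ε > 0, r ^ 2 * dd2 n e u y ≤ C₁ * (r ^ (2 + 2 * s) * (G₂ + ε) + C₂ * Minf + N +
        √(N * (r ^ (1 + 2 * s) * (G + ε)))) := fun ε hε => by
      have := H s hs e he _ _ sV.continuous sW.continuous ⟨_, bV⟩ ⟨_, bW⟩
        ⟨_, lipV⟩ lV dV dW N (C₂ * Minf) (r ^ (2 + 2 * s) * (G₂ + ε)) (r ^ (1 + 2 * s) * (G + ε))
        hN0 (by positivity) (by positivity) (by positivity) (fun x hx => ?_) ?_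
      · simpa using this
      · rw [abs_mul, abs_of_pos hr]
        refine hN _ ?_
        rw [add_sub_cancel_left, norm_smul, Real.norm_of_nonneg hr.le]
        nlinarith
      · intro x hx
        have hxR := hin x (by linarith)
        obtain ⟨i, -, hi', hi''⟩ := exists_near_maximizer hn hs hl hl1 hL hu hMu hMu' hMu'' hB hle
          he (hex _ hxR) (hG _ hxR) hxR hε
        refine ⟨B i, hB i, (hT i x).2.1, (hT i x).2.2, ?_, ?_⟩
        · rw [symOp_const_mul, symOp_comp_affine s (B i) (dd n e u) x y hr, hp1, mul_assoc,
            ← mul_neg, ← mul_neg]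
          gcongr
          exact (abs_le.1 hi').1
        · rw [symOp_const_mul, symOp_comp_affine s (B i) (dd2 n e u) x y hr, hp2, mul_assoc]
          gcongr
          exact hi'' _ (hkG _ hxR)
    simpa using le_of_forall_pos_le_continuous (F := fun ε => C₁ * (r ^ (2 + 2 * s) * (G₂ + ε) +
      C₂ * Minf + N + √(N * (r ^ (1 + 2 * s) * (G + ε))))) (by fun_prop) key

/-- Interior estimates for directional derivatives of solutions of an abstract extremal equation. -/
lemma extremal_estimates {n : ℕ} (hn : 0 < n) {lam Lam : ℝ} (hl : 0 < lam) (hl1 : lam ≤ 1)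
    (hL : 1 ≤ Lam) : ∃ C : ℝ, 0 < C ∧ ∀ s ∈ Ioo (0:ℝ) 1, ∀ u : En n → ℝ,
    ContDiff ℝ (⊤ : ℕ∞) u → ∀ M : ℝ,
    (∀ x, |u x| ≤ M ∧ ‖fderiv ℝ u x‖ ≤ M ∧ ‖fderiv ℝ (fderiv ℝ u) x‖ ≤ M) →
    ∀ {ι : Type} (B : ι → En n →L[ℝ] En n) (k : ι → En n → ℝ) (R : ℝ), 0 < R →
    (∀ i, Elliptic lam Lam (B i)) →
    (∀ x, ‖x‖ < R → ∀ i, symOp s (B i) u x ≤ k i x) →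
    (∀ x, ‖x‖ < R → ∀ ε > 0, ∃ i, k i x - ε ≤ symOp s (B i) u x) →
    ∀ Minf MR G₀ : ℝ, (∀ x, |u x| ≤ Minf) → (∀ x, ‖x‖ < R → |u x| ≤ MR) → 0 ≤ G₀ →
    (∀ x, ‖x‖ < R → ∀ i, -G₀ ≤ k i x) →
    ∀ e : En n, ‖e‖ = 1 → ∀ G : ℝ, 0 ≤ G →
    (∀ x, ‖x‖ < R → ∀ i (h : ℝ), ‖x + h • e‖ < R → |k i (x + h • e) - k i x| ≤ G * |h|) →
    (∀ x, ‖x‖ < 3 / 4 * R →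
      |dd n e u x| ≤ C / R * (Minf + R ^ s * √G₀ * √MR + R ^ (1 + 2 * s) * G)) ∧
    (∀ G₂, 0 ≤ G₂ → (∀ x, ‖x‖ < R → ∀ i (h : ℝ), ‖x + h • e‖ < R → ‖x - h • e‖ < R →
        k i (x + h • e) + k i (x - h • e) - 2 * k i x ≤ G₂ * h ^ 2) →
      ∀ x, ‖x‖ < R / 2 →
      dd2 n e u x ≤ C / R ^ 2 * (Minf + R ^ s * √G₀ * √MR + R ^ (1 + 2 * s) * G
        + R ^ (2 + 2 * s) * G₂)) := by
  obtain ⟨C, hC, H⟩ := scaled_bounds hn hl hl1 hL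
  refine ⟨8 * C + 16 * C * (2 + 4 * C), by positivity, ?_⟩
  intro s hs u hu M hM ι B k R hR hB hle hex Minf MR G₀ hMinf hMR hG₀ hkG₀ e he G hG0 hG
  have hs0 := hs.1
  set Q := Minf + R ^ s * √G₀ * √MR + R ^ (1 + 2 * s) * G with hQ
  have hMinf0 : 0 ≤ Minf := (abs_nonneg _).trans (hMinf 0)
  have hMR0 : 0 ≤ MR := (abs_nonneg _).trans (hMR 0 (by simpa using hR))
  set N := min MR Minf with hN
  have hN0 : 0 ≤ N := le_min hMR0 hMinf0
  have hNu : ∀ x, ‖x‖ < R → |u x| ≤ N := fun x hx => le_min (hMR x hx) (hMinf x)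
  set r := R / 4 with hr
  have hr0 : 0 < r := by positivity
  have hrR : r ≤ R := by linarith
  have hpow : ∀ a : ℝ, 0 ≤ a → r ^ a ≤ R ^ a := fun a ha => Real.rpow_le_rpow hr0.le hrR ha
  have hp1 := hpow (1 + 2 * s) (by linarith)
  have hp2 := hpow (2 + 2 * s) (by linarith)
  have hR1 : 0 < R ^ (1 + 2 * s) := Real.rpow_pos_of_pos hR _
  have hR2 : 0 < R ^ (2 + 2 * s) := Real.rpow_pos_of_pos hR _
  have hRs : 0 < R ^ s := Real.rpow_pos_of_pos hR _
  have hQ0 : 0 ≤ Q := by positivity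
  have hG1 : r ^ (1 + 2 * s) * G ≤ Q := by
    have h1 : r ^ (1 + 2 * s) * G ≤ R ^ (1 + 2 * s) * G := mul_le_mul_of_nonneg_right hp1 hG0
    have h2 : 0 ≤ Minf + R ^ s * √G₀ * √MR := by positivity
    linarith
  have hsq : √(N * (r ^ (2 * s) * G₀)) ≤ R ^ s * √G₀ * √MR := by
    have h1 : r ^ (2 * s) = (r ^ s) ^ 2 := by
      rw [← Real.rpow_natCast, ← Real.rpow_mul hr0.le, mul_comm]; norm_num
    rw [h1, Real.sqrt_mul hN0, Real.sqrt_mul (sq_nonneg _),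
      Real.sqrt_sq (Real.rpow_nonneg hr0.le _), mul_comm]
    have h2 : √N ≤ √MR := Real.sqrt_le_sqrt (min_le_left _ _)
    have h3 := hpow s hs0.le
    gcongr
  have one_side : ∀ e' : En n, ‖e'‖ = 1 → (∀ x, ‖x‖ < R → ∀ i (h : ℝ), ‖x + h • e'‖ < R →
      |k i (x + h • e') - k i x| ≤ G * |h|) → ∀ x, ‖x‖ < 3 / 4 * R →
      r * dd n e' u x ≤ 2 * C * Q := fun e' he' hG' x hx => by
    have := (H s hs u hu M hM B k R hB hle hex e' he' Minf G hMinf hG0 hG' x r hr0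
      (by linarith)).1 N G₀ hG₀ hkG₀ hNu
    refine this.trans ?_
    rw [mul_comm 2 C, mul_assoc]
    refine mul_le_mul_of_nonneg_left ?_ hC.le
    have h1 : N ≤ Minf := min_le_right _ _
    have h2 : r ^ (1 + 2 * s) * G ≤ R ^ (1 + 2 * s) * G := mul_le_mul_of_nonneg_right hp1 hG0
    have h3 : 0 ≤ R ^ s * √G₀ * √MR := by positivity
    have h4 : 0 ≤ R ^ (1 + 2 * s) * G := by positivity
    linarith
  have two_side : ∀ x, ‖x‖ < 3 / 4 * R → r * |dd n e u x| ≤ 2 * C * Q := fun x hx => by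
    have h1 := one_side e he hG x hx
    have h2 := one_side (-e) (by rwa [norm_neg]) (fun x hx i h hh => by
      have := hG x hx i (-h)
      simp only [neg_smul, abs_neg] at this
      rw [smul_neg] at hh ⊢
      exact this hh) x hx
    rw [dd_neg] at h2
    rcases abs_cases (dd n e u x) with ⟨h, -⟩ | ⟨h, -⟩ <;> rw [h] <;> assumption
  have hCC : 0 ≤ 16 * C * (2 + 4 * C) := by positivity
  constructor
  · intro x hx
    have := two_side x hx
    rw [div_mul_eq_mul_div, le_div_iff₀ hR]
    rw [hr] at this
    have h2 := mul_nonneg hCC hQ0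
    nlinarith
  · intro G₂ hG₂ hkG x hx
    have key := (H s hs u hu M hM B k R hB hle hex e he Minf G hMinf hG0 hG x r hr0
      (by linarith)).2 (2 * C * Q) G₂ hG₂ hkG fun z hz => two_side z (by
        have := norm_add_le x (z - x)
        rw [add_sub_cancel] at this
        linarith)
    have hN1 : 0 ≤ 2 * C * Q := by positivity
    have hG1' : 0 ≤ r ^ (1 + 2 * s) * G := by positivity
    have h1 : √(2 * C * Q * (r ^ (1 + 2 * s) * G)) ≤ 2 * C * Q + r ^ (1 + 2 * s) * G := by
      rw [Real.sqrt_le_left (by positivity)]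
      nlinarith [mul_nonneg hN1 hG1']
    have h2 : r ^ (2 + 2 * s) * G₂ ≤ R ^ (2 + 2 * s) * G₂ := mul_le_mul_of_nonneg_right hp2 hG₂
    have h3 : Minf ≤ Q := by
      have : 0 ≤ R ^ s * √G₀ * √MR + R ^ (1 + 2 * s) * G := by positivity
      linarith
    have hY : 0 ≤ R ^ (2 + 2 * s) * G₂ := by positivity
    have h4 : r ^ 2 * dd2 n e u x ≤ C * (2 + 4 * C) * (Q + R ^ (2 + 2 * s) * G₂) := by
      refine key.trans ?_
      rw [mul_assoc C (2 + 4 * C)]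
      refine mul_le_mul_of_nonneg_left ?_ hC.le
      have : 0 ≤ C * (R ^ (2 + 2 * s) * G₂) := by positivity
      nlinarith
    rw [div_mul_eq_mul_div, le_div_iff₀ (by positivity)]
    have h5 : 0 ≤ 8 * C * (Q + R ^ (2 + 2 * s) * G₂) := by positivity
    calc dd2 n e u x * R ^ 2 = 16 * (r ^ 2 * dd2 n e u x) := by rw [hr]; ring
      _ ≤ 16 * (C * (2 + 4 * C) * (Q + R ^ (2 + 2 * s) * G₂)) := by linarith
      _ ≤ 8 * C * (Q + R ^ (2 + 2 * s) * G₂) +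
          16 * (C * (2 + 4 * C) * (Q + R ^ (2 + 2 * s) * G₂)) := by linarith
      _ = _ := by ring

/-- first and one-sided second derivative estimates for the Pucci-type
maximal equation `sup_{A∈𝒜} (𝓛_A u − g_A) = f` in `B_R`, with a constant `C` depending
only on `n`, `λ`, `Λ`. -/
theorem pucci_affine_estimates (n : ℕ) (hn : 0 < n)
    (lam Lam : ℝ) (hlam : 0 < lam) (hLam : lam ≤ Lam) :
    ∃ C : ℝ, 0 < C ∧
    ∀ (s : ℝ), s ∈ Set.Ioo (0:ℝ) 1 →
    ∀ (R : ℝ), 0 < R →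
    ∀ (f : En n → ℝ) (g : Matrix (Fin n) (Fin n) ℝ → En n → ℝ) (u : En n → ℝ),
      (∃ Lf : ℝ≥0, LipschitzOnWith Lf f (ball (0 : En n) R)) →
      (∀ A, inEllipticClass n lam Lam A →
        ∃ Lg : ℝ≥0, LipschitzOnWith Lg (g A) (ball (0 : En n) R)) →
      -- continuity of `g_A` in `A`
      (∀ (Ak : ℕ → Matrix (Fin n) (Fin n) ℝ) (A : Matrix (Fin n) (Fin n) ℝ),
        (∀ k, inEllipticClass n lam Lam (Ak k)) → inEllipticClass n lam Lam A →
        Tendsto Ak atTop (nhds A) →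
        ∀ x ∈ ball (0 : En n) R, Tendsto (fun k => g (Ak k) x) atTop (nhds (g A x))) →
      ContDiff ℝ (⊤ : ℕ∞) u →
      (∃ Mu : ℝ, ∀ x, |u x| ≤ Mu ∧ ‖fderiv ℝ u x‖ ≤ Mu ∧ ‖fderiv ℝ (fderiv ℝ u) x‖ ≤ Mu) →
      -- the equation `sup_{A∈𝒜} (𝓛_A u(x) − g_A(x)) = f(x)` for all `x ∈ B_R`
      (∀ x ∈ ball (0 : En n) R,
        IsLUB {t : ℝ | ∃ A, inEllipticClass n lam Lam A ∧ t = opA n s A u x - g A x} (f x)) →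
    ∀ (Minf MR G₀ G₁ : ℝ),
      (∀ x : En n, |u x| ≤ Minf) →
      (∀ x ∈ ball (0 : En n) R, |u x| ≤ MR) →
      0 ≤ G₀ → (∀ x ∈ ball (0 : En n) R, ∀ A, inEllipticClass n lam Lam A →
          -G₀ ≤ f x + g A x) →
      0 ≤ G₁ → (∀ A, inEllipticClass n lam Lam A →
          ∀ x ∈ ball (0 : En n) R, ∀ y ∈ ball (0 : En n) R,
            |(f x + g A x) - (f y + g A y)| ≤ G₁ * dist x y) →
      -- first derivative estimate
      ((∀ x ∈ ball (0 : En n) (R/2),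
          ‖fderiv ℝ u x‖ ≤
            C / R * (Minf + R ^ s * Real.sqrt G₀ * Real.sqrt MR + R ^ (1 + 2*s) * G₁))
      ∧
      -- one-sided second derivative estimate under semiconcavity
      (∀ e : En n, ‖e‖ = 1 →
        (∀ A, inEllipticClass n lam Lam A → ∃ c : ℝ,
          ConcaveOn ℝ (ball (0 : En n) R) (fun x => f x + g A x - c * ‖x‖^2)) →
        ∀ (Ge1 Ge2 : ℝ), 0 ≤ Ge1 → 0 ≤ Ge2 →
        (∀ A, inEllipticClass n lam Lam A →
          ∀ x ∈ ball (0 : En n) R, ∀ h : ℝ, x + h • e ∈ ball (0 : En n) R →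
            |(f (x + h • e) + g A (x + h • e)) - (f x + g A x)| ≤ Ge1 * |h|) →
        (∀ A, inEllipticClass n lam Lam A →
          ∀ x ∈ ball (0 : En n) R, ∀ h : ℝ,
            x + h • e ∈ ball (0 : En n) R → x - h • e ∈ ball (0 : En n) R →
            (f (x + h • e) + g A (x + h • e)) + (f (x - h • e) + g A (x - h • e))
              - 2 * (f x + g A x) ≤ Ge2 * h^2) →
        ∀ x ∈ ball (0 : En n) (R/2),
          dd2 n e u x ≤
            C / R^2 * (Minf + R ^ s * Real.sqrt G₀ * Real.sqrt MR
              + R ^ (1 + 2*s) * Ge1 + R ^ (2 + 2*s) * Ge2))) := by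
  obtain ⟨C, hC, H⟩ := extremal_estimates hn (lt_min hlam one_pos) (min_le_right lam 1)
    (le_max_right Lam 1)
  refine ⟨C, hC, ?_⟩
  intro s hs R hR f g u _ _ _ hu ⟨M, hM⟩ heq Minf MR G₀ G₁ hMinf hMR hG₀ hfG₀ hG₁ hfG₁
  have hell : ∀ A, inEllipticClass n lam Lam A → Elliptic (min lam 1) (max Lam 1) (matCLM A) :=
    fun A hA z => by
      have h := hA.elliptic hlam z
      exact ⟨le_trans (mul_le_mul_of_nonneg_right (min_le_left _ _) (norm_nonneg _)) h.1,
        h.2.trans (mul_le_mul_of_nonneg_right (le_max_left _ _) (norm_nonneg _))⟩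
  have hop : ∀ A, inEllipticClass n lam Lam A → ∀ x,
      opA n s A u x = symOp s (matCLM A) u x := fun A hA x => by
    obtain ⟨D, -, hD⟩ := second_diff_le_smooth hu (fun x => (hM x).1) ‖x‖
    exact opA_eq_symOp hn hs (lt_min hlam one_pos) (min_le_right lam 1) (hell A hA) hu.continuous
      (fun x => (hM x).1) (hD x le_rfl)
  simp only [mem_ball_zero_iff] at heq hMR hfG₀ hfG₁ ⊢
  have H' := H s hs u hu M hM (ι := {A // inEllipticClass n lam Lam A}) (fun A => matCLM A.1)
    (fun A x => f x + g A.1 x) R hR (fun A => hell A.1 A.2)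
    (fun x hx A => by
      have := (heq x hx).1 ⟨A.1, A.2, rfl⟩
      rw [hop A.1 A.2] at this
      linarith)
    (fun x hx ε hε => by
      obtain ⟨t, ⟨A, hA, rfl⟩, ht, -⟩ := (heq x hx).exists_between (sub_lt_self _ hε)
      rw [hop A hA] at ht
      exact ⟨⟨A, hA⟩, by dsimp only; linarith⟩)
    Minf MR G₀ hMinf hMR hG₀ (fun x hx A => hfG₀ x hx A.1 A.2)
  constructor
  · intro x hx
    have h1 : ∀ e : En n, ‖e‖ = 1 → |dd n e u x| ≤
        C / R * (Minf + R ^ s * √G₀ * √MR + R ^ (1 + 2 * s) * G₁) := fun e he =>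
      (H' e he G₁ hG₁ (fun x hx A h hh => by
        have := hfG₁ A.1 A.2 _ hh x hx
        rwa [dist_eq_norm, add_sub_cancel_left, norm_smul, he, mul_one, Real.norm_eq_abs] at this)).1
        x (by linarith)
    have := nontrivial_En hn
    obtain ⟨e, he⟩ := exists_norm_eq (En n) zero_le_one
    exact ContinuousLinearMap.opNorm_le_of_unit_norm ((abs_nonneg _).trans (h1 e he)) h1
  · intro e he _ Ge1 Ge2 hGe1 hGe2 h1 h2 x hx
    exact (H' e he Ge1 hGe1 (fun x hx A h hh => h1 A.1 A.2 x hx h hh)).2 Ge2 hGe2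
      (fun x hx A h hh hh' => h2 A.1 A.2 x hx h hh hh') x hx
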